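/- There exists a constant C > 0, depending only on Ω, such that for every λ > 0: (i) for every Neumann eigenfunction φ of Ω with eigenvalue λ², the number of connected components of the nodal set {x ∈ cl(Ω) : φ(x) = 0} that intersect ∂Ω is at most C(1 + λ); and (ii) for every Dirichlet eigenfunction φ of Ω with eigenvalue λ², the number of connected components of {x ∈ Ω : φ(x) = 0} whose closure intersects ∂Ω is at most C(1 + λ). -/

import Mathlib

open MeasureTheory

/-- The Euclidean Laplacian of a function on ℝ², as the sum of its second
partial derivatives. -/
noncomputable def lap2 (φ : EuclideanSpace ℝ (Fin 2) → ℝ) (x : EuclideanSpace ℝ (Fin 2)) : ℝ :=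
  ∑ i, fderiv ℝ (fun y => fderiv ℝ φ y (EuclideanSpace.single i 1)) x (EuclideanSpace.single i 1)

/-- φ is a Neumann eigenfunction of Ω (with boundary parametrized by γ) with
eigenvalue λ². -/
def IsNeumannEigenfunction (Ω : Set (EuclideanSpace ℝ (Fin 2)))
    (γ : ℝ → EuclideanSpace ℝ (Fin 2)) (lam : ℝ)
    (φ : EuclideanSpace ℝ (Fin 2) → ℝ) : Prop :=
  (∃ U : Set (EuclideanSpace ℝ (Fin 2)), IsOpen U ∧ closure Ω ⊆ U ∧ ContDiffOn ℝ (⊤ : ℕ∞) φ U)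
  ∧ ¬ Set.EqOn φ 0 (closure Ω)
  ∧ (∀ x ∈ Ω, lap2 φ x = -lam ^ 2 * φ x)
  ∧ (∀ t : ℝ, ∃ c : ℝ, gradient φ (γ t) = c • deriv γ t)

/-- φ is a Dirichlet eigenfunction of Ω (with boundary parametrized by γ) with
eigenvalue λ². -/
def IsDirichletEigenfunction (Ω : Set (EuclideanSpace ℝ (Fin 2)))
    (γ : ℝ → EuclideanSpace ℝ (Fin 2)) (lam : ℝ)
    (φ : EuclideanSpace ℝ (Fin 2) → ℝ) : Prop :=
  (∃ U : Set (EuclideanSpace ℝ (Fin 2)), IsOpen U ∧ closure Ω ⊆ U ∧ ContDiffOn ℝ (⊤ : ℕ∞) φ U)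
  ∧ ¬ Set.EqOn φ 0 (closure Ω)
  ∧ (∀ x ∈ Ω, lap2 φ x = -lam ^ 2 * φ x)
  ∧ (∀ t : ℝ, φ (γ t) = 0)

/-- The collection of connected components of a set Z, i.e. of the subsets of Z
of the form `connectedComponentIn Z x` for x ∈ Z. -/
def componentsOf {α : Type*} [TopologicalSpace α] (Z : Set α) : Set (Set α) :=
  {S | ∃ x ∈ Z, S = connectedComponentIn Z x}

open Set Filter Topology

/-- The entire function `x ↦ ∑ (-x)^k / (k! (k+m)!)`, i.e. `x^(-m/2) J_m(2 √x)`. -/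
noncomputable def besselSeries (m : ℕ) (x : ℂ) : ℂ :=
  ∑' k : ℕ, (-x) ^ k / ((k.factorial : ℂ) * ((k + m).factorial : ℂ))

theorem norm_besselSeries_term_le (m k : ℕ) (x : ℂ) :
    ‖(-x) ^ k / ((k.factorial : ℂ) * ((k + m).factorial : ℂ))‖
      ≤ Real.exp √‖x‖ * (√‖x‖ ^ k / k.factorial) := by
  have h1 : √‖x‖ ^ k / k.factorial ≤ Real.exp √‖x‖ :=
    Real.pow_div_factorial_le_exp _ (Real.sqrt_nonneg _) k
  have h2 : ‖x‖ ^ k = √‖x‖ ^ k * √‖x‖ ^ k := by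
    rw [← mul_pow, Real.mul_self_sqrt (norm_nonneg _)]
  have hk : (0 : ℝ) < k.factorial := by positivity
  have h3 : (k.factorial : ℝ) ≤ (k + m).factorial := by
    exact_mod_cast Nat.factorial_le (Nat.le_add_right k m)
  rw [norm_div, norm_pow, norm_neg, norm_mul, Complex.norm_natCast, Complex.norm_natCast, h2]
  calc √‖x‖ ^ k * √‖x‖ ^ k / (k.factorial * (k + m).factorial)
      ≤ √‖x‖ ^ k * √‖x‖ ^ k / (k.factorial * k.factorial) := by gcongr
    _ = (√‖x‖ ^ k / k.factorial) * (√‖x‖ ^ k / k.factorial) := by field_simp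
    _ ≤ _ := by gcongr

theorem summable_besselSeries (m : ℕ) (x : ℂ) :
    Summable fun k : ℕ => (-x) ^ k / ((k.factorial : ℂ) * ((k + m).factorial : ℂ)) :=
  Summable.of_norm_bounded ((Real.summable_pow_div_factorial _).mul_left _)
    (fun k => norm_besselSeries_term_le m k x)

theorem norm_besselSeries_le (m : ℕ) (x : ℂ) :
    ‖besselSeries m x‖ ≤ Real.exp (2 * √‖x‖) := by
  have h := tsum_of_norm_bounded
    (((Real.summable_pow_div_factorial (√‖x‖)).mul_left (Real.exp √‖x‖)).hasSum)
    (fun k => norm_besselSeries_term_le m k x)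
  refine h.trans (le_of_eq ?_)
  rw [tsum_mul_left, ← congrFun NormedSpace.exp_eq_tsum_div (√‖x‖), ← Real.exp_eq_exp_ℝ,
    ← Real.exp_add, two_mul]

theorem hasDerivAt_besselSeries (m : ℕ) (x : ℂ) :
    HasDerivAt (besselSeries m) (-besselSeries (m + 1) x) x := by
  set r := ‖x‖ + 1
  have hr : 0 < r := by positivity
  let g : ℕ → ℂ → ℂ := fun k x => (-x) ^ k / ((k.factorial : ℂ) * ((k + m).factorial : ℂ))
  let g' : ℕ → ℂ → ℂ := fun k x =>
    -((k : ℂ) * (-x) ^ (k - 1) / ((k.factorial : ℂ) * ((k + m).factorial : ℂ)))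
  have hg : ∀ k y, HasDerivAt (g k) (g' k y) y := by
    intro k y
    have := (((hasDerivAt_id y).neg).pow k).div_const ((k.factorial : ℂ) * ((k + m).factorial : ℂ))
    refine this.congr_deriv ?_
    simp [g']
    ring
  have hshift : ∀ k y, g' (k + 1) y
      = -((-y) ^ k / ((k.factorial : ℂ) * ((k + (m + 1)).factorial : ℂ))) := by
    intro k y
    have h1 : ((k + 1).factorial : ℂ) = (k + 1) * k.factorial := by
      push_cast [Nat.factorial_succ]; ring
    have h2 : k + 1 + m = k + (m + 1) := by ring
    have h3 : (k.factorial : ℂ) ≠ 0 := by exact_mod_cast k.factorial_ne_zero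
    have h4 : ((k : ℂ) + 1) ≠ 0 := by exact_mod_cast k.succ_ne_zero
    have h5 : ((k + (m + 1)).factorial : ℂ) ≠ 0 := by exact_mod_cast Nat.factorial_ne_zero _
    simp only [g', h1, h2]
    push_cast
    field_simp
  let u : ℕ → ℝ := fun k => Nat.casesOn k 0
    (fun k => Real.exp √r * (√r ^ k / k.factorial))
  have hu : Summable u := by
    rw [← summable_nat_add_iff 1]
    exact (Real.summable_pow_div_factorial _).mul_left _
  have hb : ∀ k y, y ∈ Metric.ball (0 : ℂ) r → ‖g' k y‖ ≤ u k := by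
    intro k y hy
    have hy' : ‖y‖ ≤ r := (mem_ball_zero_iff.1 hy).le
    cases k with
    | zero => simp [g', u]
    | succ k =>
      rw [hshift, norm_neg]
      refine (norm_besselSeries_term_le (m + 1) k y).trans ?_
      simp only [u]
      gcongr
  have hx : x ∈ Metric.ball (0 : ℂ) r := by simp [r]
  have key := hasDerivAt_tsum_of_isPreconnected hu Metric.isOpen_ball
    (convex_ball (0 : ℂ) r).isPreconnected (fun k y _ => hg k y) hb hx
    (summable_besselSeries m x) hx
  refine key.congr_deriv ?_
  have hs : Summable fun k => g' k x := Summable.of_norm_bounded hu (fun k => hb k x hx)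
  rw [hs.tsum_eq_zero_add]
  simp only [hshift, tsum_neg]
  simp [g', besselSeries]

theorem besselSeries_zero (m : ℕ) : besselSeries m 0 = 1 / m.factorial := by
  unfold besselSeries
  rw [tsum_eq_single 0]
  · simp
  · intro k hk; simp [hk]

theorem besselSeries_rec (x : ℂ) :
    x * besselSeries 2 x - besselSeries 1 x + besselSeries 0 x = 0 := by
  have h0 := (summable_besselSeries 0 x).tsum_eq_zero_add
  have h1 := (summable_besselSeries 1 x).tsum_eq_zero_add
  have e0 : besselSeries 0 x = _ := h0
  have e1 : besselSeries 1 x = _ := h1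
  have s0 := (summable_nat_add_iff 1).2 (summable_besselSeries 0 x)
  have s1 := (summable_nat_add_iff 1).2 (summable_besselSeries 1 x)
  have e2 : x * besselSeries 2 x = ∑' k : ℕ, x * ((-x) ^ k / ((k.factorial : ℂ) * ((k + 2).factorial : ℂ))) := by
    rw [tsum_mul_left]; rfl
  have s2 := (summable_besselSeries 2 x).mul_left x
  rw [e0, e1, e2]
  simp only [pow_zero, Nat.factorial_zero, Nat.cast_one, zero_add, Nat.factorial_one, mul_one]
  rw [show ∀ a b c d : ℂ, a - (b + c) + (b + d) = a - c + d by intros; ring]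
  rw [← s2.tsum_sub s1, ← (s2.sub s1).tsum_add s0]
  convert tsum_zero with k
  have h1 : ((k + 1).factorial : ℂ) = (k + 1) * k.factorial := by
    push_cast [Nat.factorial_succ]; ring
  have h3 : (k.factorial : ℂ) ≠ 0 := by exact_mod_cast k.factorial_ne_zero
  have h4 : ((k : ℂ) + 1) ≠ 0 := by exact_mod_cast k.succ_ne_zero
  have h4' : ((k : ℂ) + 2) ≠ 0 := by exact_mod_cast (k+1).succ_ne_zero
  have h5 : ((k + 1 + 1).factorial : ℂ) = (k + 2) * ((k + 1) * k.factorial) := by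
    push_cast [Nat.factorial_succ]; ring
  simp only [h5, add_zero, show k + 2 = k + 1 + 1 from rfl, h1]
  field_simp
  ring

theorem differentiable_besselSeries (m : ℕ) : Differentiable ℂ (besselSeries m) :=
  fun x => (hasDerivAt_besselSeries m x).differentiableAt

theorem contDiff_besselSeries (m : ℕ) {n : WithTop ℕ∞} : ContDiff ℂ n (besselSeries m) :=
  (differentiable_besselSeries m).contDiff

/-- Holomorphic dependence of interval integrals on a complex parameter. -/
theorem differentiableOn_intervalIntegral_of_continuousOn {U : Set ℂ} (hU : IsOpen U)
    {f : ℂ → ℝ → ℂ} {a b : ℝ}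
    (hf : ContinuousOn (Function.uncurry f) (U ×ˢ uIcc a b))
    (hd : ∀ s ∈ uIcc a b, DifferentiableOn ℂ (fun z => f z s) U) :
    DifferentiableOn ℂ (fun z => ∫ s in a..b, f z s) U := by
  intro z₀ hz₀
  obtain ⟨r, hr, hrU⟩ := Metric.isOpen_iff.1 hU z₀ hz₀
  have hK : IsCompact (Metric.closedBall z₀ (r / 2) ×ˢ uIcc a b) :=
    (isCompact_closedBall _ _).prod isCompact_uIcc
  have hsub : Metric.closedBall z₀ (r / 2) ⊆ U :=
    (Metric.closedBall_subset_ball (by linarith)).trans hrU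
  obtain ⟨M, hM⟩ := hK.exists_bound_of_continuousOn (hf.mono (prod_mono hsub Subset.rfl))
  have hcs : ∀ z ∈ U, ContinuousOn (f z) (uIcc a b) := fun z hz =>
    hf.comp (continuousOn_const.prodMk continuousOn_id) (fun s hs => ⟨hz, hs⟩)
  -- difference quotients give measurability of the derivative
  have hderiv : ∀ s ∈ uIcc a b, ∀ z ∈ Metric.ball z₀ (r / 4), ‖deriv (fun z => f z s) z‖ ≤ M / (r / 4) := by
    intro s hs z hz
    have hz' : Metric.closedBall z (r / 4) ⊆ Metric.closedBall z₀ (r / 2) := by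
      intro w hw
      have h1 := Metric.mem_closedBall.1 hw
      have h2 := Metric.mem_ball.1 hz
      have := dist_triangle w z z₀
      exact Metric.mem_closedBall.2 (by linarith)
    refine Complex.norm_deriv_le_of_forall_mem_sphere_norm_le (by positivity) ?_ ?_
    · exact ((hd s hs).mono (hz'.trans hsub)).diffContOnCl_ball Subset.rfl
    · intro w hw
      exact hM (w, s) ⟨hz' (Metric.sphere_subset_closedBall hw), hs⟩
  have hmeas : AEStronglyMeasurable (fun s => deriv (fun z => f z s) z₀)
      (volume.restrict (uIoc a b)) := by
    let h : ℕ → ℂ := fun n => ((r / 4 / (n + 1) : ℝ) : ℂ)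
    refine aestronglyMeasurable_of_tendsto_ae atTop
      (f := fun n s => (h n)⁻¹ * (f (z₀ + h n) s - f z₀ s)) ?_ ?_
    · intro n
      have hn : z₀ + h n ∈ U := by
        apply hsub
        simp only [Metric.mem_closedBall, dist_self_add_left, h, Complex.norm_real, Real.norm_eq_abs]
        rw [abs_of_pos (by positivity)]
        have : r / 4 / (n + 1) ≤ r / 4 := div_le_self (by positivity) (by linarith [n.cast_nonneg (α := ℝ)])
        linarith
      exact ((continuousOn_const.mul ((hcs _ hn).sub (hcs _ hz₀))).mono
        uIoc_subset_uIcc).aestronglyMeasurable measurableSet_uIoc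
    · filter_upwards [ae_restrict_mem measurableSet_uIoc] with s hs
      have hda := ((hd s (uIoc_subset_uIcc hs)).differentiableAt (hU.mem_nhds hz₀)).hasDerivAt
      rw [hasDerivAt_iff_tendsto_slope_zero] at hda
      have hlim : Tendsto h atTop (𝓝[≠] 0) := by
        rw [tendsto_nhdsWithin_iff]
        constructor
        · have : Tendsto (fun n : ℕ => r / 4 / ((n : ℝ) + 1)) atTop (𝓝 0) :=
            tendsto_const_nhds.div_atTop (tendsto_atTop_add_const_right _ _ tendsto_natCast_atTop_atTop)
          have := (Complex.continuous_ofReal.tendsto 0).comp this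
          simpa [h, Function.comp_def] using this
        · refine Eventually.of_forall fun n => ?_
          simp only [h, mem_compl_iff, mem_singleton_iff, Complex.ofReal_eq_zero]
          positivity
      simpa [Function.comp_def] using hda.comp hlim
  have key := intervalIntegral.hasDerivAt_integral_of_dominated_loc_of_deriv_le
    (𝕜 := ℂ) (μ := volume) (F := f) (F' := fun z s => deriv (fun z => f z s) z) (x₀ := z₀)
    (a := a) (b := b) (bound := fun _ => M / (r / 4))
    (Metric.ball_mem_nhds z₀ (ε := r / 4) (by positivity)) ?_ ?_ hmeas ?_ ?_ ?_
  · exact key.2.differentiableAt.differentiableWithinAt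
  · filter_upwards [hU.mem_nhds hz₀] with z hz
    exact ((hcs z hz).mono uIoc_subset_uIcc).aestronglyMeasurable measurableSet_uIoc
  · exact (hcs z₀ hz₀).intervalIntegrable
  · exact Eventually.of_forall fun s hs z hz => hderiv s (uIoc_subset_uIcc hs) z hz
  · exact intervalIntegrable_const
  · refine Eventually.of_forall fun s hs z hz => ?_
    have hzU : z ∈ U := hrU (Metric.ball_subset_ball (by linarith) hz)
    exact ((hd s (uIoc_subset_uIcc hs)).differentiableAt (hU.mem_nhds hzU)).hasDerivAt

theorem hasDerivAt_intervalIntegral_param {g g' : ℝ → ℝ → ℂ}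
    (hg : Continuous (Function.uncurry g)) (hg' : Continuous (Function.uncurry g'))
    (hd : ∀ t s, HasDerivAt (fun t => g t s) (g' t s) t) (a b t₀ : ℝ) :
    HasDerivAt (fun t => ∫ s in a..b, g t s) (∫ s in a..b, g' t₀ s) t₀ := by
  have hK : IsCompact (Icc (t₀ - 1) (t₀ + 1) ×ˢ uIcc a b) := isCompact_Icc.prod isCompact_uIcc
  obtain ⟨M, hM⟩ := hK.exists_bound_of_continuousOn hg'.continuousOn
  have hc : ∀ t, Continuous (g t) := fun t => hg.comp (continuous_const.prodMk continuous_id)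
  have hc' : ∀ t, Continuous (g' t) := fun t => hg'.comp (continuous_const.prodMk continuous_id)
  refine (intervalIntegral.hasDerivAt_integral_of_dominated_loc_of_deriv_le
    (𝕜 := ℝ) (μ := volume) (F := g) (F' := g') (x₀ := t₀)
    (a := a) (b := b) (bound := fun _ => M)
    (Icc_mem_nhds (by linarith) (by linarith) : Icc (t₀ - 1) (t₀ + 1) ∈ 𝓝 t₀) ?_ ?_ ?_ ?_ ?_ ?_).2
  · exact Eventually.of_forall fun t => (hc t).aestronglyMeasurable
  · exact (hc t₀).intervalIntegrable _ _
  · exact (hc' t₀).aestronglyMeasurable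
  · exact Eventually.of_forall fun s hs t ht => hM (t, s) ⟨ht, uIoc_subset_uIcc hs⟩
  · exact intervalIntegrable_const
  · exact Eventually.of_forall fun s hs t ht => hd t s

/-- Leibniz integral rule with a variable upper limit. -/
theorem hasDerivAt_intervalIntegral_leibniz {g g' : ℝ → ℝ → ℂ}
    (hg : Continuous (Function.uncurry g)) (hg' : Continuous (Function.uncurry g'))
    (hd : ∀ t s, HasDerivAt (fun t => g t s) (g' t s) t) (a t₀ : ℝ) :
    HasDerivAt (fun t => ∫ s in a..t, g t s) (g t₀ t₀ + ∫ s in a..t₀, g' t₀ s) t₀ := by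
  have hc : ∀ t, Continuous (g t) := fun t => hg.comp (continuous_const.prodMk continuous_id)
  have h1 := hasDerivAt_intervalIntegral_param hg hg' hd a t₀ t₀
  have h2 : HasDerivAt (fun t => ∫ s in t₀..t, g t₀ s) (g t₀ t₀) t₀ :=
    intervalIntegral.integral_hasDerivAt_right ((hc t₀).intervalIntegrable _ _)
      ((hc t₀).stronglyMeasurableAtFilter _ _) (hc t₀).continuousAt
  have hK : IsCompact (Icc (t₀ - 1) (t₀ + 1) ×ˢ Icc (t₀ - 1) (t₀ + 1)) :=
    isCompact_Icc.prod isCompact_Icc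
  obtain ⟨M, hM⟩ := hK.exists_bound_of_continuousOn hg'.continuousOn
  have hball : ∀ t ∈ Icc (t₀ - 1) (t₀ + 1), ∀ s ∈ Icc (t₀ - 1) (t₀ + 1),
      ‖g t s - g t₀ s‖ ≤ M * ‖t - t₀‖ := fun t ht s hs =>
    (convex_Icc _ _).norm_image_sub_le_of_norm_hasDerivWithin_le
      (fun x _ => (hd x s).hasDerivWithinAt) (fun x hx => hM (x, s) ⟨hx, hs⟩)
      (by constructor <;> linarith) ht
  have h3 : HasDerivAt (fun t => ∫ s in t₀..t, (g t s - g t₀ s)) 0 t₀ := by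
    rw [hasDerivAt_iff_isLittleO]
    have : (fun t => ∫ s in t₀..t, (g t s - g t₀ s)) =O[𝓝 t₀] fun t => ‖t - t₀‖ ^ 2 := by
      refine Asymptotics.IsBigO.of_bound M ?_
      filter_upwards [Icc_mem_nhds (a := t₀ - 1) (b := t₀ + 1) (x := t₀) (by linarith)
        (by linarith)] with t ht
      refine (intervalIntegral.norm_integral_le_of_norm_le_const (C := M * ‖t - t₀‖)
        fun s hs => hball t ht s ?_).trans (le_of_eq ?_)
      · have := uIoc_subset_uIcc hs
        exact (uIcc_subset_Icc (by constructor <;> linarith) ht) this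
      · rw [norm_pow, norm_norm, Real.norm_eq_abs]; ring
    have h := this.trans_isLittleO ((Asymptotics.isLittleO_pow_sub_sub t₀ (m := 2) (by norm_num)))
    simpa using h
  refine ((h1.add h2).add h3).congr_of_eventuallyEq ?_ |>.congr_deriv (by ring)
  refine Eventually.of_forall fun t => ?_
  simp only [Pi.add_apply]
  rw [intervalIntegral.integral_sub ((hc t).intervalIntegrable _ _)
    ((hc t₀).intervalIntegrable _ _)]
  rw [add_assoc, add_sub_cancel, intervalIntegral.integral_add_adjacent_intervals
    ((hc t).intervalIntegrable _ _) ((hc t).intervalIntegrable _ _)]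

/-- The open horizontal strip of half-width `δ`. -/
def strip (δ : ℝ) : Set ℂ := {z | |z.im| < δ}

/-- The upper half of the strip, including the real axis. -/
def upStrip (δ : ℝ) : Set ℂ := {z | 0 ≤ z.im ∧ z.im < δ}

/-- The open upper half of the strip. -/
def upStripInt (δ : ℝ) : Set ℂ := {z | 0 < z.im ∧ z.im < δ}

/-- A holomorphic collar of the boundary of `Ω`: the map `Γ` is `L`-periodic, injective modulo `L`,
parametrizes the boundary by the real axis and maps the upper half-strip into `Ω`. -/
structure Collar (Ω : Set ℂ) (Γ : ℂ → ℂ) (L δ : ℝ) : Prop where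
  isOpen : IsOpen Ω
  bdd : Bornology.IsBounded Ω
  L_pos : 0 < L
  δ_pos : 0 < δ
  diff : DifferentiableOn ℂ Γ (strip δ)
  per : ∀ z ∈ strip δ, Γ (z + L) = Γ z
  inj : ∀ z ∈ strip δ, ∀ w ∈ strip δ, Γ z = Γ w → ∃ k : ℤ, w = z + k * L
  deriv_ne : ∀ z ∈ strip δ, deriv Γ z ≠ 0
  deriv_bdd : ∃ K, ∀ z ∈ strip δ, ‖deriv Γ z‖ ≤ K
  front : frontier Ω = Γ '' {z | z.im = 0}
  inside : ∀ z ∈ upStripInt δ, Γ z ∈ Ω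
  outside : ∀ z, -δ < z.im → z.im < 0 → Γ z ∉ closure Ω

theorem isOpen_strip (δ : ℝ) : IsOpen (strip δ) :=
  isOpen_lt (Complex.continuous_im.abs) continuous_const

theorem isOpen_upStripInt (δ : ℝ) : IsOpen (upStripInt δ) :=
  (isOpen_lt continuous_const Complex.continuous_im).inter
    (isOpen_lt Complex.continuous_im continuous_const)

theorem convex_upStrip (δ : ℝ) : Convex ℝ (upStrip δ) :=
  (convex_halfSpace_im_ge 0).inter (convex_halfSpace_im_lt δ)

theorem convex_upStripInt (δ : ℝ) : Convex ℝ (upStripInt δ) :=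
  (convex_halfSpace_im_gt 0).inter (convex_halfSpace_im_lt δ)

theorem upStripInt_subset (δ : ℝ) : upStripInt δ ⊆ upStrip δ := fun _ h => ⟨h.1.le, h.2⟩

theorem upStrip_subset (δ : ℝ) : upStrip δ ⊆ strip δ := fun z h => by
  have h1 := h.1
  have h2 := h.2
  simp only [strip, mem_ofPred_eq, abs_lt]
  constructor <;> linarith

namespace Collar

variable {Ω : Set ℂ} {Γ : ℂ → ℂ} {L δ : ℝ}

theorem hasDerivAt (hC : Collar Ω Γ L δ) {z : ℂ} (hz : z ∈ strip δ) :
    HasDerivAt Γ (deriv Γ z) z :=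
  (hC.diff.differentiableAt ((isOpen_strip δ).mem_nhds hz)).hasDerivAt

theorem analyticAt (hC : Collar Ω Γ L δ) {z : ℂ} (hz : z ∈ strip δ) : AnalyticAt ℂ Γ z :=
  hC.diff.analyticAt ((isOpen_strip δ).mem_nhds hz)

theorem hasStrictDerivAt (hC : Collar Ω Γ L δ) {z : ℂ} (hz : z ∈ strip δ) :
    HasStrictDerivAt Γ (deriv Γ z) z :=
  ((hC.analyticAt hz).contDiffAt (n := 1)).hasStrictDerivAt (by norm_num)

theorem real_mem (hC : Collar Ω Γ L δ) (t : ℝ) : (t : ℂ) ∈ upStrip δ := by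
  simp [upStrip, hC.δ_pos]

theorem per_int (hC : Collar Ω Γ L δ) {z : ℂ} (hz : z ∈ strip δ) (k : ℤ) :
    Γ (z + k * L) = Γ z := by
  induction k with
  | zero => simp
  | succ k ih =>
    rw [← ih, ← hC.per (z + ((k : ℤ) : ℂ) * L) (by simpa [strip] using hz)]
    congr 1; push_cast; ring
  | pred k ih =>
    rw [← ih, ← hC.per (z + ((-(k:ℤ) - 1 : ℤ) : ℂ) * L) (by simpa [strip] using hz)]
    congr 1; push_cast; ring

theorem map_nhds (hC : Collar Ω Γ L δ) {z : ℂ} (hz : z ∈ strip δ) :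
    map Γ (𝓝 z) = 𝓝 (Γ z) :=
  (hC.hasStrictDerivAt hz).map_nhds_eq (hC.deriv_ne z hz)

theorem isOpen_image (hC : Collar Ω Γ L δ) {U : Set ℂ} (hU : IsOpen U) (hUs : U ⊆ strip δ) :
    IsOpen (Γ '' U) := by
  rw [isOpen_iff_mem_nhds]
  rintro _ ⟨z, hz, rfl⟩
  rw [← hC.map_nhds (hUs hz)]
  exact image_mem_map (hU.mem_nhds hz)

theorem exists_re_mem (hC : Collar Ω Γ L δ) (z : ℂ) (a : ℝ) :
    ∃ k : ℤ, (z + k * L).re ∈ Icc a (a + L) ∧ (z + k * L).im = z.im := by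
  obtain ⟨k, hk, -⟩ := existsUnique_add_zsmul_mem_Ico hC.L_pos z.re a
  refine ⟨k, ?_, by simp⟩
  simp only [zsmul_eq_mul] at hk
  simpa using Ico_subset_Icc_self hk

theorem isCompact_image (hC : Collar Ω Γ L δ) {a b : ℝ} (ha : -δ < a) (hb : b < δ) :
    IsCompact (Γ '' {z | z.im ∈ Icc a b}) := by
  have hsub : {z : ℂ | z.im ∈ Icc a b} ⊆ strip δ := fun z hz => by
    simp only [strip, mem_ofPred_eq, abs_lt]
    exact ⟨ha.trans_le hz.1, hz.2.trans_lt hb⟩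
  have : Γ '' {z | z.im ∈ Icc a b} = Γ '' (Icc 0 L ×ℂ Icc a b) := by
    apply Subset.antisymm
    · rintro _ ⟨z, hz, rfl⟩
      obtain ⟨k, hk, hk'⟩ := hC.exists_re_mem z 0
      refine ⟨z + k * L, ⟨by simpa using hk, ?_⟩, hC.per_int (hsub hz) k⟩
      show (z + k * L).im ∈ Icc a b
      rw [hk']; exact hz
    · exact image_mono fun z hz => hz.2
  rw [this]
  refine (isCompact_Icc.reProdIm isCompact_Icc).image_of_continuousOn ?_
  exact hC.diff.continuousOn.mono fun z hz => hsub hz.2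

theorem mem_frontier (hC : Collar Ω Γ L δ) (t : ℝ) : Γ t ∈ frontier Ω := by
  rw [hC.front]; exact ⟨t, by simp, rfl⟩

theorem mem_closure (hC : Collar Ω Γ L δ) {z : ℂ} (hz : z ∈ upStrip δ) : Γ z ∈ closure Ω := by
  rcases hz.1.lt_or_eq with h | h
  · exact subset_closure (hC.inside z ⟨h, hz.2⟩)
  · apply frontier_subset_closure
    rw [hC.front]
    exact ⟨z, h.symm, rfl⟩

theorem exists_of_mem_closure (hC : Collar Ω Γ L δ) {x : ℂ} (hx : x ∈ closure Ω) :
    x ∈ Ω ∨ ∃ t : ℝ, x = Γ t := by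
  by_cases h : x ∈ Ω
  · exact Or.inl h
  · right
    have : x ∈ frontier Ω := ⟨hx, by rwa [hC.isOpen.interior_eq]⟩
    rw [hC.front] at this
    obtain ⟨z, hz, rfl⟩ := this
    exact ⟨z.re, by congr 1; apply Complex.ext <;> simp_all⟩

theorem isCompact_closure (hC : Collar Ω Γ L δ) : IsCompact (closure Ω) :=
  hC.bdd.isCompact_closure

/-- Differentiability of a function on the plane can be checked in the chart `Γ`. -/
theorem hasFDerivAt_of_comp (hC : Collar Ω Γ L δ) {E : Type*} [NormedAddCommGroup E]
    [NormedSpace ℝ E] {z : ℂ} (hz : z ∈ strip δ) {G : ℂ → E} {B : ℂ →L[ℝ] E}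
    (h : HasFDerivAt (fun w => G (Γ w)) B z) :
    HasFDerivAt G (B ∘L ((deriv Γ z)⁻¹ • (1 : ℂ →L[ℝ] ℂ))) (Γ z) := by
  have hs := hC.hasStrictDerivAt hz
  have h0 := hC.deriv_ne z hz
  have hσ := (hs.to_localInverse h0).hasDerivAt.complexToReal_fderiv
  have hz' : hs.localInverse Γ _ z h0 (Γ z) = z := (hs.eventually_left_inverse h0).self_of_nhds
  rw [← hz'] at h
  refine (h.comp (Γ z) hσ).congr_of_eventuallyEq ?_
  filter_upwards [hs.eventually_right_inverse h0] with y hy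
  simp [hy]

end Collar

/-- A compactly supported planar `1`-form cannot have a curl which is a nonzero constant times
a nonnegative nontrivial density. -/
theorem eq_zero_of_curl_eq_mul_density {β : ℂ → ℂ →L[ℝ] ℂ} {β' : ℂ → ℂ →L[ℝ] ℂ →L[ℝ] ℂ}
    (hβ : ∀ x, HasFDerivAt β (β' x) x) (hsupp : HasCompactSupport β)
    {ρ : ℂ → ℝ} (hρc : Continuous ρ) (hρs : HasCompactSupport ρ) (hρ0 : ∀ x, 0 ≤ ρ x)
    (hρne : ∃ x, ρ x ≠ 0) {c : ℂ}
    (hcurl : ∀ x, β' x 1 Complex.I - β' x Complex.I 1 = c * ρ x) : c = 0 := by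
  let e := Complex.equivRealProdCLM.symm
  have he1 : e (1, 0) = 1 := by
    simp only [e, Complex.equivRealProdCLM_symm_apply]; simp
  have heI : e (0, 1) = Complex.I := by
    simp only [e, Complex.equivRealProdCLM_symm_apply]; simp
  obtain ⟨r, hr0, hr⟩ := (hsupp.isCompact.isBounded.union hρs.isCompact.isBounded).subset_ball_lt 0 0
  have hin : ∀ p : ℝ × ℝ, e p ∈ Metric.ball (0 : ℂ) r → p ∈ Ioo (-r) r ×ˢ Ioo (-r) r := by
    intro p hp
    rw [mem_ball_zero_iff] at hp
    have h1 := (Complex.abs_re_le_norm (e p)).trans_lt hp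
    have h2 := (Complex.abs_im_le_norm (e p)).trans_lt hp
    exact ⟨abs_lt.1 h1, abs_lt.1 h2⟩
  have hβ0 : ∀ p : ℝ × ℝ, p ∉ Ioo (-r) r ×ˢ Ioo (-r) r → β (e p) = 0 := fun p hp =>
    image_eq_zero_of_notMem_tsupport fun h => hp (hin p (hr (Or.inl h)))
  have hρ0' : ∀ p : ℝ × ℝ, p ∉ Ioo (-r) r ×ˢ Ioo (-r) r → ρ (e p) = 0 := fun p hp =>
    image_eq_zero_of_notMem_tsupport fun h => hp (hin p (hr (Or.inr h)))
  have hd : ∀ p, HasFDerivAt (fun p => β (e p)) (β' (e p) ∘L (e : ℝ × ℝ →L[ℝ] ℂ)) p :=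
    fun p => (hβ (e p)).comp p e.hasFDerivAt
  have happ : ∀ v p, HasFDerivAt (fun p => β (e p) v)
      (((ContinuousLinearMap.apply ℝ ℂ v) ∘L (β' (e p))) ∘L (e : ℝ × ℝ →L[ℝ] ℂ)) p := fun v p =>
    (ContinuousLinearMap.apply ℝ ℂ v).hasFDerivAt.comp p (hd p)
  have hf := happ Complex.I
  have hg := fun p => (happ 1 p).neg
  have hdiv : ∀ p : ℝ × ℝ, (((ContinuousLinearMap.apply ℝ ℂ Complex.I) ∘L (β' (e p))) ∘L (e : ℝ × ℝ →L[ℝ] ℂ)) (1, 0)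
      + (-(((ContinuousLinearMap.apply ℝ ℂ (1 : ℂ)) ∘L (β' (e p))) ∘L (e : ℝ × ℝ →L[ℝ] ℂ))) (0, 1) = c * ρ (e p) := by
    intro p
    rw [← hcurl]
    simp [he1, heI, sub_eq_add_neg]
  have key := integral_divergence_prod_Icc_of_hasFDerivAt_of_le _ _ _ _ (-r, -r) (r, r)
    (by constructor <;> simp <;> linarith)
    (continuous_iff_continuousAt.2 fun p => (hf p).continuousAt).continuousOn
    (continuous_iff_continuousAt.2 fun p => (hg p).continuousAt).continuousOn
    (fun p _ => hf p) (fun p _ => hg p) ?_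
  · simp only [hdiv] at key
    have hz1 : ∀ x, β (e (x, r)) = 0 := fun x => hβ0 _ (by simp)
    have hz2 : ∀ x, β (e (x, -r)) = 0 := fun x => hβ0 _ (by simp)
    have hz3 : ∀ x, β (e (r, x)) = 0 := fun x => hβ0 _ (by simp)
    have hz4 : ∀ x, β (e (-r, x)) = 0 := fun x => hβ0 _ (by simp)
    simp only [Pi.neg_apply, hz1, hz2, hz3, hz4] at key
    simp only [_root_.zero_apply, neg_zero, intervalIntegral.integral_zero, sub_zero, add_zero] at key
    rw [setIntegral_eq_integral_of_forall_compl_eq_zero] at key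
    · rw [integral_const_mul, integral_complex_ofReal, mul_eq_zero] at key
      refine key.resolve_right ?_
      rw [Complex.ofReal_eq_zero]
      obtain ⟨x, hx⟩ := hρne
      refine ne_of_gt ((hρc.comp e.continuous).integral_pos_of_hasCompactSupport_nonneg_nonzero
        (hρs.comp_homeomorph e.toHomeomorph) (fun p => hρ0 _) (x := e.symm x) ?_)
      simpa using hx
    · intro p hp
      rw [hρ0' p, Complex.ofReal_zero, mul_zero]
      intro h
      apply hp
      rw [Icc_prod_eq]
      exact prod_mono Ioo_subset_Icc_self Ioo_subset_Icc_self h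
  · simp only [hdiv]
    refine ContinuousOn.integrableOn_compact isCompact_Icc (Continuous.continuousOn ?_)
    exact continuous_const.mul (Complex.continuous_ofReal.comp (hρc.comp e.continuous))

namespace Collar

variable {Ω : Set ℂ} {Γ : ℂ → ℂ} {L δ : ℝ}

theorem hasDerivAt_deriv (hC : Collar Ω Γ L δ) {z : ℂ} (hz : z ∈ strip δ) :
    HasDerivAt (deriv Γ) (deriv (deriv Γ) z) z :=
  (hC.analyticAt hz).deriv.differentiableAt.hasDerivAt

/-- The pullback of a `1`-form by the collar map. -/
noncomputable def pull (Γ : ℂ → ℂ) (ω : ℂ → ℂ →L[ℝ] ℂ) (z : ℂ) : ℂ →L[ℝ] ℂ :=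
  ω (Γ z) ∘L (deriv Γ z • (1 : ℂ →L[ℝ] ℂ))

theorem pull_apply (ω : ℂ → ℂ →L[ℝ] ℂ) (z h : ℂ) : pull Γ ω z h = ω (Γ z) (deriv Γ z * h) := by
  simp [pull]

theorem symm_closure {ω : ℂ → ℂ →L[ℝ] ℂ} (hω : ContDiff ℝ 1 ω)
    (hsym : ∀ x ∈ Ω, ∀ a b, fderiv ℝ ω x a b = fderiv ℝ ω x b a) :
    ∀ x ∈ closure Ω, ∀ a b, fderiv ℝ ω x a b = fderiv ℝ ω x b a := by
  intro x hx a b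
  have hc : Continuous (fderiv ℝ ω) := hω.continuous_fderiv (by norm_num)
  have hcl : IsClosed {x | fderiv ℝ ω x a b = fderiv ℝ ω x b a} :=
    isClosed_eq (by fun_prop) (by fun_prop)
  exact closure_minimal (fun x hx => hsym x hx a b) hcl hx

theorem exists_chart_potential (hC : Collar Ω Γ L δ) {ω : ℂ → ℂ →L[ℝ] ℂ} (hω : ContDiff ℝ 1 ω)
    (hsym : ∀ x ∈ Ω, ∀ a b, fderiv ℝ ω x a b = fderiv ℝ ω x b a) :
    ∃ F : ℂ → ℂ, ∀ z ∈ upStrip δ, HasFDerivWithinAt F (pull Γ ω z) (upStrip δ) z := by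
  have hsym' := symm_closure hω hsym
  have hd : ∀ z ∈ upStrip δ, HasFDerivAt (pull Γ ω) _ z := fun z hz => by
    have hz' := upStrip_subset δ hz
    have h1 : HasFDerivAt (fun z => ω (Γ z)) (fderiv ℝ ω (Γ z) ∘L (deriv Γ z • (1 : ℂ →L[ℝ] ℂ))) z :=
      ((hω.differentiable (by norm_num)) (Γ z)).hasFDerivAt.comp z
        (hC.hasDerivAt hz').complexToReal_fderiv
    have h2 : HasFDerivAt (fun z => deriv Γ z • (1 : ℂ →L[ℝ] ℂ))
      ((deriv (deriv Γ) z • (1 : ℂ →L[ℝ] ℂ)).smulRight (1 : ℂ →L[ℝ] ℂ)) z :=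
      (hC.hasDerivAt_deriv hz').complexToReal_fderiv.smul_const (1 : ℂ →L[ℝ] ℂ)
    exact h1.clm_comp h2
  refine (convex_upStrip δ).exists_forall_hasFDerivWithinAt_of_hasFDerivWithinAt_symmetric
    (fun z hz => (hd z hz).hasFDerivWithinAt) ?_
  intro z hz a _ b _
  simp [hsym' _ (hC.mem_closure hz) (deriv Γ z * b) (deriv Γ z * a)]
  ring_nf

end Collar

/-- A smooth decreasing cutoff. -/
theorem exists_cutoff {δ : ℝ} (hδ : 0 < δ) : ∃ θ : ℝ → ℝ, ContDiff ℝ 2 θ ∧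
    (∀ τ ≤ δ / 3, θ τ = 1) ∧ (∀ τ, 2 * δ / 3 ≤ τ → θ τ = 0) ∧ ∀ τ, deriv θ τ ≤ 0 := by
  refine ⟨fun τ => 1 - Real.smoothTransition ((3 * τ - δ) / δ), ?_, ?_, ?_, ?_⟩
  · exact contDiff_const.sub (Real.smoothTransition.contDiff.comp
      (((contDiff_const.mul contDiff_id).sub contDiff_const).div_const _))
  · intro τ hτ
    simp only
    rw [Real.smoothTransition.zero_of_nonpos, sub_zero]
    exact div_nonpos_of_nonpos_of_nonneg (by linarith) hδ.le
  · intro τ hτ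
    simp only
    rw [Real.smoothTransition.one_of_one_le, sub_self]
    rw [le_div_iff₀ hδ]; linarith
  · intro τ
    refine Antitone.deriv_nonpos fun a b hab => ?_
    have := Real.smoothTransition.monotone (show (3 * a - δ) / δ ≤ (3 * b - δ) / δ by gcongr)
    linarith

namespace Collar

variable {Ω : Set ℂ} {Γ : ℂ → ℂ} {L δ : ℝ}

theorem deriv_per_int (hC : Collar Ω Γ L δ) {z : ℂ} (hz : z ∈ strip δ) (k : ℤ) :
    deriv Γ (z + k * L) = deriv Γ z := by
  rw [← deriv_comp_add_const]
  refine Filter.EventuallyEq.deriv_eq ?_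
  filter_upwards [(isOpen_strip δ).mem_nhds hz] with w hw using hC.per_int hw k

open Classical in
/-- Transport to the plane of a function defined on a subset of the strip, with a default value
outside the image of that set. -/
noncomputable def descend {E : Type*} (Γ : ℂ → ℂ) (S : Set ℂ) (b d : ℂ → E) (x : ℂ) : E :=
  if h : ∃ z ∈ S, Γ z = x then b h.choose else d x

theorem descend_apply (hC : Collar Ω Γ L δ) {E : Type*} {S : Set ℂ} (hS : S ⊆ strip δ)
    {b d : ℂ → E} (hb : ∀ z ∈ S, ∀ k : ℤ, b (z + k * L) = b z) {z : ℂ} (hz : z ∈ S) :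
    descend Γ S b d (Γ z) = b z := by
  have h : ∃ w ∈ S, Γ w = Γ z := ⟨z, hz, rfl⟩
  rw [descend, dif_pos h]
  obtain ⟨k, hk⟩ := hC.inj z (hS hz) _ (hS h.choose_spec.1) h.choose_spec.2.symm
  rw [hk, hb z hz k]

theorem descend_of_not {E : Type*} {S : Set ℂ} {b d : ℂ → E} {x : ℂ}
    (h : ¬ ∃ z ∈ S, Γ z = x) : descend Γ S b d x = d x := by
  rw [descend, dif_neg h]

theorem im_eq_of_map_eq (hC : Collar Ω Γ L δ) {z w : ℂ} (hz : z ∈ strip δ) (hw : w ∈ strip δ)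
    (h : Γ z = Γ w) : z.im = w.im := by
  obtain ⟨k, rfl⟩ := hC.inj z hz w hw h
  simp

theorem notMem_of_mem_frontier (hC : Collar Ω Γ L δ) {x : ℂ} (hx : x ∈ frontier Ω) : x ∉ Ω := by
  rw [hC.isOpen.frontier_eq] at hx
  exact hx.2

theorem cover (hC : Collar Ω Γ L δ) (x : ℂ) : (∃ z ∈ upStripInt δ, Γ z = x) ∨
    (∀ᶠ y in 𝓝 x, (∀ z ∈ upStripInt δ, Γ z = y → z.im < δ / 3) ∧
      ((∃ z ∈ upStripInt δ, Γ z = y) ∨ y ∉ Ω)) ∨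
    (∀ᶠ y in 𝓝 x, y ∈ Ω ∧ ∀ z ∈ upStripInt δ, Γ z = y → 2 * δ / 3 < z.im) := by
  have hδ := hC.δ_pos
  have hsub : upStripInt δ ⊆ strip δ := (upStripInt_subset δ).trans (upStrip_subset δ)
  by_cases h1 : ∃ z ∈ upStripInt δ, Γ z = x
  · exact Or.inl h1
  right
  by_cases h2 : x ∈ Ω
  · right
    have hK : IsCompact (Γ '' {z | z.im ∈ Icc 0 (2 * δ / 3)}) :=
      hC.isCompact_image (by linarith) (by linarith)
    have hxK : x ∉ Γ '' {z | z.im ∈ Icc 0 (2 * δ / 3)} := by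
      rintro ⟨z, ⟨hz1, hz2⟩, rfl⟩
      rcases hz1.lt_or_eq with h | h
      · exact h1 ⟨z, ⟨h, by linarith⟩, rfl⟩
      · have : Γ z ∈ frontier Ω := by rw [hC.front]; exact ⟨z, h.symm, rfl⟩
        exact hC.notMem_of_mem_frontier this h2
    filter_upwards [hC.isOpen.mem_nhds h2, hK.isClosed.isOpen_compl.mem_nhds hxK] with y hy1 hy2
    refine ⟨hy1, ?_⟩
    rintro z hz rfl
    by_contra! h
    exact hy2 ⟨z, ⟨hz.1.le, h⟩, rfl⟩
  · left
    by_cases h3 : x ∈ closure Ω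
    · obtain ⟨t, rfl⟩ := (hC.exists_of_mem_closure h3).resolve_left h2
      have ho : IsOpen (Γ '' strip (δ / 3)) := hC.isOpen_image (isOpen_strip _) fun z hz => by
        have : |z.im| < δ / 3 := hz
        show |z.im| < δ
        linarith
      filter_upwards [ho.mem_nhds ⟨t, by simp [strip, hδ], rfl⟩]
      rintro _ ⟨w, hw, rfl⟩
      have hw1 : |w.im| < δ / 3 := hw
      have hw' : w ∈ strip δ := show |w.im| < δ by linarith
      rw [abs_lt] at hw1
      refine ⟨fun z hz hzw => ?_, ?_⟩
      · rw [hC.im_eq_of_map_eq (hsub hz) hw' hzw]; exact hw1.2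
      · rcases lt_trichotomy w.im 0 with h | h | h
        · exact Or.inr fun hh => hC.outside w (by linarith) h (subset_closure hh)
        · refine Or.inr (hC.notMem_of_mem_frontier ?_)
          rw [hC.front]; exact ⟨w, h, rfl⟩
        · exact Or.inl ⟨w, ⟨h, by linarith⟩, rfl⟩
    · filter_upwards [isClosed_closure.isOpen_compl.mem_nhds h3] with y hy
      have hy' : y ∉ Ω := fun h => hy (subset_closure h)
      refine ⟨?_, Or.inr hy'⟩
      rintro z hz rfl
      exact absurd (hC.inside z hz) hy'

theorem chart_potential_add_period (hC : Collar Ω Γ L δ) {ω : ℂ → ℂ →L[ℝ] ℂ} {F : ℂ → ℂ}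
    (hF : ∀ z ∈ upStrip δ, HasFDerivWithinAt F (pull Γ ω z) (upStrip δ) z) :
    ∃ c : ℂ, ∀ z ∈ upStrip δ, F (z + L) = F z + c := by
  have hmem : ∀ z ∈ upStrip δ, z + L ∈ upStrip δ := fun z hz => by
    simpa [upStrip] using hz
  have hd : ∀ z ∈ upStrip δ, HasFDerivWithinAt (fun z => F (z + L) - F z) (0 : ℂ →L[ℝ] ℂ) (upStrip δ) z := by
    intro z hz
    have h1 : HasFDerivWithinAt (fun z => F (z + L)) (pull Γ ω z ∘L (ContinuousLinearMap.id ℝ ℂ))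
        (upStrip δ) z := by
      have hp : pull Γ ω (z + L) = pull Γ ω z := by
        have h1 := hC.per_int (upStrip_subset δ hz) 1
        have h2 := hC.deriv_per_int (upStrip_subset δ hz) 1
        simp only [Int.cast_one, one_mul] at h1 h2
        rw [pull, pull, h1, h2]
      rw [← hp]
      exact (hF _ (hmem z hz)).comp z ((hasFDerivWithinAt_id z _).add_const _) hmem
    exact (h1.sub (hF z hz)).congr_fderiv (by ext; all_goals simp)
  refine ⟨F (0 + L) - F 0, fun z hz => ?_⟩
  have h0 : (0 : ℂ) ∈ upStrip δ := by simpa using hC.real_mem 0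
  have := (convex_upStrip δ).norm_image_sub_le_of_norm_hasFDerivWithin_le (C := 0)
    hd (fun _ _ => by simp) h0 hz
  rw [zero_mul, norm_le_zero_iff, sub_eq_zero] at this
  rw [← this]; ring

end Collar

namespace Collar

variable {Ω : Set ℂ} {Γ : ℂ → ℂ} {L δ : ℝ}

/-- The real-linear family of forms `h ↦ Im (c * h)`. -/
noncomputable def imForm : ℂ →L[ℝ] ℂ →L[ℝ] ℂ :=
  (ContinuousLinearMap.compL ℝ ℂ ℂ ℂ (Complex.ofRealCLM ∘L Complex.imCLM)) ∘L
    (ContinuousLinearMap.mul ℝ ℂ)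

theorem imForm_apply (c h : ℂ) : imForm c h = ((c * h).im : ℂ) := rfl

/-- The form `ω - d(θ f)` in the collar, where `f` is a potential of `ω`. -/
noncomputable def cutForm (Γ : ℂ → ℂ) (ω : ℂ → ℂ →L[ℝ] ℂ) (f : ℂ → ℂ) (θ : ℝ → ℝ) (z : ℂ) :
    ℂ →L[ℝ] ℂ :=
  ((1 - θ z.im : ℝ) : ℂ) • ω (Γ z) - (f z * (deriv θ z.im : ℝ)) • imForm (deriv Γ z)⁻¹

theorem hasFDerivAt_cutForm (hC : Collar Ω Γ L δ) {ω : ℂ → ℂ →L[ℝ] ℂ} (hω : ContDiff ℝ 1 ω)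
    {f : ℂ → ℂ} {θ : ℝ → ℝ} (hθ : ContDiff ℝ 2 θ) {c : ℂ} {z : ℂ} (hz : z ∈ strip δ)
    (hsym : ∀ a b, fderiv ℝ ω (Γ z) a b = fderiv ℝ ω (Γ z) b a)
    (hf : HasFDerivAt f (pull Γ ω z - c • (Complex.ofRealCLM ∘L Complex.reCLM)) z) :
    ∃ B : ℂ →L[ℝ] ℂ →L[ℝ] ℂ, HasFDerivAt (cutForm Γ ω f θ) B z ∧
      ∀ u w, B u (deriv Γ z * w) - B w (deriv Γ z * u)
        = deriv θ z.im * c * (u.re * w.im - w.re * u.im) := by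
  have h0 := hC.deriv_ne z hz
  have him : HasFDerivAt Complex.im Complex.imCLM z := Complex.imCLM.hasFDerivAt
  have hθ1 : HasFDerivAt (fun z : ℂ => ((1 - θ z.im : ℝ) : ℂ))
      (Complex.ofRealCLM ∘L (-(deriv θ z.im • Complex.imCLM))) z := by
    have h1 : HasDerivAt θ (deriv θ z.im) z.im :=
      ((hθ.differentiable (by norm_num)) _).hasDerivAt
    have h2 := (h1.comp_hasFDerivAt z him).const_sub 1
    exact Complex.ofRealCLM.hasFDerivAt.comp z h2
  have hθ2 : HasFDerivAt (fun z : ℂ => ((deriv θ z.im : ℝ) : ℂ))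
      (Complex.ofRealCLM ∘L (deriv (deriv θ) z.im • Complex.imCLM)) z := by
    have h1 : HasDerivAt (deriv θ) (deriv (deriv θ) z.im) z.im := by
      have : ContDiff ℝ 1 (deriv θ) := (contDiff_succ_iff_deriv.1 (hθ : ContDiff ℝ (1 + 1) θ)).2.2
      exact ((this.differentiable (by norm_num)) _).hasDerivAt
    exact Complex.ofRealCLM.hasFDerivAt.comp z (h1.comp_hasFDerivAt z him)
  have hω1 : HasFDerivAt (fun z => ω (Γ z)) (fderiv ℝ ω (Γ z) ∘L (deriv Γ z • (1 : ℂ →L[ℝ] ℂ))) z :=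
    ((hω.differentiable (by norm_num)) (Γ z)).hasFDerivAt.comp z
      (hC.hasDerivAt hz).complexToReal_fderiv
  have hΓ : HasFDerivAt (fun z => imForm (deriv Γ z)⁻¹) _ z :=
    imForm.hasFDerivAt.comp z ((hC.hasDerivAt_deriv hz).inv h0).complexToReal_fderiv
  refine ⟨_, (hθ1.smul hω1).sub ((hf.mul hθ2).smul hΓ), fun u w => ?_⟩
  simp [imForm_apply, pull_apply, hsym (deriv Γ z * w) (deriv Γ z * u), h0]
  ring

end Collar

namespace Collar

variable {Ω : Set ℂ} {Γ : ℂ → ℂ} {L δ : ℝ}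

theorem periodic_int_of_periodic {E : Type*} {S : Set ℂ} {f : ℂ → E} {L : ℝ}
    (hS : ∀ z ∈ S, ∀ k : ℤ, z + k * L ∈ S) (hf : ∀ z ∈ S, f (z + L) = f z) {z : ℂ} (hz : z ∈ S)
    (k : ℤ) : f (z + k * L) = f z := by
  induction k with
  | zero => simp
  | succ k ih =>
    rw [← ih, ← hf (z + ((k : ℤ) : ℂ) * L) (hS z hz _)]
    congr 1; push_cast; ring
  | pred k ih =>
    rw [← ih, ← hf (z + ((-(k:ℤ) - 1 : ℤ) : ℂ) * L) (hS z hz _)]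
    congr 1; push_cast; ring

theorem exists_cut_form (hC : Collar Ω Γ L δ) {ω : ℂ → ℂ →L[ℝ] ℂ} (hω : ContDiff ℝ 1 ω)
    (hsym : ∀ x ∈ Ω, ∀ a b, fderiv ℝ ω x a b = fderiv ℝ ω x b a) {θ : ℝ → ℝ} (hθ : ContDiff ℝ 2 θ)
    (hθ1 : ∀ τ ≤ δ / 3, θ τ = 1) (hθ0 : ∀ τ, 2 * δ / 3 ≤ τ → θ τ = 0) (hθd : ∀ τ, deriv θ τ ≤ 0) :
    ∃ (f : ℂ → ℂ) (ω₂ : ℂ → ℂ →L[ℝ] ℂ),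
      (∀ z ∈ upStrip δ, ∀ k : ℤ, f (z + k * L) = f z) ∧
      (∀ z ∈ upStrip δ, HasFDerivWithinAt f (pull Γ ω z) (upStrip δ) z) ∧
      (∀ z ∈ upStripInt δ, ω₂ (Γ z) = cutForm Γ ω f θ z) ∧
      (∀ t : ℝ, ω₂ (Γ t) = 0) ∧
      (∀ x ∈ Ω, (¬ ∃ z ∈ upStripInt δ, Γ z = x) → ω₂ x = ω x) ∧
      Differentiable ℝ ω₂ ∧ ∀ x u w, fderiv ℝ ω₂ x u w = fderiv ℝ ω₂ x w u := by
  have hδ := hC.δ_pos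
  have hsub : upStripInt δ ⊆ strip δ := (upStripInt_subset δ).trans (upStrip_subset δ)
  have hsymc := symm_closure hω hsym
  obtain ⟨F, hF⟩ := hC.exists_chart_potential hω hsym
  obtain ⟨c₀, hc₀⟩ := hC.chart_potential_add_period hF
  have hL : (L : ℂ) ≠ 0 := by exact_mod_cast hC.L_pos.ne'
  have hd1 : ∀ τ < δ / 3, deriv θ τ = 0 := fun τ hτ => by
    have : θ =ᶠ[𝓝 τ] fun _ => 1 := by
      filter_upwards [Iio_mem_nhds hτ] with s hs using hθ1 s (le_of_lt hs)
    rw [this.deriv_eq, deriv_const]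
  have hd0 : ∀ τ, 2 * δ / 3 < τ → deriv θ τ = 0 := fun τ hτ => by
    have : θ =ᶠ[𝓝 τ] fun _ => 0 := by
      filter_upwards [Ioi_mem_nhds hτ] with s hs using hθ0 s (le_of_lt hs)
    rw [this.deriv_eq, deriv_const]
  have hS : ∀ z ∈ upStrip δ, ∀ k : ℤ, z + k * L ∈ upStrip δ := fun z hz k => by
    simpa [upStrip] using hz
  let f : ℂ → ℂ := fun z => F z - (c₀ / L) * z.re
  have hfper : ∀ z ∈ upStrip δ, ∀ k : ℤ, f (z + k * L) = f z := fun z hz k => by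
    refine periodic_int_of_periodic hS (fun z hz => ?_) hz k
    simp only [f, hc₀ z hz]
    simp only [Complex.add_re, Complex.ofReal_re, Complex.ofReal_add]
    field_simp
    ring
  have hre : ∀ z : ℂ, HasFDerivAt (fun z : ℂ => (c₀ / L) * (z.re : ℂ))
      ((c₀ / L) • (Complex.ofRealCLM ∘L Complex.reCLM)) z := fun z =>
    (Complex.ofRealCLM ∘L Complex.reCLM).hasFDerivAt.const_mul (c₀ / L)
  have hfd : ∀ z ∈ upStripInt δ, HasFDerivAt f
      (pull Γ ω z - (c₀ / L) • (Complex.ofRealCLM ∘L Complex.reCLM)) z := fun z hz =>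
    ((hF z (upStripInt_subset δ hz)).hasFDerivAt (mem_of_superset
      ((isOpen_upStripInt δ).mem_nhds hz) (upStripInt_subset δ))).sub (hre z)
  have hbper : ∀ z ∈ upStripInt δ, ∀ k : ℤ, cutForm Γ ω f θ (z + k * L) = cutForm Γ ω f θ z := by
    intro z hz k
    have h1 := hC.per_int (hsub hz) k
    have h2 := hC.deriv_per_int (hsub hz) k
    have h3 := hfper z (upStripInt_subset δ hz) k
    have h4 : (z + k * L).im = z.im := by simp
    rw [cutForm, cutForm, h1, h2, h3, h4]
  classical
  let ω₂ : ℂ → ℂ →L[ℝ] ℂ := descend Γ (upStripInt δ) (cutForm Γ ω f θ)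
    (fun x => if x ∈ Ω then ω x else 0)
  have hω₂ : ∀ z ∈ upStripInt δ, ω₂ (Γ z) = cutForm Γ ω f θ z := fun z hz =>
    hC.descend_apply hsub hbper hz
  have hω₂n : ∀ x, (¬ ∃ z ∈ upStripInt δ, Γ z = x) → ω₂ x = if x ∈ Ω then ω x else 0 :=
    fun x hx => descend_of_not hx
  let ρ : ℂ → ℝ := descend Γ (upStripInt δ)
    (fun z => -deriv θ z.im * Complex.normSq (deriv Γ z)⁻¹) (fun _ => 0)
  have hρ : ∀ z ∈ upStripInt δ, ρ (Γ z) = -deriv θ z.im * Complex.normSq (deriv Γ z)⁻¹ :=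
    fun z hz => hC.descend_apply hsub (fun z hz k => by
      simp only [hC.deriv_per_int (hsub hz) k]
      simp) hz
  have hρn : ∀ x, (¬ ∃ z ∈ upStripInt δ, Γ z = x) → ρ x = 0 := fun x hx => descend_of_not hx
  -- behaviour near the boundary and outside
  have hnear : ∀ y, (∀ z ∈ upStripInt δ, Γ z = y → z.im < δ / 3) →
      ((∃ z ∈ upStripInt δ, Γ z = y) ∨ y ∉ Ω) → ω₂ y = 0 ∧ ρ y = 0 := by
    intro y hy1 hy2
    by_cases h : ∃ z ∈ upStripInt δ, Γ z = y
    · obtain ⟨z, hz, rfl⟩ := h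
      have hz3 := hy1 z hz rfl
      rw [hω₂ z hz, hρ z hz, cutForm, hθ1 _ hz3.le, hd1 _ hz3]
      refine ⟨?_, by simp⟩
      ext h
      simp
    · rw [hω₂n y h, hρn y h, if_neg (hy2.resolve_left h)]
      simp
  have hfar : ∀ y, (y ∈ Ω ∧ ∀ z ∈ upStripInt δ, Γ z = y → 2 * δ / 3 < z.im) →
      ω₂ y = ω y ∧ ρ y = 0 := by
    intro y ⟨hy1, hy2⟩
    by_cases h : ∃ z ∈ upStripInt δ, Γ z = y
    · obtain ⟨z, hz, rfl⟩ := h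
      have hz3 := hy2 z hz rfl
      rw [hω₂ z hz, hρ z hz, cutForm, hθ0 _ hz3.le, hd0 _ hz3]
      refine ⟨?_, by simp⟩
      ext h
      simp
    · rw [hω₂n y h, hρn y h, if_pos hy1]
      simp
  have hder : ∀ x, ∃ B : ℂ →L[ℝ] ℂ →L[ℝ] ℂ, HasFDerivAt ω₂ B x ∧
      ∀ u w, B u w - B w u = -(c₀ / L) * ρ x * (u.re * w.im - w.re * u.im) := by
    intro x
    rcases hC.cover x with ⟨z, hz, rfl⟩ | h | h
    · obtain ⟨B, hB, hBs⟩ := hC.hasFDerivAt_cutForm hω hθ (hsub hz)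
        (hsymc _ (hC.mem_closure (upStripInt_subset δ hz))) (hfd z hz)
      have hB' : HasFDerivAt (fun w => ω₂ (Γ w)) B z := hB.congr_of_eventuallyEq (by
        filter_upwards [(isOpen_upStripInt δ).mem_nhds hz] with w hw using hω₂ w hw)
      refine ⟨_, hC.hasFDerivAt_of_comp (hsub hz) hB', fun u w => ?_⟩
      have h0 := hC.deriv_ne z (hsub hz)
      have h := hBs ((deriv Γ z)⁻¹ * u) ((deriv Γ z)⁻¹ * w)
      rw [mul_inv_cancel_left₀ h0, mul_inv_cancel_left₀ h0] at h
      simp only [ContinuousLinearMap.comp_apply, smul_apply,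
        one_apply_eq_self, smul_eq_mul]
      rw [h, hρ z hz]
      generalize (deriv Γ z)⁻¹ = d
      simp only [Complex.normSq_apply, Complex.mul_re, Complex.mul_im]
      push_cast
      ring
    · refine ⟨0, (hasFDerivAt_const (0 : ℂ →L[ℝ] ℂ) x).congr_of_eventuallyEq ?_, fun u w => ?_⟩
      · filter_upwards [h] with y hy using (hnear y hy.1 hy.2).1
      · rw [(hnear x h.self_of_nhds.1 h.self_of_nhds.2).2]; simp
    · refine ⟨fderiv ℝ ω x, ((hω.differentiable (by norm_num)) x).hasFDerivAt.congr_of_eventuallyEq ?_,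
        fun u w => ?_⟩
      · filter_upwards [h] with y hy using (hfar y hy).1
      · rw [(hfar x h.self_of_nhds).2, hsym x h.self_of_nhds.1 u w]; simp
  choose B hB hBs using hder
  have hρc : Continuous ρ := by
    rw [continuous_iff_continuousAt]
    intro x
    rcases hC.cover x with ⟨z, hz, rfl⟩ | h | h
    · have h1 : ContinuousAt (fun z => -deriv θ z.im * Complex.normSq (deriv Γ z)⁻¹) z := by
        have h2 : ContinuousAt (deriv Γ) z := (hC.hasDerivAt_deriv (hsub hz)).continuousAt
        have h3 : Continuous (deriv θ) := hθ.continuous_deriv (by norm_num)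
        have h4 := h2.inv₀ (hC.deriv_ne z (hsub hz))
        exact ((h3.comp Complex.continuous_im).neg.continuousAt).mul
          (Complex.continuous_normSq.continuousAt.comp h4)
      have h2 : ContinuousAt (fun w => ρ (Γ w)) z := h1.congr (by
        filter_upwards [(isOpen_upStripInt δ).mem_nhds hz] with w hw using (hρ w hw).symm)
      rw [ContinuousAt, ← hC.map_nhds (hsub hz), tendsto_map'_iff]
      exact h2
    · refine (continuousAt_const (y := (0 : ℝ))).congr ?_
      filter_upwards [h] with y hy using (hnear y hy.1 hy.2).2.symm
    · refine (continuousAt_const (y := (0 : ℝ))).congr ?_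
      filter_upwards [h] with y hy using (hfar y hy).2.symm
  have hout : ∀ x, x ∉ closure Ω → ω₂ x = 0 ∧ ρ x = 0 := fun x hx => by
    have hn : ¬ ∃ z ∈ upStripInt δ, Γ z = x := by
      rintro ⟨z, hz, rfl⟩
      exact hx (subset_closure (hC.inside z hz))
    rw [hω₂n x hn, hρn x hn, if_neg fun h => hx (subset_closure h)]
    simp
  have hc : -(c₀ / L) = 0 := by
    refine eq_zero_of_curl_eq_mul_density hB
      (HasCompactSupport.intro hC.isCompact_closure fun x hx => (hout x hx).1) hρc
      (HasCompactSupport.intro hC.isCompact_closure fun x hx => (hout x hx).2) ?_ ?_ ?_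
    · intro x
      by_cases h : ∃ z ∈ upStripInt δ, Γ z = x
      · obtain ⟨z, hz, rfl⟩ := h
        rw [hρ z hz]
        exact mul_nonneg (neg_nonneg.2 (hθd _)) (Complex.normSq_nonneg _)
      · rw [hρn x h]
    · obtain ⟨τ, hτ, hτ'⟩ := exists_deriv_eq_slope θ (a := δ / 3) (b := 2 * δ / 3) (by linarith)
        hθ.continuous.continuousOn (hθ.differentiable (by norm_num)).differentiableOn
      have hz : (τ * Complex.I) ∈ upStripInt δ := by
        have := hτ.1; have := hτ.2
        constructor <;> simp <;> linarith
      refine ⟨Γ (τ * Complex.I), ?_⟩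
      rw [hρ _ hz]
      have him : (τ * Complex.I).im = τ := by simp
      rw [him, hτ', hθ1 _ le_rfl, hθ0 _ le_rfl]
      refine mul_ne_zero (neg_ne_zero.2 (div_ne_zero (by norm_num) ?_)) ?_
      · have : 2 * δ / 3 - δ / 3 ≠ 0 := by
          have : 2 * δ / 3 - δ / 3 = δ / 3 := by ring
          rw [this]; positivity
        exact this
      · simpa using hC.deriv_ne _ (hsub hz)
    · intro x
      rw [hBs]
      simp
  have hc' : c₀ / L = 0 := neg_eq_zero.1 hc
  refine ⟨f, ω₂, hfper, ?_, hω₂, ?_, ?_, fun x => (hB x).differentiableAt, ?_⟩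
  · intro z hz
    have hfF : f = F := by ext z; simp [f, hc']
    rw [hfF]; exact hF z hz
  · intro t
    have hn : ¬ ∃ z ∈ upStripInt δ, Γ z = Γ t := by
      rintro ⟨z, hz, h⟩
      exact hC.notMem_of_mem_frontier (hC.mem_frontier t) (h ▸ hC.inside z hz)
    rw [hω₂n _ hn, if_neg (hC.notMem_of_mem_frontier (hC.mem_frontier t))]
  · intro x hx hn
    rw [hω₂n x hn, if_pos hx]
  · intro x u w
    rw [(hB x).fderiv, ← sub_eq_zero, hBs, hc]
    simp

theorem exists_potential (hC : Collar Ω Γ L δ) {ω : ℂ → ℂ →L[ℝ] ℂ} (hω : ContDiff ℝ 1 ω)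
    (hsym : ∀ x ∈ Ω, ∀ a b, fderiv ℝ ω x a b = fderiv ℝ ω x b a) :
    ∃ Ψ : ℂ → ℂ, (∀ x ∈ Ω, HasFDerivAt Ψ (ω x) x) ∧
      ∀ z ∈ upStrip δ, HasFDerivWithinAt (fun w => Ψ (Γ w)) (pull Γ ω z) (upStrip δ) z := by
  have hsub : upStripInt δ ⊆ strip δ := (upStripInt_subset δ).trans (upStrip_subset δ)
  obtain ⟨θ, hθ, hθ1, hθ0, hθd⟩ := exists_cutoff hC.δ_pos
  obtain ⟨f, ω₂, hfper, hf, hω₂, hω₂r, hω₂n, hω₂d, hω₂s⟩ :=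
    hC.exists_cut_form hω hsym hθ hθ1 hθ0 hθd
  obtain ⟨G, hG⟩ := convex_univ.exists_forall_hasFDerivAt_of_fderiv_symmetric isOpen_univ
    hω₂d.differentiableOn (fun x _ u w => hω₂s x u w)
  have hbper : ∀ z ∈ upStrip δ, ∀ k : ℤ,
      (fun z : ℂ => (θ z.im : ℂ) * f z) (z + k * L) = (fun z : ℂ => (θ z.im : ℂ) * f z) z := by
    intro z hz k
    simp only [hfper z hz k]
    simp
  let D : ℂ → ℂ := descend Γ (upStrip δ) (fun z : ℂ => (θ z.im : ℂ) * f z) (fun _ => 0)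
  have hD : ∀ z ∈ upStrip δ, D (Γ z) = (θ z.im : ℂ) * f z := fun z hz =>
    hC.descend_apply (upStrip_subset δ) hbper hz
  have hchart : ∀ z ∈ upStrip δ,
      HasFDerivWithinAt (fun w => G (Γ w) + D (Γ w)) (pull Γ ω z) (upStrip δ) z := by
    intro z hz
    have hz' := upStrip_subset δ hz
    have h1 : HasFDerivAt (fun w => G (Γ w)) (pull Γ ω₂ z) z :=
      (hG (Γ z) (mem_univ _)).comp z (hC.hasDerivAt hz').complexToReal_fderiv
    have hθ' : HasFDerivAt (fun z : ℂ => (θ z.im : ℂ))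
        (Complex.ofRealCLM ∘L ((1 : ℝ →L[ℝ] ℝ).smulRight (deriv θ z.im) ∘L Complex.imCLM)) z :=
      Complex.ofRealCLM.hasFDerivAt.comp z
        (((hθ.differentiable (by norm_num)) z.im).hasDerivAt.hasFDerivAt.comp z
          Complex.imCLM.hasFDerivAt)
    have h2 := hθ'.hasFDerivWithinAt.mul (hf z hz)
    refine ((h1.hasFDerivWithinAt.add h2).congr_fderiv ?_).congr
      (fun w hw => by simp [hD w hw]) (by simp [hD z hz])
    ext h
    rcases hz.1.lt_or_eq with h0 | h0
    · have h3 := hω₂ z ⟨h0, hz.2⟩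
      have h4 := hC.deriv_ne z hz'
      simp [pull_apply, h3, cutForm, imForm_apply, inv_mul_cancel_left₀ h4]
      ring
    · have h3 : z = ((z.re : ℝ) : ℂ) := by apply Complex.ext <;> simp [← h0]
      have h4 : ω₂ (Γ z) = 0 := by rw [h3]; exact hω₂r _
      have h5 : deriv θ z.im = 0 := by
        have : θ =ᶠ[𝓝 z.im] fun _ => 1 := by
          filter_upwards [Iio_mem_nhds (show z.im < δ / 3 by rw [← h0]; linarith [hC.δ_pos])]
            with s hs using hθ1 s (le_of_lt hs)
        rw [this.deriv_eq, deriv_const]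
      have h6 : θ z.im = 1 := hθ1 _ (by rw [← h0]; linarith [hC.δ_pos])
      simp [pull_apply, h4, h5, h6]
  refine ⟨fun x => G x + D x, fun x hx => ?_, hchart⟩
  rcases hC.cover x with ⟨z, hz, rfl⟩ | h | h
  · have h1 := (hchart z (upStripInt_subset δ hz)).hasFDerivAt (mem_of_superset
      ((isOpen_upStripInt δ).mem_nhds hz) (upStripInt_subset δ))
    refine (hC.hasFDerivAt_of_comp (hsub hz) (G := fun x => G x + D x) h1).congr_fderiv ?_
    ext h
    simp [pull_apply, mul_inv_cancel_left₀ (hC.deriv_ne z (hsub hz))]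
  · have h1 := h.self_of_nhds
    rcases h1.2 with ⟨z, hz, rfl⟩ | h2
    · have h1 := (hchart z (upStripInt_subset δ hz)).hasFDerivAt (mem_of_superset
        ((isOpen_upStripInt δ).mem_nhds hz) (upStripInt_subset δ))
      refine (hC.hasFDerivAt_of_comp (hsub hz) (G := fun x => G x + D x) h1).congr_fderiv ?_
      ext h
      simp [pull_apply, mul_inv_cancel_left₀ (hC.deriv_ne z (hsub hz))]
    · exact absurd hx h2
  · have hDz : ∀ y, (y ∈ Ω ∧ ∀ z ∈ upStripInt δ, Γ z = y → 2 * δ / 3 < z.im) → D y = 0 := by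
      intro y hy
      by_cases hn : ∃ z ∈ upStrip δ, Γ z = y
      · obtain ⟨z, hz, rfl⟩ := hn
        rw [hD z hz]
        rcases hz.1.lt_or_eq with h0 | h0
        · rw [hθ0 _ (hy.2 z ⟨h0, hz.2⟩ rfl).le]; simp
        · have h3 : z = ((z.re : ℝ) : ℂ) := by apply Complex.ext <;> simp [← h0]
          rw [h3] at hy
          exact absurd hy.1 (hC.notMem_of_mem_frontier (hC.mem_frontier _))
      · exact descend_of_not hn
    have hωx : ω₂ x = ω x := by
      by_cases hn : ∃ z ∈ upStripInt δ, Γ z = x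
      · obtain ⟨z, hz, rfl⟩ := hn
        have h3 := h.self_of_nhds.2 z hz rfl
        have h5 : deriv θ z.im = 0 := by
          have : θ =ᶠ[𝓝 z.im] fun _ => 0 := by
            filter_upwards [Ioi_mem_nhds h3] with s hs using hθ0 s (le_of_lt hs)
          rw [this.deriv_eq, deriv_const]
        rw [hω₂ z hz, cutForm, hθ0 _ h3.le, h5]
        ext h
        simp
      · exact hω₂n x hx hn
    rw [← hωx]
    refine (hG x (mem_univ _)).congr_of_eventuallyEq ?_
    filter_upwards [h] with y hy
    rw [hDz y hy, add_zero]

theorem continuousWithinAt_of_comp (hC : Collar Ω Γ L δ) {E : Type*} [TopologicalSpace E]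
    {Φ : ℂ → E} {s : ℝ} (h : ContinuousWithinAt (fun w => Φ (Γ w)) (upStrip δ) s) :
    ContinuousWithinAt Φ (closure Ω) (Γ s) := by
  have hs := hC.hasStrictDerivAt (upStrip_subset δ (hC.real_mem s))
  have h0 := hC.deriv_ne _ (upStrip_subset δ (hC.real_mem s))
  have hc := (hs.to_localInverse h0).hasDerivAt.continuousAt
  have hz' : hs.localInverse Γ _ s h0 (Γ s) = s := (hs.eventually_left_inverse h0).self_of_nhds
  have hin : ∀ᶠ y in 𝓝 (Γ s), hs.localInverse Γ _ s h0 y ∈ strip δ := by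
    refine hc.eventually_mem ?_
    rw [hz']
    exact (isOpen_strip δ).mem_nhds (upStrip_subset δ (hC.real_mem s))
  have hr := hs.eventually_right_inverse h0
  have hin2 : ∀ᶠ y in 𝓝[closure Ω] (Γ s), hs.localInverse Γ _ s h0 y ∈ upStrip δ := by
    filter_upwards [nhdsWithin_le_nhds hin, nhdsWithin_le_nhds hr, self_mem_nhdsWithin] with y h1 h2 h3
    have h4 := abs_lt.1 (show |(hs.localInverse Γ _ s h0 y).im| < δ from h1)
    refine ⟨?_, h4.2⟩
    by_contra h5
    exact hC.outside _ h4.1 (not_le.1 h5) (by rw [h2]; exact h3)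
  have ht : Tendsto (hs.localInverse Γ _ s h0) (𝓝[closure Ω] (Γ s)) (𝓝[upStrip δ] s) := by
    refine tendsto_nhdsWithin_iff.2 ⟨?_, hin2⟩
    have := hc.tendsto
    rw [hz'] at this
    exact this.mono_left nhdsWithin_le_nhds
  refine (Tendsto.congr' ?_ (h.tendsto.comp ht))
  filter_upwards [nhdsWithin_le_nhds hr] with y hy
  simp [hy]

end Collar

/-- The real-linear map with Wirtinger coefficients `α` and `β`. -/
noncomputable def wirt (α β : ℂ) : ℂ →L[ℝ] ℂ :=
  α • (1 : ℂ →L[ℝ] ℂ) + β • (Complex.conjCLE : ℂ →L[ℝ] ℂ)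

theorem wirt_apply (α β h : ℂ) : wirt α β h = α * h + β * (starRingEnd ℂ) h := by
  simp [wirt]

theorem wirt_ext {B : ℂ →L[ℝ] ℂ} {α β : ℂ} (h : ∀ x, B x = α * x + β * (starRingEnd ℂ) x) :
    B = wirt α β := by
  ext x; simp [h, wirt_apply]

theorem hasFDerivAt_wirt_mul {f g : ℂ → ℂ} {a b c d x : ℂ} (hf : HasFDerivAt f (wirt a b) x)
    (hg : HasFDerivAt g (wirt c d) x) :
    HasFDerivAt (fun x => f x * g x) (wirt (a * g x + f x * c) (b * g x + f x * d)) x := by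
  refine (hf.mul hg).congr_fderiv (wirt_ext fun h => ?_)
  simp [wirt_apply]; ring

theorem hasFDerivAt_wirt_const_mul {f : ℂ → ℂ} {a b x : ℂ} (hf : HasFDerivAt f (wirt a b) x)
    (c : ℂ) : HasFDerivAt (fun x => c * f x) (wirt (c * a) (c * b)) x := by
  refine (hf.const_mul c).congr_fderiv (wirt_ext fun h => ?_)
  simp [wirt_apply]; ring

theorem hasFDerivAt_wirt_comp {f : ℂ → ℂ} {g : ℂ → ℂ} {a b c x : ℂ} (hg : HasDerivAt g c (f x))
    (hf : HasFDerivAt f (wirt a b) x) :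
    HasFDerivAt (fun x => g (f x)) (wirt (c * a) (c * b)) x := by
  refine (hg.complexToReal_fderiv.comp x hf).congr_fderiv (wirt_ext fun h => ?_)
  simp [wirt_apply]; ring

theorem hasFDerivAt_wirt_conj {f : ℂ → ℂ} {a b x : ℂ} (hf : HasFDerivAt f (wirt a b) x) :
    HasFDerivAt (fun x => (starRingEnd ℂ) (f x))
      (wirt ((starRingEnd ℂ) b) ((starRingEnd ℂ) a)) x := by
  refine (((Complex.conjCLE : ℂ →L[ℝ] ℂ).hasFDerivAt (x := f x)).comp x hf).congr_fderiv
    (wirt_ext fun h => ?_)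
  simp [wirt_apply]; ring

theorem hasFDerivAt_const_sub (Z x : ℂ) : HasFDerivAt (fun x : ℂ => Z - x) (wirt (-1) 0) x := by
  refine ((hasFDerivAt_id (𝕜 := ℝ) x).const_sub Z).congr_fderiv (wirt_ext fun h => ?_)
  simp

theorem hasFDerivAt_const_sub_conj (Q x : ℂ) :
    HasFDerivAt (fun x : ℂ => Q - (starRingEnd ℂ) x) (wirt 0 (-1)) x := by
  refine (((Complex.conjCLE : ℂ →L[ℝ] ℂ).hasFDerivAt (x := x)).const_sub Q).congr_fderiv
    (wirt_ext fun h => ?_)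
  simp

/-- The argument `μ (Z - x) (Q - x̄)` of the Riemann function. -/
noncomputable def riemannArg (μ : ℝ) (Z Q x : ℂ) : ℂ := μ * ((Z - x) * (Q - (starRingEnd ℂ) x))

/-- The Riemann function of the Helmholtz equation. -/
noncomputable def riemannFun (μ : ℝ) (Z Q x : ℂ) : ℂ := besselSeries 0 (riemannArg μ Z Q x)

/-- The derivative of the Riemann function in `x̄`. -/
noncomputable def riemannFunBar (μ : ℝ) (Z Q x : ℂ) : ℂ :=
  μ * (Z - x) * besselSeries 1 (riemannArg μ Z Q x)

/-- The derivative of the Riemann function in `x`. -/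
noncomputable def riemannFunHol (μ : ℝ) (Z Q x : ℂ) : ℂ :=
  μ * (Q - (starRingEnd ℂ) x) * besselSeries 1 (riemannArg μ Z Q x)

theorem hasFDerivAt_riemannArg (μ : ℝ) (Z Q x : ℂ) :
    HasFDerivAt (riemannArg μ Z Q) (wirt (-(μ * (Q - (starRingEnd ℂ) x))) (-(μ * (Z - x)))) x := by
  exact (hasFDerivAt_wirt_const_mul (hasFDerivAt_wirt_mul (hasFDerivAt_const_sub Z x)
    (hasFDerivAt_const_sub_conj Q x)) (μ : ℂ)).congr_fderiv (by congr 1 <;> ring)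

theorem hasFDerivAt_riemannFun (μ : ℝ) (Z Q x : ℂ) :
    HasFDerivAt (riemannFun μ Z Q) (wirt (riemannFunHol μ Z Q x) (riemannFunBar μ Z Q x)) x := by
  exact (hasFDerivAt_wirt_comp (hasDerivAt_besselSeries 0 _)
    (hasFDerivAt_riemannArg μ Z Q x)).congr_fderiv (by
      congr 1 <;> simp only [riemannFunHol, riemannFunBar, zero_add] <;> ring)

theorem hasFDerivAt_riemannFunBar (μ : ℝ) (Z Q x : ℂ) : ∃ b,
    HasFDerivAt (riemannFunBar μ Z Q) (wirt (-μ * riemannFun μ Z Q x) b) x := by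
  have h := hasFDerivAt_wirt_mul (hasFDerivAt_wirt_const_mul (hasFDerivAt_const_sub Z x) (μ : ℂ))
    (hasFDerivAt_wirt_comp (hasDerivAt_besselSeries 1 _) (hasFDerivAt_riemannArg μ Z Q x))
  refine ⟨_, h.congr_fderiv (congrArg (fun a => wirt a _) ?_)⟩
  have h1 := besselSeries_rec (riemannArg μ Z Q x)
  have h2 : riemannArg μ Z Q x = μ * ((Z - x) * (Q - (starRingEnd ℂ) x)) := rfl
  rw [riemannFun]
  linear_combination (μ : ℂ) * h1 - (μ : ℂ) * besselSeries 2 (riemannArg μ Z Q x) * h2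

@[fun_prop]
theorem continuous_besselSeries (m : ℕ) : Continuous (besselSeries m) :=
  (differentiable_besselSeries m).continuous

/-- A solution `v` of the Helmholtz equation on `Ω` together with its Wirtinger derivative `g`. -/
structure HelmholtzPair (Ω : Set ℂ) (μ : ℝ) (v : ℂ → ℝ) (g : ℂ → ℂ) : Prop where
  contDiff_v : ContDiff ℝ 1 v
  contDiff_g : ContDiff ℝ 1 g
  hasFDerivAt_v : ∀ x, HasFDerivAt (fun x => (v x : ℂ)) (wirt (g x) ((starRingEnd ℂ) (g x))) x
  hasFDerivAt_g : ∀ x ∈ Ω, ∃ a, HasFDerivAt g (wirt a (-μ * v x)) x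

/-- The closed one-form `R v_z dz + v R_{z̄} dz̄`. -/
noncomputable def helmForm (μ : ℝ) (v : ℂ → ℝ) (g : ℂ → ℂ) (Z Q x : ℂ) : ℂ →L[ℝ] ℂ :=
  wirt (riemannFun μ Z Q x * g x) (v x * riemannFunBar μ Z Q x)

namespace HelmholtzPair

variable {Ω : Set ℂ} {μ : ℝ} {v : ℂ → ℝ} {g : ℂ → ℂ}

theorem contDiff_riemannArg (Z Q : ℂ) : ContDiff ℝ 1 (riemannArg μ Z Q) := by
  unfold riemannArg
  have : ContDiff ℝ 1 (starRingEnd ℂ : ℂ → ℂ) := Complex.conjCLE.contDiff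
  fun_prop

theorem contDiff_form (h : HelmholtzPair Ω μ v g) (Z Q : ℂ) : ContDiff ℝ 1 (helmForm μ v g Z Q) := by
  have h1 := h.contDiff_g
  have h2 : ContDiff ℝ 1 (fun x => (v x : ℂ)) := Complex.ofRealCLM.contDiff.comp h.contDiff_v
  have h3 := contDiff_riemannArg (μ := μ) Z Q
  have h4 : ∀ m, ContDiff ℝ 1 (fun x => besselSeries m (riemannArg μ Z Q x)) := fun m =>
    ((contDiff_besselSeries m).restrict_scalars ℝ).comp h3
  unfold helmForm wirt riemannFun riemannFunBar
  have h5 := h4 0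
  have h6 := h4 1
  fun_prop

theorem symm_form (h : HelmholtzPair Ω μ v g) (Z Q : ℂ) : ∀ x ∈ Ω, ∀ a b,
    fderiv ℝ (helmForm μ v g Z Q) x a b = fderiv ℝ (helmForm μ v g Z Q) x b a := by
  intro x hx a b
  obtain ⟨c, hc⟩ := h.hasFDerivAt_g x hx
  obtain ⟨d, hd⟩ := hasFDerivAt_riemannFunBar μ Z Q x
  have h1 := hasFDerivAt_wirt_mul (hasFDerivAt_riemannFun μ Z Q x) hc
  have h2 := hasFDerivAt_wirt_mul (h.hasFDerivAt_v x) hd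
  have h3 : HasFDerivAt (helmForm μ v g Z Q) _ x :=
    (h1.smul_const (1 : ℂ →L[ℝ] ℂ)).add (h2.smul_const (Complex.conjCLE : ℂ →L[ℝ] ℂ))
  rw [h3.fderiv]
  simp [wirt_apply]
  ring

theorem continuous_form (h : HelmholtzPair Ω μ v g) (Q : ℂ) :
    Continuous (fun z : ℂ × ℂ => helmForm μ v g z.1 Q z.2) := by
  have h1 := h.contDiff_g.continuous
  have h2 := h.contDiff_v.continuous
  unfold helmForm wirt riemannFun riemannFunBar riemannArg
  fun_prop

theorem differentiable_form (v : ℂ → ℝ) (g : ℂ → ℂ) (Q x b : ℂ) :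
    Differentiable ℂ (fun Z => helmForm μ v g Z Q x b) := by
  have h0 := differentiable_besselSeries 0
  have h1 := differentiable_besselSeries 1
  simp only [helmForm, wirt_apply, riemannFun, riemannFunBar, riemannArg]
  fun_prop

theorem form_diag (v : ℂ → ℝ) (g : ℂ → ℂ) (Z Q : ℂ) : helmForm μ v g Z Q Z = wirt (g Z) 0 := by
  simp [helmForm, riemannFun, riemannFunBar, riemannArg, besselSeries_zero]

end HelmholtzPair

namespace Collar

variable {Ω : Set ℂ} {Γ : ℂ → ℂ} {L δ : ℝ}

theorem isPreconnected (hC : Collar Ω Γ L δ) : IsPreconnected Ω := by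
  have hδ := hC.δ_pos
  have hsub : upStripInt δ ⊆ strip δ := (upStripInt_subset δ).trans (upStrip_subset δ)
  have himg : IsPreconnected (Γ '' upStripInt δ) :=
    (convex_upStripInt δ).isPreconnected.image _ (hC.diff.continuousOn.mono hsub)
  have key : ∀ U V : Set ℂ, IsOpen U → IsOpen V → Ω ⊆ U ∪ V → Ω ∩ (U ∩ V) = ∅ →
      Γ '' upStripInt δ ⊆ U → (Ω ∩ V).Nonempty → False := by
    intro U V hU hV hUV hdis hin hne
    have hW : IsOpen (Ω ∩ V) := hC.isOpen.inter hV
    have hfr : (frontier (Ω ∩ V)).Nonempty := by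
      refine nonempty_frontier_iff.2 ⟨hne, fun h => ?_⟩
      have : Bornology.IsBounded (univ : Set ℂ) := h ▸ hC.bdd.subset inter_subset_left
      exact NormedSpace.unbounded_univ ℂ ℂ this
    obtain ⟨x, hx⟩ := hfr
    rw [hW.frontier_eq] at hx
    have hxc : x ∈ closure Ω := closure_mono inter_subset_left hx.1
    rcases hC.exists_of_mem_closure hxc with h | ⟨t, rfl⟩
    · rcases hUV h with h' | h'
      · obtain ⟨y, hy, hy'⟩ := mem_closure_iff.1 hx.1 U hU h'
        have : y ∈ Ω ∩ (U ∩ V) := ⟨hy'.1, hy, hy'.2⟩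
        rw [hdis] at this; exact this
      · exact hx.2 ⟨h, h'⟩
    · have ht := upStrip_subset δ (hC.real_mem t)
      obtain ⟨y, ⟨z, hz, rfl⟩, hy⟩ := mem_closure_iff.1 hx.1 (Γ '' strip δ)
        (hC.isOpen_image (isOpen_strip δ) Subset.rfl) ⟨t, ht, rfl⟩
      have hz' := abs_lt.1 (show |z.im| < δ from hz)
      have hz0 : 0 < z.im := by
        by_contra h0
        rcases (not_lt.1 h0).lt_or_eq with h1 | h1
        · exact hC.outside z hz'.1 h1 (subset_closure hy.1)
        · exact hC.notMem_of_mem_frontier (by rw [hC.front]; exact ⟨z, h1, rfl⟩) hy.1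
      have : Γ z ∈ Ω ∩ (U ∩ V) := ⟨hy.1, hin ⟨z, ⟨hz0, hz'.2⟩, rfl⟩, hy.2⟩
      rw [hdis] at this; exact this
  intro U V hU hV hUV hneU hneV
  by_contra hdis
  rw [not_nonempty_iff_eq_empty] at hdis
  have hsubΩ : Γ '' upStripInt δ ⊆ Ω := by
    rintro _ ⟨z, hz, rfl⟩; exact hC.inside z hz
  rcases (isPreconnected_iff_subset_of_disjoint.1 himg) U V hU hV (hsubΩ.trans hUV)
    (subset_empty_iff.1 (hdis ▸ inter_subset_inter_left _ hsubΩ)) with h | h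
  · exact key U V hU hV hUV hdis h hneV
  · exact key V U hV hU (by rwa [union_comm]) (by rwa [inter_comm V U]) h hneU

/-- A relation that is transitive and holds locally in `Ω` and along the collar holds on `closure Ω`. -/
theorem closure_induction (hC : Collar Ω Γ L δ) {r : ℂ → ℂ → Prop}
    (symm : ∀ x y, r x y → r y x) (trans : ∀ x y z, r x y → r y z → r x z)
    (hΩ : ∀ x ∈ Ω, ∀ᶠ y in 𝓝 x, r x y)
    (hb : ∀ s : ℝ, ∀ z ∈ upStripInt δ, r (Γ s) (Γ z)) {x y : ℂ} (hx : x ∈ closure Ω)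
    (hy : y ∈ closure Ω) : r x y := by
  have hδ := hC.δ_pos
  have h1 : ∀ x ∈ Ω, ∀ y ∈ Ω, r x y := fun x hx y hy => by
    refine hC.isPreconnected.induction₂ r (fun x hx => ?_) (fun x y z _ _ _ => trans x y z)
      (fun x y _ _ => symm x y) hx hy
    exact nhdsWithin_le_nhds (hΩ x hx)
  have h2 : ∀ x ∈ closure Ω, ∃ y ∈ Ω, r x y := by
    intro x hx
    rcases hC.exists_of_mem_closure hx with h | ⟨t, rfl⟩
    · exact ⟨x, h, h1 x h x h⟩
    · have hz : ((δ / 2 : ℝ) * Complex.I : ℂ) ∈ upStripInt δ := by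
        constructor <;> simp <;> linarith
      exact ⟨_, hC.inside _ hz, hb t _ hz⟩
  obtain ⟨x', hx', hxx⟩ := h2 x hx
  obtain ⟨y', hy', hyy⟩ := h2 y hy
  exact trans _ _ _ hxx (trans _ _ _ (h1 x' hx' y' hy') (symm _ _ hyy))

end Collar

theorem conj_besselSeries (m : ℕ) (x : ℂ) :
    (starRingEnd ℂ) (besselSeries m x) = besselSeries m ((starRingEnd ℂ) x) := by
  rw [besselSeries, besselSeries, Complex.conj_tsum]
  simp

theorem sub_eq_integral_of_convex {S : Set ℂ} (hS : Convex ℝ S) {F : ℂ → ℂ} {B : ℂ → ℂ →L[ℝ] ℂ}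
    (hF : ∀ w ∈ S, HasFDerivWithinAt F (B w) S w) (hB : ContinuousOn B S) {x y : ℂ} (hx : x ∈ S)
    (hy : y ∈ S) : F y - F x = ∫ u in (0 : ℝ)..1, B (x + u * (y - x)) (y - x) := by
  have hmaps : MapsTo (fun u : ℝ => x + u * (y - x)) (Icc 0 1) S := fun u hu => by
    have := hS.add_smul_sub_mem hx hy hu
    simpa using this
  have hd : ∀ u ∈ Icc (0 : ℝ) 1, HasDerivWithinAt (fun u : ℝ => F (x + u * (y - x)))
      (B (x + u * (y - x)) (y - x)) (Icc 0 1) u := by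
    intro u hu
    have h1 : HasDerivAt (fun u : ℝ => x + u * (y - x)) (y - x) u := by
      simpa using ((Complex.ofRealCLM.hasDerivAt (x := u)).mul_const (y - x)).const_add x
    exact (hF _ (hmaps hu)).comp_hasDerivWithinAt u h1.hasDerivWithinAt hmaps
  rw [intervalIntegral.integral_eq_sub_of_hasDerivAt_of_le zero_le_one
    (fun u hu => (hd u hu).continuousWithinAt)
    (fun u hu => (hd u (Ioo_subset_Icc_self hu)).hasDerivAt (Icc_mem_nhds hu.1 hu.2))]
  · simp
  · apply ContinuousOn.intervalIntegrable
    rw [uIcc_of_le zero_le_one]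
    exact (hB.comp (by fun_prop) hmaps).clm_apply continuousOn_const

theorem differentiable_sub_of_convex {S : Set ℂ} (hS : Convex ℝ S) {F : ℂ → ℂ → ℂ}
    {B : ℂ → ℂ → ℂ →L[ℝ] ℂ} (hF : ∀ Z, ∀ w ∈ S, HasFDerivWithinAt (F Z) (B Z w) S w)
    (hB : ContinuousOn (fun z : ℂ × ℂ => B z.1 z.2) (univ ×ˢ S))
    (hBd : ∀ w ∈ S, ∀ b, Differentiable ℂ (fun Z => B Z w b)) {x y : ℂ} (hx : x ∈ S)
    (hy : y ∈ S) : Differentiable ℂ (fun Z => F Z y - F Z x) := by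
  have hmaps : MapsTo (fun u : ℝ => x + u * (y - x)) (Icc 0 1) S := fun u hu => by
    have := hS.add_smul_sub_mem hx hy hu
    simpa using this
  have h : (fun Z => F Z y - F Z x) = fun Z => ∫ u in (0 : ℝ)..1, B Z (x + u * (y - x)) (y - x) := by
    funext Z
    refine sub_eq_integral_of_convex hS (hF Z) ?_ hx hy
    exact hB.comp (f := fun w => (Z, w)) (by fun_prop) fun w hw => ⟨mem_univ _, hw⟩
  rw [h, ← differentiableOn_univ]
  apply differentiableOn_intervalIntegral_of_continuousOn isOpen_univ
  · refine ContinuousOn.clm_apply ?_ continuousOn_const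
    refine hB.comp (f := fun z : ℂ × ℝ => (z.1, x + (z.2 : ℂ) * (y - x))) (by fun_prop) ?_
    rintro ⟨Z, u⟩ ⟨-, hu⟩
    rw [uIcc_of_le zero_le_one] at hu
    exact ⟨mem_univ _, hmaps hu⟩
  · intro u hu
    rw [uIcc_of_le zero_le_one] at hu
    exact (hBd _ (hmaps hu) _).differentiableOn

namespace HelmholtzPair

variable {Ω : Set ℂ} {Γ : ℂ → ℂ} {L δ μ : ℝ} {v : ℂ → ℝ} {g : ℂ → ℂ}

/-- The Riemann representation: a kernel `V Z q`, holomorphic in `Z ∈ Ω` and continuous up to the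
boundary, which is given on the boundary by the Cauchy data of `v`. -/
theorem exists_kernel (h : HelmholtzPair Ω μ v g) (hC : Collar Ω Γ L δ) :
    ∃ V : ℂ → ℂ → ℂ,
      (∀ q ∈ closure Ω, DifferentiableOn ℂ (fun Z => V Z q) Ω ∧
        ContinuousOn (fun Z => V Z q) (closure Ω)) ∧
      (∀ t s : ℝ, V (Γ t) (Γ s) = v (Γ s) +
        ∫ σ in s..t, helmForm μ v g (Γ t) ((starRingEnd ℂ) (Γ s)) (Γ σ) (deriv Γ σ)) ∧
      (∀ q ∈ closure Ω, ∀ Z ∈ closure Ω, (starRingEnd ℂ) (V Z q) = V q Z) ∧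
      (∀ q, V q q = v q) := by
  have hδ := hC.δ_pos
  have hsub : upStripInt δ ⊆ strip δ := (upStripInt_subset δ).trans (upStrip_subset δ)
  choose Ψ hΨ hΨ' using fun Z Q => hC.exists_potential (h.contDiff_form Z Q) (h.symm_form Z Q)
  have hpc : ∀ Q, ContinuousOn (fun z : ℂ × ℂ => Collar.pull Γ (helmForm μ v g z.1 Q) z.2)
      (univ ×ˢ upStrip δ) := by
    intro Q
    have h1 : ContinuousOn Γ (upStrip δ) := hC.diff.continuousOn.mono (upStrip_subset δ)
    have h2 : ContinuousOn (deriv Γ) (upStrip δ) := fun z hz =>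
      (hC.hasDerivAt_deriv (upStrip_subset δ hz)).continuousAt.continuousWithinAt
    have h1' : ContinuousOn (fun z : ℂ × ℂ => Γ z.2) (univ ×ˢ upStrip δ) :=
      h1.comp continuousOn_snd fun z hz => hz.2
    have h2' : ContinuousOn (fun z : ℂ × ℂ => deriv Γ z.2) (univ ×ˢ upStrip δ) :=
      h2.comp continuousOn_snd fun z hz => hz.2
    exact ((h.continuous_form Q).comp_continuousOn (continuousOn_fst.prodMk h1')).clm_comp
      (h2'.smul continuousOn_const)
  have hent : ∀ Q, ∀ x ∈ closure Ω, ∀ y ∈ closure Ω,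
      Differentiable ℂ (fun Z => Ψ Z Q y - Ψ Z Q x) := by
    intro Q x hx y hy
    refine hC.closure_induction (r := fun x y => Differentiable ℂ (fun Z => Ψ Z Q y - Ψ Z Q x))
      (fun x y hd => ?_) (fun x y z h1 h2 => ?_) (fun x hx => ?_) (fun s z hz => ?_) hx hy
    · have h1 : (fun Z => Ψ Z Q x - Ψ Z Q y) = -fun Z => Ψ Z Q y - Ψ Z Q x := by
        funext Z; simp
      rw [h1]; exact hd.neg
    · have h3 : (fun Z => Ψ Z Q z - Ψ Z Q x) =
          (fun Z => Ψ Z Q z - Ψ Z Q y) + fun Z => Ψ Z Q y - Ψ Z Q x := by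
        funext Z; simp
      rw [h3]; exact h2.add h1
    · obtain ⟨r, hr, hrΩ⟩ := Metric.isOpen_iff.1 hC.isOpen x hx
      filter_upwards [Metric.ball_mem_nhds x hr] with y hy
      exact differentiable_sub_of_convex (convex_ball x r) (F := fun Z => Ψ Z Q)
        (fun Z w hw => (hΨ Z Q w (hrΩ hw)).hasFDerivWithinAt)
        (h.continuous_form Q).continuousOn
        (fun w _ b => differentiable_form v g Q w b) (Metric.mem_ball_self hr) hy
    · refine differentiable_sub_of_convex (convex_upStrip δ) (F := fun Z w => Ψ Z Q (Γ w))
        (fun Z w hw => hΨ' Z Q w hw) (hpc Q) (fun w _ b => ?_) (hC.real_mem s)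
        (upStripInt_subset δ hz)
      simpa only [Collar.pull_apply] using differentiable_form v g Q (Γ w) (deriv Γ w * b)
  refine ⟨fun Z q => v q + (Ψ Z ((starRingEnd ℂ) q) Z - Ψ Z ((starRingEnd ℂ) q) q), ?_, ?_, ?_,
    fun q => by simp⟩
  · intro q hq
    beta_reduce
    generalize (starRingEnd ℂ) q = Q
    have hin : ∀ Z₁ ∈ Ω, DifferentiableAt ℂ (fun Z => (v q : ℂ) + (Ψ Z Q Z - Ψ Z Q q)) Z₁ := by
      intro Z₁ hZ₁
      have h1 : DifferentiableAt ℂ (fun Z => Ψ Z Q Z₁ - Ψ Z Q q) Z₁ :=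
        hent Q q hq Z₁ (subset_closure hZ₁) Z₁
      have h2 : HasDerivAt (fun Z => Ψ Z Q Z - Ψ Z Q Z₁) (g Z₁) Z₁ := by
        rw [hasDerivAt_iff_isLittleO, Asymptotics.isLittleO_iff]
        intro c hc
        have hcont := (h.continuous_form Q).continuousAt (x := (Z₁, Z₁))
        have hev := Metric.tendsto_nhds.1 hcont.tendsto c hc
        simp only [form_diag] at hev
        rw [nhds_prod_eq] at hev
        obtain ⟨U, hU, hUc⟩ := Filter.eventually_prod_self_iff'.1 hev
        obtain ⟨r, hr, hrU⟩ := Metric.mem_nhds_iff.1 (inter_mem hU (hC.isOpen.mem_nhds hZ₁))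
        filter_upwards [Metric.ball_mem_nhds Z₁ hr] with Z hZ
        have key := (convex_ball Z₁ r).norm_image_sub_le_of_norm_hasFDerivWithin_le
          (f := fun x => Ψ Z Q x - g Z₁ * x) (f' := fun x => helmForm μ v g Z Q x - wirt (g Z₁) 0)
          (C := c) (x := Z₁) (y := Z) (fun x hx => ?_) (fun x hx => ?_)
          (Metric.mem_ball_self hr) hZ
        · refine le_trans (le_of_eq ?_) key
          congr 1
          simp only [smul_eq_mul]; ring
        · have h3 := hΨ Z Q x (hrU hx).2
          have h4 : HasFDerivAt (fun x => g Z₁ * x) (wirt (g Z₁) 0) x := by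
            refine ((hasFDerivAt_id (𝕜 := ℝ) x).const_mul (g Z₁)).congr_fderiv
              (wirt_ext fun h => ?_)
            simp
          exact (h3.sub h4).hasFDerivWithinAt
        · have := hUc Z (hrU hZ).1 x (hrU hx).1
          rw [dist_eq_norm] at this
          exact this.le
      have h3 : (fun Z => (v q : ℂ) + (Ψ Z Q Z - Ψ Z Q q)) =
          fun Z => (v q : ℂ) + ((Ψ Z Q Z₁ - Ψ Z Q q) + (Ψ Z Q Z - Ψ Z Q Z₁)) := by
        funext Z; ring
      rw [h3]
      exact (h1.add h2.differentiableAt).const_add _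
    refine ⟨fun Z hZ => (hin Z hZ).differentiableWithinAt, fun Z hZ => ?_⟩
    rcases hC.exists_of_mem_closure hZ with hZ' | ⟨s, rfl⟩
    · exact (hin Z hZ').continuousAt.continuousWithinAt
    · apply hC.continuousWithinAt_of_comp
      have hs := hC.real_mem s
      have h1 : ContinuousWithinAt (fun w => Ψ (Γ w) Q (Γ s) - Ψ (Γ w) Q q) (upStrip δ) s :=
        ((hent Q q hq _ (hC.mem_closure hs)).continuous.continuousAt.comp
          (hC.hasDerivAt (upStrip_subset δ hs)).continuousAt).continuousWithinAt
      obtain ⟨K, hK⟩ := (hC.isCompact_closure.prod hC.isCompact_closure).exists_bound_of_continuousOn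
        (h.continuous_form Q).continuousOn
      obtain ⟨K', hK'⟩ := hC.deriv_bdd
      have h2 : ∀ w ∈ upStrip δ, ‖Ψ (Γ w) Q (Γ w) - Ψ (Γ w) Q (Γ s)‖ ≤ K * K' * ‖w - s‖ := by
        intro w hw
        refine (convex_upStrip δ).norm_image_sub_le_of_norm_hasFDerivWithin_le
          (f := fun x => Ψ (Γ w) Q (Γ x)) (fun x hx => hΨ' (Γ w) Q x hx) (fun x hx => ?_) hs hw
        have hk0 := hK (Γ w, Γ x) ⟨hC.mem_closure hw, hC.mem_closure hx⟩
        have hK0 := (norm_nonneg _).trans hk0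
        have hk1 := hK' x (upStrip_subset δ hx)
        refine ContinuousLinearMap.opNorm_le_bound _ (mul_nonneg hK0 ((norm_nonneg _).trans hk1))
          fun b => ?_
        rw [Collar.pull_apply]
        refine (ContinuousLinearMap.le_opNorm _ _).trans ?_
        rw [norm_mul, mul_assoc]
        gcongr
      have h3 : ContinuousWithinAt (fun w => Ψ (Γ w) Q (Γ w) - Ψ (Γ w) Q (Γ s)) (upStrip δ) s := by
        rw [ContinuousWithinAt, sub_self]
        refine squeeze_zero_norm' (eventually_nhdsWithin_of_forall h2) ?_
        have : Continuous fun w : ℂ => K * K' * ‖w - s‖ := by fun_prop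
        simpa using (this.tendsto (s : ℂ)).mono_left nhdsWithin_le_nhds
      have h4 := (h1.add h3).const_add (v q : ℂ)
      refine h4.congr (fun w _ => ?_) ?_ <;> simp
  · intro t s
    beta_reduce
    generalize (starRingEnd ℂ) (Γ s) = Q
    congr 1
    symm
    rw [intervalIntegral.integral_eq_sub_of_hasDerivAt (f := fun σ : ℝ => Ψ (Γ t) Q (Γ σ))]
    · intro σ _
      have h1 := (hΨ' (Γ t) Q σ (hC.real_mem σ)).comp_hasDerivAt σ
        (Complex.ofRealCLM.hasDerivAt (x := σ)) (Eventually.of_forall fun x => hC.real_mem x)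
      have h2 : Collar.pull Γ (helmForm μ v g (Γ t) Q) σ (Complex.ofRealCLM 1) =
          helmForm μ v g (Γ t) Q (Γ σ) (deriv Γ σ) := by simp [Collar.pull_apply]
      rw [← h2]
      exact h1
    · apply Continuous.intervalIntegrable
      have h1 : Continuous fun σ : ℝ => Collar.pull Γ (helmForm μ v g (Γ t) Q) σ := by
        have := (hpc Q).comp_continuous (f := fun σ : ℝ => (Γ t, (σ : ℂ))) (by fun_prop)
          (fun σ => ⟨mem_univ _, hC.real_mem σ⟩)
        exact this
      have h2 := h1.clm_apply (continuous_const (y := (1 : ℂ)))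
      simpa [Collar.pull_apply] using h2
  · intro q hq Z hZ
    have hZQ : ∀ x, riemannArg μ q ((starRingEnd ℂ) Z) x =
        (starRingEnd ℂ) (riemannArg μ Z ((starRingEnd ℂ) q) x) := fun x => by
      simp only [riemannArg, map_mul, map_sub, Complex.conj_conj, Complex.conj_ofReal]
      ring
    let Θ : ℂ → ℂ := fun x => (starRingEnd ℂ) (Ψ Z ((starRingEnd ℂ) q) x) +
      Ψ q ((starRingEnd ℂ) Z) x - riemannFun μ q ((starRingEnd ℂ) Z) x * v x
    have hΘ : ∀ x ∈ Ω, HasFDerivAt Θ (0 : ℂ →L[ℝ] ℂ) x := by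
      intro x hx
      have h1 : HasFDerivAt (Ψ Z ((starRingEnd ℂ) q)) (wirt _ _) x := hΨ Z _ x hx
      have h2 : HasFDerivAt (Ψ q ((starRingEnd ℂ) Z)) (wirt _ _) x := hΨ q _ x hx
      refine (((hasFDerivAt_wirt_conj h1).add h2).sub (hasFDerivAt_wirt_mul
        (hasFDerivAt_riemannFun μ q ((starRingEnd ℂ) Z) x) (h.hasFDerivAt_v x))).congr_fderiv ?_
      ext b
      simp [wirt_apply, riemannFun, riemannFunBar, riemannFunHol, hZQ, conj_besselSeries]
      ring
    have hΘ' : ∀ z ∈ upStrip δ, HasFDerivWithinAt (fun w => Θ (Γ w)) (0 : ℂ →L[ℝ] ℂ) (upStrip δ) z := by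
      intro z hz
      have h1 := (Complex.conjCLE : ℂ →L[ℝ] ℂ).hasFDerivAt.comp_hasFDerivWithinAt z
        (hΨ' Z ((starRingEnd ℂ) q) z hz)
      have h2 := hΨ' q ((starRingEnd ℂ) Z) z hz
      have h3 := (hasFDerivAt_wirt_mul
        (hasFDerivAt_riemannFun μ q ((starRingEnd ℂ) Z) (Γ z)) (h.hasFDerivAt_v (Γ z))).comp z
        (hC.hasDerivAt (upStrip_subset δ hz)).complexToReal_fderiv
      refine ((h1.add h2).sub h3.hasFDerivWithinAt).congr_fderiv ?_
      ext b
      simp [Collar.pull_apply, helmForm, wirt_apply, riemannFun, riemannFunBar, riemannFunHol, hZQ,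
        conj_besselSeries]
      ring
    have hconst : Θ q = Θ Z := by
      refine hC.closure_induction (r := fun x y => Θ x = Θ y) (fun _ _ => Eq.symm)
        (fun _ _ _ => Eq.trans) (fun x hx => ?_) (fun s z hz => ?_) hq hZ
      · obtain ⟨r, hr, hrΩ⟩ := Metric.isOpen_iff.1 hC.isOpen x hx
        filter_upwards [Metric.ball_mem_nhds x hr] with y hy
        have := (convex_ball x r).norm_image_sub_le_of_norm_hasFDerivWithin_le (C := 0)
          (fun y hy => (hΘ y (hrΩ hy)).hasFDerivWithinAt) (by simp) hy (Metric.mem_ball_self hr)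
        simpa [sub_eq_zero] using this
      · have := (convex_upStrip δ).norm_image_sub_le_of_norm_hasFDerivWithin_le (C := 0)
          (fun y hy => hΘ' y hy) (by simp) (upStripInt_subset δ hz) (hC.real_mem s)
        simpa [sub_eq_zero] using this
    simp only [Θ, riemannFun, riemannArg, sub_self, mul_zero, zero_mul, besselSeries_zero] at hconst
    simp only [map_add, map_sub, Complex.conj_ofReal]
    simp at hconst
    linear_combination -hconst

end HelmholtzPair

section BoundaryKernel

variable {μ : ℝ} {γ γ' a η : ℝ → ℂ}

/-- The Riemann argument along a curve. -/
noncomputable def curveArg (μ : ℝ) (γ : ℝ → ℂ) (t r s : ℝ) : ℂ :=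
  riemannArg μ (γ t) ((starRingEnd ℂ) (γ r)) (γ s)

/-- The kernel of the Riemann representation on a curve. -/
noncomputable def curveKernel (μ : ℝ) (γ ν a η : ℝ → ℂ) (t t' : ℝ) : ℂ :=
  a t' + ∫ s in t'..t, (besselSeries 0 (curveArg μ γ t t' s) * η s +
    a s * (μ * (γ t - γ s) * besselSeries 1 (curveArg μ γ t t' s)) * (starRingEnd ℂ) (ν s))

/-- The derivative of `curveKernel` in its first variable. -/
noncomputable def curveKernelDeriv (μ : ℝ) (γ γ' a η : ℝ → ℂ) (t t' : ℝ) : ℂ :=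
  η t + ∫ s in t'..t, μ * γ' t * (a s * besselSeries 0 (curveArg μ γ t t' s) *
    (starRingEnd ℂ) (γ' s) - besselSeries 1 (curveArg μ γ t t' s) *
      ((starRingEnd ℂ) (γ t') - (starRingEnd ℂ) (γ s)) * η s)

theorem hasDerivAt_curveArg_left (hγ : ∀ t, HasDerivAt γ (γ' t) t) (t t' s : ℝ) :
    HasDerivAt (fun t => curveArg μ γ t t' s)
      (μ * γ' t * ((starRingEnd ℂ) (γ t') - (starRingEnd ℂ) (γ s))) t := by
  simp only [curveArg, riemannArg]
  refine ((((hγ t).sub_const (γ s)).mul_const _).const_mul (μ : ℂ)).congr_deriv ?_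
  ring

theorem hasDerivAt_conj {f : ℝ → ℂ} {f' : ℂ} {t : ℝ} (h : HasDerivAt f f' t) :
    HasDerivAt (fun t => (starRingEnd ℂ) (f t)) ((starRingEnd ℂ) f') t :=
  (Complex.conjCLE : ℂ →L[ℝ] ℂ).hasFDerivAt.comp_hasDerivAt t h

theorem hasDerivAt_curveArg_right (hγ : ∀ t, HasDerivAt γ (γ' t) t) (t t' s : ℝ) :
    HasDerivAt (fun t' => curveArg μ γ t t' s)
      (μ * (γ t - γ s) * (starRingEnd ℂ) (γ' t')) t' := by
  simp only [curveArg, riemannArg]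
  refine ((((hasDerivAt_conj (hγ t')).sub_const ((starRingEnd ℂ) (γ s))).const_mul
    (γ t - γ s)).const_mul (μ : ℂ)).congr_deriv ?_
  ring

theorem hasDerivAt_besselSeries_comp (m : ℕ) {f : ℝ → ℂ} {f' : ℂ} {t : ℝ} (h : HasDerivAt f f' t) :
    HasDerivAt (fun t => besselSeries m (f t)) (-besselSeries (m + 1) (f t) * f') t :=
  (hasDerivAt_besselSeries m (f t)).comp t h

theorem continuous_conj_comp {X : Type*} [TopologicalSpace X] {f : X → ℂ} (h : Continuous f) :
    Continuous fun x => (starRingEnd ℂ) (f x) :=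
  Complex.continuous_conj.comp h

theorem continuous_curveArg (hγ : Continuous γ) :
    Continuous fun p : ℝ × ℝ × ℝ => curveArg μ γ p.1 p.2.1 p.2.2 := by
  simp only [curveArg, riemannArg]
  have := continuous_conj_comp hγ
  fun_prop

theorem hasDerivAt_curveKernel (hγ : ∀ t, HasDerivAt γ (γ' t) t) (hγ' : Continuous γ')
    (ha : Continuous a) (hη : Continuous η) (t t' : ℝ) :
    HasDerivAt (fun t => curveKernel μ γ γ' a η t t') (curveKernelDeriv μ γ γ' a η t t') t := by
  have hγc : Continuous γ := continuous_iff_continuousAt.2 fun t => (hγ t).continuousAt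
  have hA : Continuous fun p : ℝ × ℝ => curveArg μ γ p.1 t' p.2 :=
    (continuous_curveArg hγc).comp (by fun_prop : Continuous fun p : ℝ × ℝ => (p.1, t', p.2))
  have h1 := continuous_conj_comp hγ'
  have h2 := continuous_conj_comp hγc
  have key := hasDerivAt_intervalIntegral_leibniz
    (g := fun t s => besselSeries 0 (curveArg μ γ t t' s) * η s +
      a s * (μ * (γ t - γ s) * besselSeries 1 (curveArg μ γ t t' s)) * (starRingEnd ℂ) (γ' s))
    (g' := fun t s => μ * γ' t * (a s * besselSeries 0 (curveArg μ γ t t' s) *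
      (starRingEnd ℂ) (γ' s) - besselSeries 1 (curveArg μ γ t t' s) *
      ((starRingEnd ℂ) (γ t') - (starRingEnd ℂ) (γ s)) * η s))
    (by simp only [Function.uncurry_def]; fun_prop) (by simp only [Function.uncurry_def]; fun_prop)
    (fun t s => ?_) t' t
  · refine (key.const_add (a t')).congr_deriv ?_
    rw [curveKernelDeriv]
    congr 1
    simp [curveArg, riemannArg, besselSeries_zero]
  · have hA := hasDerivAt_curveArg_left (μ := μ) hγ t t' s
    refine (((hasDerivAt_besselSeries_comp 0 hA).mul_const (η s)).add
      ((((((hγ t).sub_const (γ s)).const_mul (μ : ℂ)).mul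
        (hasDerivAt_besselSeries_comp 1 hA)).const_mul (a s)).mul_const _)).congr_deriv ?_
    have h3 := besselSeries_rec (curveArg μ γ t t' s)
    have h4 : curveArg μ γ t t' s =
      μ * ((γ t - γ s) * ((starRingEnd ℂ) (γ t') - (starRingEnd ℂ) (γ s))) := rfl
    simp only [zero_add, one_add_one_eq_two]
    linear_combination (-(μ * γ' t * a s * (starRingEnd ℂ) (γ' s))) * h3 +
      (μ * γ' t * a s * (starRingEnd ℂ) (γ' s)) * besselSeries 2 (curveArg μ γ t t' s) * h4

theorem hasDerivAt_curveKernelDeriv (hγ : ∀ t, HasDerivAt γ (γ' t) t) (hγ' : Continuous γ')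
    (ha : Continuous a) (hη : Continuous η) (t t' : ℝ) :
    HasDerivAt (fun t' => curveKernelDeriv μ γ γ' a η t t')
      (-(μ * γ' t * (starRingEnd ℂ) (γ' t')) * curveKernel μ γ γ' a η t t') t' := by
  have hγc : Continuous γ := continuous_iff_continuousAt.2 fun t => (hγ t).continuousAt
  have hA : Continuous fun p : ℝ × ℝ => curveArg μ γ t p.1 p.2 :=
    (continuous_curveArg hγc).comp (by fun_prop : Continuous fun p : ℝ × ℝ => (t, p.1, p.2))
  have h1 := continuous_conj_comp hγ'
  have h2 := continuous_conj_comp hγc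
  have key := hasDerivAt_intervalIntegral_leibniz
    (g := fun t' s => μ * γ' t * (a s * besselSeries 0 (curveArg μ γ t t' s) *
      (starRingEnd ℂ) (γ' s) - besselSeries 1 (curveArg μ γ t t' s) *
      ((starRingEnd ℂ) (γ t') - (starRingEnd ℂ) (γ s)) * η s))
    (g' := fun t' s => -(μ * γ' t * (starRingEnd ℂ) (γ' t')) *
      (besselSeries 0 (curveArg μ γ t t' s) * η s +
      a s * (μ * (γ t - γ s) * besselSeries 1 (curveArg μ γ t t' s)) * (starRingEnd ℂ) (γ' s)))
    (by simp only [Function.uncurry_def]; fun_prop) (by simp only [Function.uncurry_def]; fun_prop)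
    (fun t' s => ?_) t t'
  · have h3 := (key.neg).const_add (η t)
    have h4 : (fun t' => curveKernelDeriv μ γ γ' a η t t') = fun t' => η t + -∫ s in t..t',
        μ * γ' t * (a s * besselSeries 0 (curveArg μ γ t t' s) *
      (starRingEnd ℂ) (γ' s) - besselSeries 1 (curveArg μ γ t t' s) *
      ((starRingEnd ℂ) (γ t') - (starRingEnd ℂ) (γ s)) * η s) := by
      funext t'
      rw [← intervalIntegral.integral_symm, curveKernelDeriv]
    rw [h4]
    refine h3.congr_deriv ?_
    rw [curveKernel, intervalIntegral.integral_const_mul, intervalIntegral.integral_symm t t']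
    simp [curveArg, riemannArg, besselSeries_zero]
    ring
  · have hA := hasDerivAt_curveArg_right (μ := μ) hγ t t' s
    refine ((((((hasDerivAt_besselSeries_comp 0 hA).const_mul (a s)).mul_const
      ((starRingEnd ℂ) (γ' s))).sub (((hasDerivAt_besselSeries_comp 1 hA).mul
      ((hasDerivAt_conj (hγ t')).sub_const ((starRingEnd ℂ) (γ s)))).mul_const (η s))).const_mul
      (μ * γ' t))).congr_deriv ?_
    have h3 := besselSeries_rec (curveArg μ γ t t' s)
    have h4 : curveArg μ γ t t' s =
      μ * ((γ t - γ s) * ((starRingEnd ℂ) (γ t') - (starRingEnd ℂ) (γ s))) := rfl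
    simp only [zero_add, one_add_one_eq_two]
    linear_combination (μ * γ' t * (starRingEnd ℂ) (γ' t') * η s) * h3 -
      (μ * γ' t * (starRingEnd ℂ) (γ' t') * η s) * besselSeries 2 (curveArg μ γ t t' s) * h4

theorem curveKernelDeriv_self (t : ℝ) : curveKernelDeriv μ γ γ' a η t t = η t := by
  simp [curveKernelDeriv]

theorem continuous_intervalIntegral_var {f : ℝ → ℝ → ℝ → ℂ}
    (hf : Continuous fun p : ℝ × ℝ × ℝ => f p.1 p.2.1 p.2.2) :
    Continuous fun p : ℝ × ℝ => ∫ s in p.2..p.1, f p.1 p.2 s := by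
  have hc : ∀ p : ℝ × ℝ, Continuous (f p.1 p.2) := fun p =>
    hf.comp (by fun_prop : Continuous fun s : ℝ => (p.1, p.2, s))
  have h : (fun p : ℝ × ℝ => ∫ s in p.2..p.1, f p.1 p.2 s) =
      fun p : ℝ × ℝ => (∫ s in (0:ℝ)..p.1, f p.1 p.2 s) - ∫ s in (0:ℝ)..p.2, f p.1 p.2 s := by
    funext p
    rw [intervalIntegral.integral_interval_sub_left ((hc p).intervalIntegrable _ _)
      ((hc p).intervalIntegrable _ _)]
  rw [h]
  have hu : Continuous (Function.uncurry fun (p : ℝ × ℝ) s => f p.1 p.2 s) :=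
    hf.comp (by fun_prop : Continuous fun q : (ℝ × ℝ) × ℝ => (q.1.1, q.1.2, q.2))
  exact (intervalIntegral.continuous_parametric_intervalIntegral_of_continuous hu
    continuous_fst).sub (intervalIntegral.continuous_parametric_intervalIntegral_of_continuous hu
    continuous_snd)

theorem continuous_curveKernel (hγ : Continuous γ) (hγ' : Continuous γ')
    (ha : Continuous a) (hη : Continuous η) :
    Continuous fun p : ℝ × ℝ => curveKernel μ γ γ' a η p.1 p.2 := by
  have hA := continuous_curveArg (μ := μ) hγ
  have h1 := continuous_conj_comp hγ'
  have h2 := continuous_conj_comp hγ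
  exact Continuous.add (by fun_prop) (continuous_intervalIntegral_var (f := fun t t' s =>
    besselSeries 0 (curveArg μ γ t t' s) * η s +
    a s * (μ * (γ t - γ s) * besselSeries 1 (curveArg μ γ t t' s)) * (starRingEnd ℂ) (γ' s))
    (by fun_prop))

theorem continuous_curveKernelDeriv (hγ : Continuous γ) (hγ' : Continuous γ')
    (ha : Continuous a) (hη : Continuous η) :
    Continuous fun p : ℝ × ℝ => curveKernelDeriv μ γ γ' a η p.1 p.2 := by
  have hA := continuous_curveArg (μ := μ) hγ
  have h1 := continuous_conj_comp hγ'
  have h2 := continuous_conj_comp hγ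
  exact Continuous.add (by fun_prop) (continuous_intervalIntegral_var (f := fun t t' s =>
    μ * γ' t * (a s * besselSeries 0 (curveArg μ γ t t' s) *
    (starRingEnd ℂ) (γ' s) - besselSeries 1 (curveArg μ γ t t' s) *
      ((starRingEnd ℂ) (γ t') - (starRingEnd ℂ) (γ s)) * η s)) (by fun_prop))

end BoundaryKernel

/-- The integrated form of a hermitian solution of `∂₂ ∂₁ W = c W`. -/
theorem kernel_integral_identities {W W₁ c : ℝ → ℝ → ℂ} {η : ℝ → ℂ}
    (hW : Continuous fun p : ℝ × ℝ => W p.1 p.2) (hW₁ : Continuous fun p : ℝ × ℝ => W₁ p.1 p.2)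
    (hc : Continuous fun p : ℝ × ℝ => c p.1 p.2) (hη : Continuous η)
    (hd : ∀ t t', HasDerivAt (fun t => W t t') (W₁ t t') t)
    (hd' : ∀ t t', HasDerivAt (fun t' => W₁ t t') (c t t' * W t t') t')
    (hdiag : ∀ t, W₁ t t = η t) (hWs : ∀ t t', (starRingEnd ℂ) (W t t') = W t' t)
    (hcs : ∀ t t', (starRingEnd ℂ) (c t t') = c t' t) (s₀ : ℝ) :
    (∀ t, ∫ s in s₀..t, η s =
      W t s₀ - W s₀ s₀ + ∫ τ in s₀..t, ∫ σ in s₀..τ, c τ σ * W τ σ) ∧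
    ∀ t t', W t t' = W t s₀ + (starRingEnd ℂ) (∫ s in s₀..t', η s) +
      ∫ τ in s₀..t', ∫ σ in τ..t, c σ τ * W σ τ := by
  have hcW : Continuous fun p : ℝ × ℝ => c p.1 p.2 * W p.1 p.2 := hc.mul hW
  have hin : ∀ t, Continuous fun σ => c t σ * W t σ := fun t =>
    hcW.comp (by fun_prop : Continuous fun σ : ℝ => (t, σ))
  have hin' : ∀ t, Continuous fun σ => c σ t * W σ t := fun t =>
    hcW.comp (by fun_prop : Continuous fun σ : ℝ => (σ, t))
  have h1 : ∀ t s, W₁ t s = η t - ∫ σ in s..t, c t σ * W t σ := by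
    intro t s
    rw [intervalIntegral.integral_eq_sub_of_hasDerivAt (fun σ _ => hd' t σ)
      ((hin t).intervalIntegrable _ _), hdiag]
    ring
  have hJ : Continuous fun τ => ∫ σ in s₀..τ, c τ σ * W τ σ :=
    intervalIntegral.continuous_parametric_intervalIntegral_of_continuous
      (f := fun τ σ => c τ σ * W τ σ) hcW continuous_id
  refine ⟨fun t => ?_, fun t t' => ?_⟩
  · have hW₁c : Continuous fun τ => W₁ τ s₀ :=
      hW₁.comp (by fun_prop : Continuous fun σ : ℝ => (σ, s₀))
    have h2 := intervalIntegral.integral_eq_sub_of_hasDerivAt (a := s₀) (b := t)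
      (fun τ _ => hd τ s₀)
      (hW₁c.intervalIntegrable _ _)
    rw [← h2, ← intervalIntegral.integral_add
      (hW₁c.intervalIntegrable _ _)
      (hJ.intervalIntegrable _ _)]
    congr 1
    funext τ
    rw [h1 τ s₀]; ring
  · have hd2 : ∀ τ, HasDerivAt (fun τ => W t τ) ((starRingEnd ℂ) (W₁ τ t)) τ := fun τ => by
      simpa only [hWs] using hasDerivAt_conj (hd τ t)
    have hcont : Continuous fun τ => (starRingEnd ℂ) (W₁ τ t) :=
      continuous_conj_comp (hW₁.comp (by fun_prop : Continuous fun τ : ℝ => (τ, t)))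
    have h2 := intervalIntegral.integral_eq_sub_of_hasDerivAt (a := s₀) (b := t')
      (fun τ _ => hd2 τ) (hcont.intervalIntegrable _ _)
    have h3 : (starRingEnd ℂ) (∫ s in s₀..t', η s) = ∫ s in s₀..t', (starRingEnd ℂ) (η s) :=
      (Complex.conjCLE : ℂ →L[ℝ] ℂ).intervalIntegral_comp_comm (hη.intervalIntegrable _ _) |>.symm
    have hcj : Continuous fun τ => ∫ σ in τ..t, c σ τ * W σ τ := by
      have := intervalIntegral.continuous_parametric_intervalIntegral_of_continuous
        (μ := volume) (f := fun τ σ => c σ τ * W σ τ) (a₀ := t)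
        (hcW.comp (by fun_prop : Continuous fun p : ℝ × ℝ => (p.2, p.1))) continuous_id
      refine this.neg.congr fun τ => ?_
      exact (intervalIntegral.integral_symm _ _).symm
    rw [h3, add_assoc, ← intervalIntegral.integral_add
      ((continuous_conj_comp hη).intervalIntegrable _ _) (hcj.intervalIntegrable _ _),
      ← sub_eq_iff_eq_add', ← h2]
    congr 1
    funext τ
    rw [h1 τ t, map_sub, sub_eq_add_neg]
    congr 1
    have h4 : (starRingEnd ℂ) (∫ σ in t..τ, c τ σ * W τ σ) =
        ∫ σ in t..τ, (starRingEnd ℂ) (c τ σ * W τ σ) :=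
      (Complex.conjCLE : ℂ →L[ℝ] ℂ).intervalIntegral_comp_comm
        ((hin τ).intervalIntegrable _ _) |>.symm
    rw [h4, ← intervalIntegral.integral_symm]
    simp only [map_mul, hWs, hcs]

/-- The Volterra-type integral operator on a triangle attached to a boundary kernel. -/
noncomputable def volterra (ε : ℂ) (c f : ℝ → ℝ → ℂ) (t t' : ℝ) : ℂ :=
  ∫ τ in (0:ℝ)..t', (ε * (∫ σ in (0:ℝ)..τ, c τ σ * f τ σ) + ∫ σ in τ..t, c σ τ * f σ τ)

/-- The double integral of `c * f` over the unit triangle. -/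
noncomputable def volterraTrace (c f : ℝ → ℝ → ℂ) : ℂ :=
  ∫ τ in (0:ℝ)..1, ∫ σ in (0:ℝ)..τ, c τ σ * f τ σ

/-- The inhomogeneous term of the Volterra equation. -/
noncomputable def volterraSource (ε : ℂ) (h : ℝ → ℂ) (t r : ℝ) : ℂ := h t + ε * (h r - h 0)

/-- Picard iterates for the Volterra equation `f = volterraSource ε h + volterra ε c f`. -/
noncomputable def picardIter (ε : ℂ) (h : ℝ → ℂ) (c : ℝ → ℝ → ℂ) : ℕ → ℝ → ℝ → ℂ
  | 0 => fun _ _ => 0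
  | n + 1 => fun t t' => volterraSource ε h t t' + volterra ε c (picardIter ε h c n) t t'

theorem norm_integral_le_exp {f : ℝ → ℂ} {a b d K κ : ℝ} (hab : a ≤ b) (hκ : 0 < κ)
    (hf : ∀ s ∈ Ioc a b, ‖f s‖ ≤ K * Real.exp (κ * (s + d))) :
    ‖∫ s in a..b, f s‖ ≤ K / κ * (Real.exp (κ * (b + d)) - Real.exp (κ * (a + d))) := by
  have hd : ∀ s : ℝ, HasDerivAt (fun s => K / κ * Real.exp (κ * (s + d)))
      (K * Real.exp (κ * (s + d))) s := fun s => by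
    refine (((((hasDerivAt_id s).add_const d).const_mul κ).exp).const_mul (K / κ)).congr_deriv ?_
    simp only [id]
    field_simp
  have hc : Continuous fun s => K * Real.exp (κ * (s + d)) := by fun_prop
  refine (intervalIntegral.norm_integral_le_of_norm_le hab (Eventually.of_forall hf)
    (hc.intervalIntegrable _ _)).trans_eq ?_
  rw [intervalIntegral.integral_eq_sub_of_hasDerivAt (fun s _ => hd s) (hc.intervalIntegrable _ _)]
  ring

section Bounds

variable {ε : ℂ} {c f : ℝ → ℝ → ℂ} {M C κ : ℝ}

theorem norm_volterra_le (hε : ‖ε‖ ≤ 1) (hc : ∀ t s, ‖c t s‖ ≤ M) (hκ : 0 < κ)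
    (hM : 2 * M ≤ κ ^ 2) (hC : 0 ≤ C) (hf : ∀ t t', 0 ≤ t' → t' ≤ t → t ≤ 1 →
      ‖f t t'‖ ≤ C * Real.exp (κ * (t + t'))) {t t' : ℝ} (h0 : 0 ≤ t') (h1 : t' ≤ t) (h2 : t ≤ 1) :
    ‖volterra ε c f t t'‖ ≤ C / 2 * Real.exp (κ * (t + t')) := by
  have hM0 : 0 ≤ M := (norm_nonneg _).trans (hc 0 0)
  have hcf : ∀ a b, 0 ≤ b → b ≤ a → a ≤ 1 →
      ‖c a b * f a b‖ ≤ M * C * Real.exp (κ * (a + b)) := fun a b h h' h'' => by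
    rw [norm_mul, mul_assoc]
    exact mul_le_mul (hc a b) (hf a b h h' h'') (norm_nonneg _) hM0
  have key : ∀ τ ∈ Ioc 0 t', ‖ε * (∫ σ in (0:ℝ)..τ, c τ σ * f τ σ) + ∫ σ in τ..t, c σ τ * f σ τ‖ ≤
      M * C / κ * Real.exp (κ * (τ + t)) := by
    rintro τ ⟨hτ0, hτ⟩
    have e1 := norm_integral_le_exp (f := fun σ => c τ σ * f τ σ) (d := τ) (K := M * C) hτ0.le hκ
      fun s hs => by
        rw [add_comm s]; exact hcf _ _ hs.1.le hs.2 (by linarith)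
    have e2 := norm_integral_le_exp (f := fun σ => c σ τ * f σ τ) (d := τ) (K := M * C)
      (hτ.trans h1) hκ fun s hs => hcf _ _ hτ0.le hs.1.le (hs.2.trans h2)
    refine (norm_add_le _ _).trans ?_
    rw [norm_mul]
    have e3 := mul_le_of_le_one_left (norm_nonneg (∫ σ in (0:ℝ)..τ, c τ σ * f τ σ)) hε
    have e4 : 0 ≤ M * C / κ * Real.exp (κ * (0 + τ)) := by positivity
    rw [add_comm τ t]
    linarith
  refine (norm_integral_le_exp h0 hκ key).trans ?_
  have e5 : 0 ≤ M * C / κ / κ * Real.exp (κ * (0 + t)) := by positivity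
  have e6 : M * C / κ / κ ≤ C / 2 := by
    rw [div_div, div_le_div_iff₀ (by positivity) (by norm_num)]
    nlinarith
  rw [add_comm t t']
  nlinarith [mul_le_mul_of_nonneg_right e6 (Real.exp_nonneg (κ * (t' + t)))]

theorem norm_volterraTrace_le (hc : ∀ t s, ‖c t s‖ ≤ M) (hκ : 0 < κ)
    (hM : 2 * M ≤ κ ^ 2) (hC : 0 ≤ C) (hf : ∀ t t', 0 ≤ t' → t' ≤ t → t ≤ 1 →
      ‖f t t'‖ ≤ C * Real.exp (κ * (t + t'))) :
    ‖volterraTrace c f‖ ≤ C / 2 * Real.exp (κ * (1 + 1)) := by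
  have h := norm_volterra_le (ε := 1) (c := c) (f := fun t s => f t s) (by simp) hc hκ hM hC hf
    zero_le_one le_rfl le_rfl
  have hM0 : 0 ≤ M := (norm_nonneg _).trans (hc 0 0)
  have hcf : ∀ a b, 0 ≤ b → b ≤ a → a ≤ 1 →
      ‖c a b * f a b‖ ≤ M * C * Real.exp (κ * (a + b)) := fun a b h h' h'' => by
    rw [norm_mul, mul_assoc]
    exact mul_le_mul (hc a b) (hf a b h h' h'') (norm_nonneg _) hM0
  have key : ∀ τ ∈ Ioc (0:ℝ) 1, ‖∫ σ in (0:ℝ)..τ, c τ σ * f τ σ‖ ≤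
      M * C / κ * Real.exp (κ * (τ + 1)) := by
    rintro τ ⟨hτ0, hτ⟩
    have e1 := norm_integral_le_exp (f := fun σ => c τ σ * f τ σ) (d := τ) (K := M * C) hτ0.le hκ
      fun s hs => by
        rw [add_comm s]; exact hcf _ _ hs.1.le hs.2 hτ
    have e4 : 0 ≤ M * C / κ * Real.exp (κ * (0 + τ)) := by positivity
    have e5 : M * C / κ * Real.exp (κ * (τ + τ)) ≤ M * C / κ * Real.exp (κ * (τ + 1)) := by gcongr
    linarith
  refine (norm_integral_le_exp zero_le_one hκ key).trans ?_
  have e5 : 0 ≤ M * C / κ / κ * Real.exp (κ * (0 + 1)) := by positivity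
  have e6 : M * C / κ / κ ≤ C / 2 := by
    rw [div_div, div_le_div_iff₀ (by positivity) (by norm_num)]
    nlinarith
  nlinarith [mul_le_mul_of_nonneg_right e6 (Real.exp_nonneg (κ * (1 + 1)))]

end Bounds

theorem continuous_intervalIntegral_param {X : Type*} [TopologicalSpace X] {f : X → ℝ → ℂ}
    {a b : X → ℝ} (hf : Continuous fun p : X × ℝ => f p.1 p.2) (ha : Continuous a)
    (hb : Continuous b) : Continuous fun x => ∫ s in a x..b x, f x s := by
  have hc : ∀ x, Continuous (f x) := fun x => hf.comp (Continuous.prodMk_right x)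
  have h : (fun x => ∫ s in a x..b x, f x s) =
      fun x => (∫ s in (0:ℝ)..b x, f x s) - ∫ s in (0:ℝ)..a x, f x s := by
    funext x
    rw [intervalIntegral.integral_interval_sub_left ((hc x).intervalIntegrable _ _)
      ((hc x).intervalIntegrable _ _)]
  rw [h]
  exact (intervalIntegral.continuous_parametric_intervalIntegral_of_continuous hf hb).sub
    (intervalIntegral.continuous_parametric_intervalIntegral_of_continuous hf ha)

section Continuity

variable {X : Type*} [TopologicalSpace X] {ε : ℂ} {c f g : X → ℝ → ℝ → ℂ} {h : X → ℝ → ℂ}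

theorem continuous_inner_left (hc : Continuous fun p : X × ℝ × ℝ => c p.1 p.2.1 p.2.2)
    (hf : Continuous fun p : X × ℝ × ℝ => f p.1 p.2.1 p.2.2) :
    Continuous fun p : X × ℝ => ∫ σ in (0:ℝ)..p.2, c p.1 p.2 σ * f p.1 p.2 σ :=
  continuous_intervalIntegral_param (f := fun (p : X × ℝ) σ => c p.1 p.2 σ * f p.1 p.2 σ)
    ((hc.mul hf).comp (by fun_prop : Continuous fun q : (X × ℝ) × ℝ => (q.1.1, q.1.2, q.2)))
    continuous_const continuous_snd

theorem continuous_inner_right (hc : Continuous fun p : X × ℝ × ℝ => c p.1 p.2.1 p.2.2)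
    (hf : Continuous fun p : X × ℝ × ℝ => f p.1 p.2.1 p.2.2) :
    Continuous fun p : X × ℝ × ℝ => ∫ σ in p.2.2..p.2.1, c p.1 σ p.2.2 * f p.1 σ p.2.2 :=
  continuous_intervalIntegral_param (f := fun (p : X × ℝ × ℝ) σ => c p.1 σ p.2.2 * f p.1 σ p.2.2)
    ((hc.mul hf).comp (by fun_prop : Continuous fun q : (X × ℝ × ℝ) × ℝ => (q.1.1, q.2, q.1.2.2)))
    (by fun_prop) (by fun_prop)

theorem continuous_volterra_integrand (hc : Continuous fun p : X × ℝ × ℝ => c p.1 p.2.1 p.2.2)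
    (hf : Continuous fun p : X × ℝ × ℝ => f p.1 p.2.1 p.2.2) :
    Continuous fun p : X × ℝ × ℝ => ε * (∫ σ in (0:ℝ)..p.2.2, c p.1 p.2.2 σ * f p.1 p.2.2 σ) +
      ∫ σ in p.2.2..p.2.1, c p.1 σ p.2.2 * f p.1 σ p.2.2 :=
  (continuous_const.mul ((continuous_inner_left hc hf).comp
    (by fun_prop : Continuous fun p : X × ℝ × ℝ => (p.1, p.2.2)))).add (continuous_inner_right hc hf)

theorem continuous_volterra (hc : Continuous fun p : X × ℝ × ℝ => c p.1 p.2.1 p.2.2)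
    (hf : Continuous fun p : X × ℝ × ℝ => f p.1 p.2.1 p.2.2) :
    Continuous fun p : X × ℝ × ℝ => volterra ε (c p.1) (f p.1) p.2.1 p.2.2 :=
  continuous_intervalIntegral_param (f := fun (p : X × ℝ × ℝ) τ =>
      ε * (∫ σ in (0:ℝ)..τ, c p.1 τ σ * f p.1 τ σ) + ∫ σ in τ..p.2.1, c p.1 σ τ * f p.1 σ τ)
    ((continuous_volterra_integrand hc hf).comp
      (by fun_prop : Continuous fun q : (X × ℝ × ℝ) × ℝ => (q.1.1, q.1.2.1, q.2)))
    continuous_const (by fun_prop)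

theorem continuous_volterraTrace (hc : Continuous fun p : X × ℝ × ℝ => c p.1 p.2.1 p.2.2)
    (hf : Continuous fun p : X × ℝ × ℝ => f p.1 p.2.1 p.2.2) :
    Continuous fun x => volterraTrace (c x) (f x) :=
  continuous_intervalIntegral_param (f := fun x τ => ∫ σ in (0:ℝ)..τ, c x τ σ * f x τ σ)
    (continuous_inner_left hc hf) continuous_const continuous_const

theorem continuous_picardIter (hh : Continuous fun p : X × ℝ => h p.1 p.2)
    (hc : Continuous fun p : X × ℝ × ℝ => c p.1 p.2.1 p.2.2) (n : ℕ) :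
    Continuous fun p : X × ℝ × ℝ => picardIter ε (h p.1) (c p.1) n p.2.1 p.2.2 := by
  induction n with
  | zero => exact continuous_const
  | succ n ih =>
    have hs : Continuous fun p : X × ℝ × ℝ => volterraSource ε (h p.1) p.2.1 p.2.2 := by
      have h1 : Continuous fun p : X × ℝ × ℝ => h p.1 p.2.1 :=
        hh.comp (by fun_prop : Continuous fun p : X × ℝ × ℝ => (p.1, p.2.1))
      have h2 : Continuous fun p : X × ℝ × ℝ => h p.1 p.2.2 :=
        hh.comp (by fun_prop : Continuous fun p : X × ℝ × ℝ => (p.1, p.2.2))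
      have h3 : Continuous fun p : X × ℝ × ℝ => h p.1 0 :=
        hh.comp (by fun_prop : Continuous fun p : X × ℝ × ℝ => (p.1, (0:ℝ)))
      exact h1.add (continuous_const.mul (h2.sub h3))
    have hv := continuous_volterra (ε := ε) (f := fun x => picardIter ε (h x) (c x) n) hc ih
    exact hs.add hv

end Continuity

section Linear

variable {ε : ℂ} {c f g : ℝ → ℝ → ℂ}

theorem volterra_sub (hc : Continuous fun p : ℝ × ℝ => c p.1 p.2)
    (hf : Continuous fun p : ℝ × ℝ => f p.1 p.2) (hg : Continuous fun p : ℝ × ℝ => g p.1 p.2)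
    (t t' : ℝ) :
    volterra ε c (fun t t' => f t t' - g t t') t t' = volterra ε c f t t' - volterra ε c g t t' := by
  have lift : ∀ {u : ℝ → ℝ → ℂ}, (Continuous fun p : ℝ × ℝ => u p.1 p.2) →
      Continuous fun p : Unit × ℝ × ℝ => u p.2.1 p.2.2 := fun hu => hu.comp continuous_snd
  have h1 : ∀ {u : ℝ → ℝ → ℂ}, (Continuous fun p : ℝ × ℝ => u p.1 p.2) → ∀ s,
      Continuous (u s) := fun hu s => hu.comp (Continuous.prodMk_right s)
  have h2 : ∀ {u : ℝ → ℝ → ℂ}, (Continuous fun p : ℝ × ℝ => u p.1 p.2) → ∀ s,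
      Continuous fun r => u r s := fun hu s => hu.comp (Continuous.prodMk_left s)
  have h3 : ∀ {u : ℝ → ℝ → ℂ}, (Continuous fun p : ℝ × ℝ => u p.1 p.2) → Continuous fun τ =>
      ε * (∫ σ in (0:ℝ)..τ, c τ σ * u τ σ) + ∫ σ in τ..t, c σ τ * u σ τ := fun {u} hu =>
    (continuous_volterra_integrand (X := Unit) (c := fun _ => c) (f := fun _ => u)
      (lift hc) (lift hu)).comp (by fun_prop : Continuous fun τ : ℝ => ((), t, τ))
  rw [volterra, volterra, volterra, ← intervalIntegral.integral_sub
    ((h3 hf).intervalIntegrable _ _) ((h3 hg).intervalIntegrable _ _)]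
  congr 1
  funext τ
  have e1 := intervalIntegral.integral_sub (μ := volume) (a := 0) (b := τ)
    (((h1 hc τ).mul (h1 hf τ)).intervalIntegrable _ _)
    (((h1 hc τ).mul (h1 hg τ)).intervalIntegrable _ _)
  have e2 := intervalIntegral.integral_sub (μ := volume) (a := τ) (b := t)
    (((h2 hc τ).mul (h2 hf τ)).intervalIntegrable _ _)
    (((h2 hc τ).mul (h2 hg τ)).intervalIntegrable _ _)
  simp only [Pi.mul_apply] at e1 e2
  simp only [mul_sub, e1, e2]
  ring

theorem volterraTrace_sub (hc : Continuous fun p : ℝ × ℝ => c p.1 p.2)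
    (hf : Continuous fun p : ℝ × ℝ => f p.1 p.2) (hg : Continuous fun p : ℝ × ℝ => g p.1 p.2) :
    volterraTrace c (fun t t' => f t t' - g t t') = volterraTrace c f - volterraTrace c g := by
  have lift : ∀ {u : ℝ → ℝ → ℂ}, (Continuous fun p : ℝ × ℝ => u p.1 p.2) →
      Continuous fun p : Unit × ℝ × ℝ => u p.2.1 p.2.2 := fun hu => hu.comp continuous_snd
  have h1 : ∀ {u : ℝ → ℝ → ℂ}, (Continuous fun p : ℝ × ℝ => u p.1 p.2) → ∀ s,
      Continuous (u s) := fun hu s => hu.comp (Continuous.prodMk_right s)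
  have h3 : ∀ {u : ℝ → ℝ → ℂ}, (Continuous fun p : ℝ × ℝ => u p.1 p.2) → Continuous fun τ =>
      (∫ σ in (0:ℝ)..τ, c τ σ * u τ σ) := fun {u} hu =>
    (continuous_inner_left (X := Unit) (c := fun _ => c) (f := fun _ => u)
      (lift hc) (lift hu)).comp (by fun_prop : Continuous fun τ : ℝ => ((), τ))
  rw [volterraTrace, volterraTrace, volterraTrace, ← intervalIntegral.integral_sub
    ((h3 hf).intervalIntegrable _ _) ((h3 hg).intervalIntegrable _ _)]
  congr 1
  funext τ
  have e1 := intervalIntegral.integral_sub (μ := volume) (a := 0) (b := τ)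
    (((h1 hc τ).mul (h1 hf τ)).intervalIntegrable _ _)
    (((h1 hc τ).mul (h1 hg τ)).intervalIntegrable _ _)
  simp only [Pi.mul_apply] at e1
  simp only [mul_sub, e1]

end Linear

section PicardFamily

variable {U V : Set ℂ} {ε : ℂ} {h : ℂ → ℝ → ℂ} {c f : ℂ → ℝ → ℝ → ℂ} {B M κ : ℝ}

theorem differentiableOn_inner {g : ℂ → ℝ → ℂ} (hV : IsOpen V) (hVU : V ⊆ U) {a b : ℝ}
    (hg : Continuous fun p : U × ℝ => g p.1 p.2) (hgd : ∀ s, DifferentiableOn ℂ (fun ζ => g ζ s) V) :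
    DifferentiableOn ℂ (fun ζ => ∫ s in a..b, g ζ s) V := by
  refine differentiableOn_intervalIntegral_of_continuousOn hV ?_ fun s _ => hgd s
  rw [continuousOn_iff_continuous_domRestrict]
  exact hg.comp ((Continuous.subtype_mk (by fun_prop : Continuous fun p : V ×ˢ uIcc a b =>
    (p : ℂ × ℝ).1) fun p => hVU p.2.1).prodMk (by fun_prop : Continuous fun p : V ×ˢ uIcc a b =>
    (p : ℂ × ℝ).2))

theorem differentiableOn_volterra (hV : IsOpen V) (hVU : V ⊆ U)
    (hc : Continuous fun p : U × ℝ × ℝ => c p.1 p.2.1 p.2.2)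
    (hcd : ∀ t s, DifferentiableOn ℂ (fun ζ => c ζ t s) V)
    (hf : Continuous fun p : U × ℝ × ℝ => f p.1 p.2.1 p.2.2)
    (hfd : ∀ t s, DifferentiableOn ℂ (fun ζ => f ζ t s) V) (t t' : ℝ) :
    DifferentiableOn ℂ (fun ζ => volterra ε (c ζ) (f ζ) t t') V := by
  refine differentiableOn_inner (g := fun ζ τ =>
    (ε * (∫ σ in (0:ℝ)..τ, c ζ τ σ * f ζ τ σ) + ∫ σ in τ..t, c ζ σ τ * f ζ σ τ)) hV hVU
    ((continuous_volterra_integrand (c := fun x : U => c x) (f := fun x : U => f x) hc hf).comp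
      (by fun_prop : Continuous fun p : U × ℝ => (p.1, t, p.2))) fun τ => ?_
  refine (DifferentiableOn.const_mul (differentiableOn_inner hV hVU ?_ fun s =>
    (hcd τ s).mul (hfd τ s)) ε).add (differentiableOn_inner hV hVU ?_ fun s =>
    (hcd s τ).mul (hfd s τ))
  · exact (hc.mul hf).comp (by fun_prop : Continuous fun p : U × ℝ => (p.1, τ, p.2))
  · exact (hc.mul hf).comp (by fun_prop : Continuous fun p : U × ℝ => (p.1, p.2, τ))

theorem differentiableOn_volterraTrace (hV : IsOpen V) (hVU : V ⊆ U)
    (hc : Continuous fun p : U × ℝ × ℝ => c p.1 p.2.1 p.2.2)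
    (hcd : ∀ t s, DifferentiableOn ℂ (fun ζ => c ζ t s) V)
    (hf : Continuous fun p : U × ℝ × ℝ => f p.1 p.2.1 p.2.2)
    (hfd : ∀ t s, DifferentiableOn ℂ (fun ζ => f ζ t s) V) :
    DifferentiableOn ℂ (fun ζ => volterraTrace (c ζ) (f ζ)) V := by
  refine differentiableOn_inner (g := fun ζ τ => ∫ σ in (0:ℝ)..τ, c ζ τ σ * f ζ τ σ) hV hVU
    (continuous_inner_left (c := fun x : U => c x) (f := fun x : U => f x) hc hf) fun τ => ?_
  refine differentiableOn_inner hV hVU ?_ fun s => (hcd τ s).mul (hfd τ s)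
  exact (hc.mul hf).comp (by fun_prop : Continuous fun p : U × ℝ => (p.1, τ, p.2))

theorem differentiableOn_picardIter (hV : IsOpen V) (hVU : V ⊆ U)
    (hh : Continuous fun p : U × ℝ => h p.1 p.2)
    (hhd : ∀ t, DifferentiableOn ℂ (fun ζ => h ζ t) V)
    (hc : Continuous fun p : U × ℝ × ℝ => c p.1 p.2.1 p.2.2)
    (hcd : ∀ t s, DifferentiableOn ℂ (fun ζ => c ζ t s) V) (n : ℕ) (t t' : ℝ) :
    DifferentiableOn ℂ (fun ζ => picardIter ε (h ζ) (c ζ) n t t') V := by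
  induction n generalizing t t' with
  | zero => exact differentiableOn_const _
  | succ n ih =>
    have h1 := differentiableOn_volterra (ε := ε) (f := fun ζ => picardIter ε (h ζ) (c ζ) n)
      hV hVU hc hcd (continuous_picardIter (h := fun x : U => h x) (c := fun x : U => c x) hh hc n)
      ih t t'
    exact ((hhd t).add (((hhd t').sub (hhd 0)).const_mul ε)).add h1

end PicardFamily

section Convergence

variable {ε : ℂ} {h : ℝ → ℂ} {c w : ℝ → ℝ → ℂ} {B M κ : ℝ}

theorem norm_volterraSource_le (hε : ‖ε‖ ≤ 1) (hB : ∀ t, ‖h t‖ ≤ B) (t t' : ℝ) :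
    ‖volterraSource ε h t t'‖ ≤ 3 * B := by
  refine (norm_add_le _ _).trans ?_
  rw [norm_mul]
  have h1 := mul_le_of_le_one_left (norm_nonneg (h t' - h 0)) hε
  have h2 := norm_sub_le (h t') (h 0)
  linarith [hB t, hB t', hB 0]

theorem norm_picardIter_le (hε : ‖ε‖ ≤ 1) (hB : ∀ t, ‖h t‖ ≤ B) (hc : ∀ t s, ‖c t s‖ ≤ M)
    (hκ : 0 < κ) (hM : 2 * M ≤ κ ^ 2) (n : ℕ) (t t' : ℝ) (h0 : 0 ≤ t') (h1 : t' ≤ t) (h2 : t ≤ 1) :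
    ‖picardIter ε h c n t t'‖ ≤ 6 * B * Real.exp (κ * (t + t')) := by
  have hB0 : 0 ≤ B := (norm_nonneg _).trans (hB 0)
  induction n generalizing t t' with
  | zero => simp only [picardIter, norm_zero]; positivity
  | succ n ih =>
    have e1 := norm_volterra_le hε hc hκ hM (by positivity) ih h0 h1 h2
    have e2 : 1 ≤ Real.exp (κ * (t + t')) := Real.one_le_exp (by nlinarith)
    refine (norm_add_le _ _).trans ?_
    nlinarith [norm_volterraSource_le hε hB t t']

theorem continuous_picardIter' (hh : Continuous h) (hcc : Continuous fun p : ℝ × ℝ => c p.1 p.2)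
    (n : ℕ) : Continuous fun p : ℝ × ℝ => picardIter ε h c n p.1 p.2 :=
  (continuous_picardIter (X := Unit) (h := fun _ => h) (c := fun _ => c)
    (hh.comp continuous_snd) (hcc.comp continuous_snd) n).comp
    (by fun_prop : Continuous fun p : ℝ × ℝ => ((), p))

theorem norm_sub_picardIter_le (hε : ‖ε‖ ≤ 1) (hh : Continuous h)
    (hcc : Continuous fun p : ℝ × ℝ => c p.1 p.2) (hc : ∀ t s, ‖c t s‖ ≤ M)
    (hκ : 0 < κ) (hM : 2 * M ≤ κ ^ 2) (hw : Continuous fun p : ℝ × ℝ => w p.1 p.2)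
    (hfix : ∀ t t', 0 ≤ t' → t' ≤ t → t ≤ 1 →
      w t t' = volterraSource ε h t t' + volterra ε c w t t') {K : ℝ} (hK : 0 ≤ K)
    (hwK : ∀ t t', 0 ≤ t' → t' ≤ t → t ≤ 1 → ‖w t t'‖ ≤ K) (n : ℕ) (t t' : ℝ)
    (h0 : 0 ≤ t') (h1 : t' ≤ t) (h2 : t ≤ 1) :
    ‖w t t' - picardIter ε h c n t t'‖ ≤ K * (1 / 2) ^ n * Real.exp (κ * (t + t')) := by
  induction n generalizing t t' with
  | zero =>
    have e2 : 1 ≤ Real.exp (κ * (t + t')) := Real.one_le_exp (by nlinarith)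
    simp only [picardIter, sub_zero, pow_zero, mul_one]
    nlinarith [hwK t t' h0 h1 h2]
  | succ n ih =>
    have e1 := norm_volterra_le hε hc hκ hM (by positivity) ih h0 h1 h2
    rw [volterra_sub hcc hw (continuous_picardIter' hh hcc n)] at e1
    rw [hfix t t' h0 h1 h2, picardIter, add_sub_add_left_eq_sub]
    refine e1.trans_eq ?_
    ring

theorem norm_picardIter_succ_sub_le (hε : ‖ε‖ ≤ 1) (hh : Continuous h) (hB : ∀ t, ‖h t‖ ≤ B)
    (hcc : Continuous fun p : ℝ × ℝ => c p.1 p.2) (hc : ∀ t s, ‖c t s‖ ≤ M)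
    (hκ : 0 < κ) (hM : 2 * M ≤ κ ^ 2) (n : ℕ) (t t' : ℝ)
    (h0 : 0 ≤ t') (h1 : t' ≤ t) (h2 : t ≤ 1) :
    ‖picardIter ε h c (n + 1) t t' - picardIter ε h c n t t'‖ ≤
      6 * B * (1 / 2) ^ n * Real.exp (κ * (t + t')) := by
  have hB0 : 0 ≤ B := (norm_nonneg _).trans (hB 0)
  induction n generalizing t t' with
  | zero =>
    simpa [picardIter] using norm_picardIter_le hε hB hc hκ hM 1 t t' h0 h1 h2
  | succ n ih =>
    have e1 := norm_volterra_le hε hc hκ hM (by positivity) ih h0 h1 h2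
    rw [volterra_sub hcc (continuous_picardIter' hh hcc _) (continuous_picardIter' hh hcc n)] at e1
    rw [picardIter, picardIter.eq_def ε h c (n + 1), add_sub_add_left_eq_sub]
    refine e1.trans_eq ?_
    ring

end Convergence

/-- Solutions of a holomorphic family of Volterra equations have a holomorphic trace. -/
theorem exists_volterra_trace {U V : Set ℂ} {ε : ℂ} {h : ℂ → ℝ → ℂ} {c : ℂ → ℝ → ℝ → ℂ}
    {B M κ : ℝ} (hV : IsOpen V) (hVU : V ⊆ U)
    (hh : Continuous fun p : U × ℝ => h p.1 p.2)
    (hhd : ∀ t, DifferentiableOn ℂ (fun ζ => h ζ t) V)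
    (hc : Continuous fun p : U × ℝ × ℝ => c p.1 p.2.1 p.2.2)
    (hcd : ∀ t s, DifferentiableOn ℂ (fun ζ => c ζ t s) V) (hε : ‖ε‖ ≤ 1) (hB0 : 0 ≤ B)
    (hB : ∀ ζ ∈ U, ∀ t, ‖h ζ t‖ ≤ B) (hM : ∀ ζ ∈ U, ∀ t s, ‖c ζ t s‖ ≤ M)
    (hκ : 0 < κ) (hMκ : 2 * M ≤ κ ^ 2) :
    ∃ Y : ℂ → ℂ, ContinuousOn Y U ∧ DifferentiableOn ℂ Y V ∧
      (∀ ζ ∈ U, ‖Y ζ‖ ≤ 5 * B * Real.exp (2 * κ)) ∧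
      ∀ ζ ∈ U, ∀ w : ℝ → ℝ → ℂ, (Continuous fun p : ℝ × ℝ => w p.1 p.2) →
        (∀ t t', 0 ≤ t' → t' ≤ t → t ≤ 1 →
          w t t' = volterraSource ε (h ζ) t t' + volterra ε (c ζ) w t t') →
        Y ζ = h ζ 1 - h ζ 0 + volterraTrace (c ζ) w := by
  set F : ℕ → ℂ → ℂ := fun n ζ =>
    h ζ 1 - h ζ 0 + volterraTrace (c ζ) (picardIter ε (h ζ) (c ζ) n) with hF
  have hh' : ∀ ζ ∈ U, Continuous (h ζ) := fun ζ hζ =>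
    hh.comp (by fun_prop : Continuous fun t : ℝ => ((⟨ζ, hζ⟩ : U), t))
  have hc' : ∀ ζ ∈ U, Continuous fun p : ℝ × ℝ => c ζ p.1 p.2 := fun ζ hζ =>
    hc.comp (by fun_prop : Continuous fun p : ℝ × ℝ => ((⟨ζ, hζ⟩ : U), p))
  have hgeo : ∀ ζ ∈ U, ∀ n, dist (F n ζ) (F (n + 1) ζ) ≤
      3 * B * Real.exp (κ * (1 + 1)) * (1 / 2) ^ n := fun ζ hζ n => by
    have e := norm_volterraTrace_le (hM ζ hζ) hκ hMκ (by positivity)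
      (norm_picardIter_succ_sub_le hε (hh' ζ hζ) (hB ζ hζ) (hc' ζ hζ) (hM ζ hζ) hκ hMκ n)
    rw [volterraTrace_sub (hc' ζ hζ) (continuous_picardIter' (hh' ζ hζ) (hc' ζ hζ) _)
      (continuous_picardIter' (hh' ζ hζ) (hc' ζ hζ) n)] at e
    rw [dist_comm, dist_eq_norm, hF]
    simp only [add_sub_add_left_eq_sub]
    refine e.trans_eq ?_
    ring
  have hlim : ∀ ζ, ∃ y, ζ ∈ U → Tendsto (fun n => F n ζ) atTop (𝓝 y) := fun ζ => by
    by_cases hζ : ζ ∈ U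
    · obtain ⟨y, hy⟩ := cauchySeq_tendsto_of_complete
        (cauchySeq_of_le_geometric _ _ (by norm_num) (hgeo ζ hζ))
      exact ⟨y, fun _ => hy⟩
    · exact ⟨0, fun h => absurd h hζ⟩
  choose Y hY using hlim
  have hunif : TendstoUniformlyOn F Y atTop U := by
    rw [Metric.tendstoUniformlyOn_iff]
    intro e he
    have ht : Tendsto (fun n : ℕ => 3 * B * Real.exp (κ * (1 + 1)) * (1 / 2) ^ n / (1 - 1 / 2))
        atTop (𝓝 (3 * B * Real.exp (κ * (1 + 1)) * 0 / (1 - 1 / 2))) :=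
      ((tendsto_pow_atTop_nhds_zero_of_lt_one (by norm_num) (by norm_num)).const_mul _).div_const _
    rw [mul_zero, zero_div] at ht
    filter_upwards [ht.eventually_lt_const he] with n hn ζ hζ
    rw [dist_comm]
    exact (dist_le_of_le_geometric_of_tendsto _ _ (by norm_num) (hgeo ζ hζ) (hY ζ hζ) n).trans_lt hn
  refine ⟨Y, ?_, ?_, ?_, ?_⟩
  · refine hunif.continuousOn (Frequently.of_forall fun n => ?_)
    rw [continuousOn_iff_continuous_domRestrict]
    have h1 : ∀ t : ℝ, Continuous fun ζ : U => h ζ t := fun t =>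
      hh.comp (by fun_prop : Continuous fun ζ : U => (ζ, t))
    exact ((h1 1).sub (h1 0)).add (continuous_volterraTrace (c := fun x : U => c x)
      (f := fun x : U => picardIter ε (h x) (c x) n) hc
      (continuous_picardIter (h := fun x : U => h x) (c := fun x : U => c x) hh hc n))
  · refine (hunif.mono hVU).tendstoLocallyUniformlyOn.differentiableOn
      (Eventually.of_forall fun n => ?_) hV
    exact ((hhd 1).sub (hhd 0)).add (differentiableOn_volterraTrace hV hVU hc hcd
      (continuous_picardIter (h := fun x : U => h x) (c := fun x : U => c x) hh hc n)
      (differentiableOn_picardIter hV hVU hh hhd hc hcd n))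
  · intro ζ hζ
    refine le_of_tendsto (hY ζ hζ).norm (Eventually.of_forall fun n => ?_)
    have e := norm_volterraTrace_le (hM ζ hζ) hκ hMκ (by positivity)
      (norm_picardIter_le hε (hB ζ hζ) (hM ζ hζ) hκ hMκ n)
    have e2 : 1 ≤ Real.exp (κ * (1 + 1)) := Real.one_le_exp (by nlinarith)
    have e3 : 2 * κ = κ * (1 + 1) := by ring
    refine (norm_add_le _ _).trans ?_
    have e4 := norm_sub_le (h ζ 1) (h ζ 0)
    have e5 := mul_le_mul_of_nonneg_left e2 hB0
    have e6 := hB ζ hζ 1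
    have e7 := hB ζ hζ 0
    rw [e3]
    generalize Real.exp (κ * (1 + 1)) = E at *
    linarith
  · intro ζ hζ w hw hfix
    obtain ⟨K, hK⟩ := (isCompact_Icc (a := (0:ℝ)) (b := 1)).prod (isCompact_Icc (a := (0:ℝ)) (b := 1))
      |>.exists_bound_of_continuousOn hw.continuousOn
    have hK0 : 0 ≤ K := (norm_nonneg _).trans (hK (0, 0) (by simp))
    have hwK : ∀ t t', 0 ≤ t' → t' ≤ t → t ≤ 1 → ‖w t t'‖ ≤ K := fun t t' h0 h1 h2 =>
      hK (t, t') ⟨⟨h0.trans h1, h2⟩, ⟨h0, h1.trans h2⟩⟩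
    refine tendsto_nhds_unique (hY ζ hζ) ?_
    rw [tendsto_iff_norm_sub_tendsto_zero]
    refine squeeze_zero (g := fun n : ℕ => K * (1 / 2) ^ n / 2 * Real.exp (κ * (1 + 1)))
      (fun n => norm_nonneg _) (fun n => ?_) ?_
    · have e := norm_volterraTrace_le (hM ζ hζ) hκ hMκ (by positivity)
        (norm_sub_picardIter_le hε (hh' ζ hζ) (hc' ζ hζ) (hM ζ hζ) hκ hMκ hw hfix hK0 hwK n)
      rw [volterraTrace_sub (hc' ζ hζ) hw (continuous_picardIter' (hh' ζ hζ) (hc' ζ hζ) n),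
        norm_sub_rev] at e
      simpa only [hF, add_sub_add_left_eq_sub] using e
    · have ht : Tendsto (fun n : ℕ => K * (1 / 2 : ℝ) ^ n / 2 * Real.exp (κ * (1 + 1)))
          atTop (𝓝 (K * 0 / 2 * Real.exp (κ * (1 + 1)))) :=
        (((tendsto_pow_atTop_nhds_zero_of_lt_one (by norm_num) (by norm_num)).const_mul _).div_const
          _).mul_const _
      simpa using ht

theorem volterra_rescale (ε : ℂ) (C W : ℝ → ℝ → ℂ) (s₀ x t t' : ℝ) :
    volterra ε (fun t s => (x:ℂ) ^ 2 * C (s₀ + x * t) (s₀ + x * s))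
      (fun t s => W (s₀ + x * t) (s₀ + x * s)) t t' =
    ∫ τ in s₀..s₀ + x * t', (ε * (∫ σ in s₀..τ, C τ σ * W τ σ) +
      ∫ σ in τ..s₀ + x * t, C σ τ * W σ τ) := by
  have h1 := intervalIntegral.smul_integral_comp_add_mul (a := 0) (b := t')
    (fun τ => ε * (∫ σ in s₀..τ, C τ σ * W τ σ) + ∫ σ in τ..s₀ + x * t, C σ τ * W σ τ) x s₀
  rw [mul_zero, add_zero] at h1
  rw [← h1, volterra, Complex.real_smul, ← intervalIntegral.integral_const_mul]
  congr 1
  funext τ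
  have h2 := intervalIntegral.smul_integral_comp_add_mul (a := 0) (b := τ)
    (fun σ => C (s₀ + x * τ) σ * W (s₀ + x * τ) σ) x s₀
  have h3 := intervalIntegral.smul_integral_comp_add_mul (a := τ) (b := t)
    (fun σ => C σ (s₀ + x * τ) * W σ (s₀ + x * τ)) x s₀
  rw [mul_zero, add_zero] at h2
  rw [← h2, ← h3]
  simp only [mul_assoc, intervalIntegral.integral_const_mul, Complex.real_smul]
  ring

theorem volterraTrace_rescale (C W : ℝ → ℝ → ℂ) (s₀ x : ℝ) :
    volterraTrace (fun t s => (x:ℂ) ^ 2 * C (s₀ + x * t) (s₀ + x * s))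
      (fun t s => W (s₀ + x * t) (s₀ + x * s)) =
    ∫ τ in s₀..s₀ + x, ∫ σ in s₀..τ, C τ σ * W τ σ := by
  have h1 := intervalIntegral.smul_integral_comp_add_mul (a := 0) (b := 1)
    (fun τ => ∫ σ in s₀..τ, C τ σ * W τ σ) x s₀
  rw [mul_zero, add_zero, mul_one] at h1
  rw [← h1, volterraTrace, Complex.real_smul, ← intervalIntegral.integral_const_mul]
  congr 1
  funext τ
  have h2 := intervalIntegral.smul_integral_comp_add_mul (a := 0) (b := τ)
    (fun σ => C (s₀ + x * τ) σ * W (s₀ + x * τ) σ) x s₀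
  rw [mul_zero, add_zero] at h2
  rw [← h2]
  simp only [mul_assoc, intervalIntegral.integral_const_mul, Complex.real_smul]
  ring

theorem volterra_congr {ε : ℂ} {c c' : ℝ → ℝ → ℂ}
    (h : ∀ t ∈ Icc (0:ℝ) 1, ∀ s ∈ Icc (0:ℝ) 1, c t s = c' t s) (w : ℝ → ℝ → ℂ) {t t' : ℝ}
    (h0 : 0 ≤ t') (h1 : t' ≤ t) (h2 : t ≤ 1) : volterra ε c w t t' = volterra ε c' w t t' := by
  refine intervalIntegral.integral_congr fun τ hτ => ?_
  rw [uIcc_of_le h0] at hτ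
  have hτ1 : τ ∈ Icc (0:ℝ) 1 := ⟨hτ.1, by linarith [hτ.2]⟩
  have e1 : ∫ σ in (0:ℝ)..τ, c τ σ * w τ σ = ∫ σ in (0:ℝ)..τ, c' τ σ * w τ σ :=
    intervalIntegral.integral_congr fun σ hσ => by
      rw [uIcc_of_le hτ.1] at hσ
      simp only [h τ hτ1 σ ⟨hσ.1, hσ.2.trans hτ1.2⟩]
  have e2 : ∫ σ in τ..t, c σ τ * w σ τ = ∫ σ in τ..t, c' σ τ * w σ τ :=
    intervalIntegral.integral_congr fun σ hσ => by
      rw [uIcc_of_le (hτ.2.trans h1)] at hσ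
      simp only [h σ ⟨hτ.1.trans hσ.1, hσ.2.trans h2⟩ τ hτ1]
  simp only [e1, e2]

theorem volterraTrace_congr {c c' : ℝ → ℝ → ℂ}
    (h : ∀ t ∈ Icc (0:ℝ) 1, ∀ s ∈ Icc (0:ℝ) 1, c t s = c' t s) (w : ℝ → ℝ → ℂ) :
    volterraTrace c w = volterraTrace c' w := by
  refine intervalIntegral.integral_congr fun τ hτ => ?_
  rw [uIcc_of_le zero_le_one] at hτ
  refine intervalIntegral.integral_congr fun σ hσ => ?_
  rw [uIcc_of_le hτ.1] at hσ
  simp only [h τ hτ σ ⟨hσ.1, hσ.2.trans hτ.2⟩]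

/-- A half-open box above the real axis, centred at `s₀`. -/
def halfBox (s₀ ρ δ : ℝ) : Set ℂ := {ζ | |ζ.re - s₀| < ρ ∧ 0 ≤ ζ.im ∧ ζ.im < δ}

/-- An open box above the real axis, centred at `s₀`. -/
def openHalfBox (s₀ ρ δ : ℝ) : Set ℂ := {ζ | |ζ.re - s₀| < ρ ∧ 0 < ζ.im ∧ ζ.im < δ}

theorem isOpen_openHalfBox (s₀ ρ δ : ℝ) : IsOpen (openHalfBox s₀ ρ δ) := by
  have h1 : IsOpen {ζ : ℂ | |ζ.re - s₀| < ρ} := isOpen_lt (by fun_prop) continuous_const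
  have h2 : IsOpen {ζ : ℂ | 0 < ζ.im} := isOpen_lt continuous_const (by fun_prop)
  have h3 : IsOpen {ζ : ℂ | ζ.im < δ} := isOpen_lt (by fun_prop) continuous_const
  exact h1.inter (h2.inter h3)

theorem openHalfBox_subset (s₀ ρ δ : ℝ) : openHalfBox s₀ ρ δ ⊆ halfBox s₀ ρ δ :=
  fun _ h => ⟨h.1, h.2.1.le, h.2.2⟩

/-- The segment from `s₀` to `ζ`, extended to be constant outside of `[0, 1]`. -/
noncomputable def clampSeg (s₀ : ℝ) (ζ : ℂ) (t : ℝ) : ℂ :=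
  s₀ + (projIcc (0:ℝ) 1 zero_le_one t : ℝ) * (ζ - s₀)

theorem clampSeg_of_mem {s₀ t : ℝ} (ζ : ℂ) (ht : t ∈ Icc (0:ℝ) 1) :
    clampSeg s₀ ζ t = s₀ + t * (ζ - s₀) := by
  rw [clampSeg, projIcc_of_mem _ ht]

theorem continuous_clampSeg (s₀ : ℝ) : Continuous fun p : ℂ × ℝ => clampSeg s₀ p.1 p.2 := by
  simp only [clampSeg]
  have : Continuous fun p : ℂ × ℝ => (projIcc (0:ℝ) 1 zero_le_one p.2 : ℝ) :=
    continuous_subtype_val.comp (continuous_projIcc.comp continuous_snd)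
  fun_prop

theorem clampSeg_mem {s₀ ρ δ : ℝ} {ζ : ℂ} (h : ζ ∈ halfBox s₀ ρ δ) (t : ℝ) :
    clampSeg s₀ ζ t ∈ halfBox s₀ ρ δ := by
  obtain ⟨h0, h1⟩ := (projIcc (0:ℝ) 1 zero_le_one t).2
  rw [clampSeg]
  set r : ℝ := ↑(projIcc (0:ℝ) 1 zero_le_one t)
  obtain ⟨a1, a2, a3⟩ := h
  refine ⟨?_, ?_, ?_⟩
  · have : ((s₀ : ℂ) + r * (ζ - s₀)).re - s₀ = r * (ζ.re - s₀) := by simp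
    rw [this, abs_mul, abs_of_nonneg h0]
    exact (mul_le_of_le_one_left (abs_nonneg _) h1).trans_lt a1
  · have : ((s₀ : ℂ) + r * (ζ - s₀)).im = r * ζ.im := by simp
    rw [this]; positivity
  · have : ((s₀ : ℂ) + r * (ζ - s₀)).im = r * ζ.im := by simp
    rw [this]
    exact (mul_le_of_le_one_left a2 h1).trans_lt a3

theorem differentiableOn_comp_clampSeg {s₀ ρ δ : ℝ} {f : ℂ → ℂ}
    (hf : DifferentiableOn ℂ f (openHalfBox s₀ ρ δ)) (t : ℝ) :
    DifferentiableOn ℂ (fun ζ => f (clampSeg s₀ ζ t)) (openHalfBox s₀ ρ δ) := by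
  rcases (projIcc (0:ℝ) 1 zero_le_one t).2.1.eq_or_lt with h0 | h0
  · have : (fun ζ => f (clampSeg s₀ ζ t)) = fun _ => f s₀ := by
      funext ζ; rw [clampSeg, ← h0]; simp
    rw [this]
    exact differentiableOn_const _
  · have hd : Differentiable ℂ fun ζ => clampSeg s₀ ζ t := by
      simp only [clampSeg]; fun_prop
    refine hf.comp hd.differentiableOn fun ζ hζ => ?_
    have := clampSeg_mem (openHalfBox_subset _ _ _ hζ) t
    refine ⟨this.1, ?_, this.2.2⟩
    have e : (clampSeg s₀ ζ t).im = (projIcc (0:ℝ) 1 zero_le_one t : ℝ) * ζ.im := by simp [clampSeg]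
    rw [e]
    exact mul_pos h0 hζ.2.1

theorem continuous_comp_clampSeg {s₀ ρ δ : ℝ} {f : ℂ → ℂ} (hf : ContinuousOn f (halfBox s₀ ρ δ)) :
    Continuous fun p : halfBox s₀ ρ δ × ℝ => f (clampSeg s₀ p.1 p.2) :=
  hf.comp_continuous ((continuous_clampSeg s₀).comp
    (by fun_prop : Continuous fun p : halfBox s₀ ρ δ × ℝ => ((p.1 : ℂ), p.2)))
    fun p => clampSeg_mem p.1.2 p.2

/-- The boundary primitive attached to a kernel extends holomorphically to a half box. -/
theorem exists_boundary_primitive {s₀ ρ δ B D κ : ℝ} {ε k : ℂ} {H p q : ℂ → ℂ} {W : ℝ → ℝ → ℂ}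
    (hHc : ContinuousOn H (halfBox s₀ ρ δ)) (hHd : DifferentiableOn ℂ H (openHalfBox s₀ ρ δ))
    (hpc : ContinuousOn p (halfBox s₀ ρ δ)) (hpd : DifferentiableOn ℂ p (openHalfBox s₀ ρ δ))
    (hqc : ContinuousOn q (halfBox s₀ ρ δ)) (hqd : DifferentiableOn ℂ q (openHalfBox s₀ ρ δ))
    (hB0 : 0 ≤ B) (hB : ∀ ζ ∈ halfBox s₀ ρ δ, ‖H ζ‖ ≤ B)
    (hp : ∀ ζ ∈ halfBox s₀ ρ δ, ‖p ζ‖ ≤ D) (hq : ∀ ζ ∈ halfBox s₀ ρ δ, ‖q ζ‖ ≤ D)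
    (hε : ‖ε‖ ≤ 1) (hκ : 0 < κ) (hκ2 : 2 * (‖k‖ * (ρ + δ) ^ 2 * D ^ 2) ≤ κ ^ 2)
    (hWc : Continuous fun p : ℝ × ℝ => W p.1 p.2)
    (hW : ∀ t t' : ℝ, W t t' = H t + ε * (H t' - H s₀) + ∫ τ in s₀..t',
      (ε * (∫ σ in s₀..τ, k * p τ * q σ * W τ σ) + ∫ σ in τ..t, k * p σ * q τ * W σ τ)) :
    ∃ Y : ℂ → ℂ, ContinuousOn Y (halfBox s₀ ρ δ) ∧ DifferentiableOn ℂ Y (openHalfBox s₀ ρ δ) ∧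
      (∀ ζ ∈ halfBox s₀ ρ δ, ‖Y ζ‖ ≤ 5 * B * Real.exp (2 * κ)) ∧
      ∀ t : ℝ, (t : ℂ) ∈ halfBox s₀ ρ δ → Y t = H t - H s₀ +
        ∫ τ in s₀..t, ∫ σ in s₀..τ, k * p τ * q σ * W τ σ := by
  have hcont : Continuous fun x : halfBox s₀ ρ δ × ℝ × ℝ => ((x.1:ℂ) - s₀) ^ 2 *
      (k * p (clampSeg s₀ x.1 x.2.1) * q (clampSeg s₀ x.1 x.2.2)) := by
    have h1 : Continuous fun x : halfBox s₀ ρ δ × ℝ × ℝ => p (clampSeg s₀ x.1 x.2.1) :=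
      (continuous_comp_clampSeg hpc).comp
        (by fun_prop : Continuous fun x : halfBox s₀ ρ δ × ℝ × ℝ => (x.1, x.2.1))
    have h2 : Continuous fun x : halfBox s₀ ρ δ × ℝ × ℝ => q (clampSeg s₀ x.1 x.2.2) :=
      (continuous_comp_clampSeg hqc).comp
        (by fun_prop : Continuous fun x : halfBox s₀ ρ δ × ℝ × ℝ => (x.1, x.2.2))
    exact (by fun_prop : Continuous fun x : halfBox s₀ ρ δ × ℝ × ℝ => ((x.1:ℂ) - s₀) ^ 2).mul
      ((continuous_const.mul h1).mul h2)
  have hdiff : ∀ t s, DifferentiableOn ℂ (fun ζ => (ζ - s₀) ^ 2 *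
      (k * p (clampSeg s₀ ζ t) * q (clampSeg s₀ ζ s))) (openHalfBox s₀ ρ δ) := by
    intro t s
    have h1 := differentiableOn_comp_clampSeg hpd t
    have h2 := differentiableOn_comp_clampSeg hqd s
    exact ((differentiableOn_id.sub_const _).pow 2).mul ((h1.const_mul k).mul h2)
  have hbdd : ∀ ζ ∈ halfBox s₀ ρ δ, ∀ t s, ‖(ζ - s₀) ^ 2 *
      (k * p (clampSeg s₀ ζ t) * q (clampSeg s₀ ζ s))‖ ≤ ‖k‖ * (ρ + δ) ^ 2 * D ^ 2 := by
    intro ζ hζ t s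
    have h1 := hp _ (clampSeg_mem hζ t)
    have h2 := hq _ (clampSeg_mem hζ s)
    have h3 : ‖ζ - s₀‖ ≤ ρ + δ := by
      refine (Complex.norm_le_abs_re_add_abs_im _).trans ?_
      have e1 : (ζ - s₀).re = ζ.re - s₀ := by simp
      have e2 : (ζ - s₀).im = ζ.im := by simp
      rw [e1, e2, abs_of_nonneg hζ.2.1]
      linarith [hζ.1, hζ.2.2]
    have h4 : ‖p (clampSeg s₀ ζ t)‖ * ‖q (clampSeg s₀ ζ s)‖ ≤ D ^ 2 := by
      rw [pow_two]
      exact mul_le_mul h1 h2 (norm_nonneg _) ((norm_nonneg _).trans h1)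
    have h5 : ‖ζ - s₀‖ ^ 2 ≤ (ρ + δ) ^ 2 := pow_le_pow_left₀ (norm_nonneg _) h3 2
    rw [norm_mul, norm_mul, norm_mul, norm_pow]
    calc _ = ‖k‖ * (‖ζ - s₀‖ ^ 2 * (‖p (clampSeg s₀ ζ t)‖ * ‖q (clampSeg s₀ ζ s)‖)) := by ring
      _ ≤ ‖k‖ * ((ρ + δ) ^ 2 * D ^ 2) := by gcongr
      _ = _ := by ring
  obtain ⟨Y, hYc, hYd, hYb, hY⟩ := exists_volterra_trace (ε := ε) (B := B)
    (M := ‖k‖ * (ρ + δ) ^ 2 * D ^ 2) (κ := κ)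
    (h := fun ζ t => H (clampSeg s₀ ζ t))
    (c := fun ζ t s => (ζ - s₀) ^ 2 * (k * p (clampSeg s₀ ζ t) * q (clampSeg s₀ ζ s)))
    (isOpen_openHalfBox s₀ ρ δ) (openHalfBox_subset s₀ ρ δ) (continuous_comp_clampSeg hHc)
    (differentiableOn_comp_clampSeg hHd) hcont hdiff hε hB0
    (fun ζ hζ t => hB _ (clampSeg_mem hζ t)) hbdd hκ hκ2
  refine ⟨Y, hYc, hYd, hYb, fun t ht => ?_⟩
  have hcl : ∀ u ∈ Icc (0:ℝ) 1, clampSeg s₀ t u = ((s₀ + (t - s₀) * u : ℝ) : ℂ) := fun u hu => by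
    rw [clampSeg_of_mem _ hu]; push_cast; ring
  have hcc : ∀ u ∈ Icc (0:ℝ) 1, ∀ r ∈ Icc (0:ℝ) 1, ((t:ℂ) - s₀) ^ 2 *
      (k * p (clampSeg s₀ t u) * q (clampSeg s₀ t r)) = ((t - s₀ : ℝ) : ℂ) ^ 2 *
      (fun a b : ℝ => k * p a * q b) (s₀ + (t - s₀) * u) (s₀ + (t - s₀) * r) :=
    fun u hu r hr => by
      simp only [hcl u hu, hcl r hr, Complex.ofReal_sub]
  have key := hY t ht (fun u r => W (s₀ + (t - s₀) * u) (s₀ + (t - s₀) * r))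
    (hWc.comp (by fun_prop : Continuous fun p : ℝ × ℝ =>
      (s₀ + (t - s₀) * p.1, s₀ + (t - s₀) * p.2))) fun u r h0 h1 h2 => ?_
  · rw [key, volterraTrace_congr hcc,
      volterraTrace_rescale (fun a b : ℝ => k * p a * q b) W,
      hcl 1 (by simp), hcl 0 (by simp)]
    simp
  · rw [volterra_congr hcc _ h0 h1 h2, volterra_rescale ε (fun a b : ℝ => k * p a * q b) W, hW,
      volterraSource,
      hcl u ⟨h0.trans h1, h2⟩, hcl r ⟨h0, h1.trans h2⟩, hcl 0 (by simp),
      mul_zero, add_zero]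

theorem norm_besselSeries_curveArg_le {lam d : ℝ} (hlam : 0 ≤ lam) {γ : ℝ → ℂ}
    (hd : ∀ t s, ‖γ t - γ s‖ ≤ d) (m : ℕ) (t t' s : ℝ) :
    ‖besselSeries m (curveArg (lam ^ 2 / 4) γ t t' s)‖ ≤ Real.exp (lam * d) := by
  have hd0 : 0 ≤ d := (norm_nonneg _).trans (hd t s)
  refine (norm_besselSeries_le _ _).trans (Real.exp_le_exp.2 ?_)
  have h1 : ‖curveArg (lam ^ 2 / 4) γ t t' s‖ ≤ (lam * d / 2) ^ 2 := by
    rw [curveArg, riemannArg, ← map_sub, norm_mul, norm_mul, RCLike.norm_conj, Complex.norm_real,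
      Real.norm_of_nonneg (by positivity)]
    have h2 := mul_le_mul (hd t s) (hd t' s) (norm_nonneg _) hd0
    nlinarith [sq_nonneg lam]
  have h2 : √‖curveArg (lam ^ 2 / 4) γ t t' s‖ ≤ lam * d / 2 :=
    (Real.sqrt_le_sqrt h1).trans_eq (Real.sqrt_sq (by positivity))
  linarith

theorem sq_div_four_le_exp {x : ℝ} (hx : 0 ≤ x) : x ^ 2 / 4 ≤ Real.exp x := by
  nlinarith [Real.quadratic_le_exp_of_nonneg hx, sq_nonneg x]

/-- The bound for the boundary kernel with vanishing Dirichlet data. -/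
theorem norm_curveKernel_le_of_dirichlet {lam d L A : ℝ} (hlam : 0 ≤ lam) {γ γ' a η : ℝ → ℂ}
    (hd : ∀ t s, ‖γ t - γ s‖ ≤ d) (ha : ∀ t, a t = 0) (hA : ∀ t, ‖η t‖ ≤ A) {t t' : ℝ}
    (ht : |t - t'| ≤ L) :
    ‖curveKernel (lam ^ 2 / 4) γ γ' a η t t'‖ ≤ L * Real.exp (lam * d) * A := by
  have h0 : 0 ≤ A := (norm_nonneg _).trans (hA t)
  simp only [curveKernel, ha, zero_mul, add_zero, zero_add]
  refine (intervalIntegral.norm_integral_le_of_norm_le_const (C := Real.exp (lam * d) * A)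
    fun s _ => ?_).trans ?_
  · rw [norm_mul]
    exact mul_le_mul (norm_besselSeries_curveArg_le hlam hd _ _ _ _) (hA s) (norm_nonneg _)
      (Real.exp_pos _).le
  · rw [mul_comm, mul_assoc]
    gcongr

/-- The bound for the boundary kernel with vanishing Neumann data. -/
theorem norm_curveKernel_le_of_neumann {lam d D L A : ℝ} (hlam : 0 ≤ lam) {γ γ' a η : ℝ → ℂ}
    (hγ : ∀ t, HasDerivAt γ (γ' t) t) (hγ' : Continuous γ') (hη : Continuous η)
    (hd : ∀ t s, ‖γ t - γ s‖ ≤ d) (hD : ∀ t, ‖γ' t‖ ≤ D)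
    (ha : ∀ t, HasDerivAt a (2 * η t) t) (hA : ∀ t, ‖a t‖ ≤ A) {t t' : ℝ} (ht : |t - t'| ≤ L) :
    ‖curveKernel (lam ^ 2 / 4) γ γ' a η t t'‖ ≤
      (1 + 2 * L * d * D * Real.exp (lam * (d + 1))) * A := by
  have h0 : 0 ≤ A := (norm_nonneg _).trans (hA t)
  have hd0 : 0 ≤ d := (norm_nonneg _).trans (hd t t)
  have hD0 : 0 ≤ D := (norm_nonneg _).trans (hD t)
  have hγc : Continuous γ := continuous_iff_continuousAt.2 fun t => (hγ t).continuousAt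
  have hac : Continuous a := continuous_iff_continuousAt.2 fun t => (ha t).continuousAt
  set μ : ℝ := lam ^ 2 / 4 with hμ
  have hμ0 : 0 ≤ μ := by positivity
  have hArg : Continuous fun s => curveArg μ γ t t' s :=
    (continuous_curveArg hγc).comp (by fun_prop : Continuous fun s : ℝ => (t, t', s))
  have hc1 := continuous_conj_comp hγc
  have hc2 := continuous_conj_comp hγ'
  let arg' : ℝ → ℂ := fun s => -(μ * (γ' s * ((starRingEnd ℂ) (γ t') - (starRingEnd ℂ) (γ s)) +
    (γ t - γ s) * (starRingEnd ℂ) (γ' s)))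
  have harg'c : Continuous arg' := by fun_prop
  have harg' : ∀ s, HasDerivAt (fun s => curveArg μ γ t t' s) (arg' s) s := fun s => by
    simp only [curveArg, riemannArg]
    refine ((((hγ s).const_sub (γ t)).mul ((hasDerivAt_conj (hγ s)).const_sub
      ((starRingEnd ℂ) (γ t')))).const_mul (μ : ℂ)).congr_deriv ?_
    simp only [arg']
    ring
  have hprim : ∀ s, HasDerivAt (fun s => besselSeries 0 (curveArg μ γ t t' s) * (a s / 2))
      (besselSeries 0 (curveArg μ γ t t' s) * η s -
        besselSeries 1 (curveArg μ γ t t' s) * arg' s * (a s / 2)) s := fun s => by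
    refine ((hasDerivAt_besselSeries_comp 0 (harg' s)).mul ((ha s).div_const 2)).congr_deriv ?_
    ring
  have hFTC := intervalIntegral.integral_eq_sub_of_hasDerivAt (a := t') (b := t)
    (fun s _ => hprim s) (Continuous.intervalIntegrable (by fun_prop) _ _)
  have e1 : curveArg μ γ t t' t = 0 := by simp [curveArg, riemannArg]
  have e2 : curveArg μ γ t t' t' = 0 := by simp [curveArg, riemannArg]
  rw [e1, e2, besselSeries_zero] at hFTC
  have key : curveKernel μ γ γ' a η t t' = (a t + a t') / 2 + ∫ s in t'..t,
      a s * besselSeries 1 (curveArg μ γ t t' s) *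
        (arg' s / 2 + μ * (γ t - γ s) * (starRingEnd ℂ) (γ' s)) := by
    have : ∀ s, besselSeries 0 (curveArg μ γ t t' s) * η s +
        a s * (μ * (γ t - γ s) * besselSeries 1 (curveArg μ γ t t' s)) * (starRingEnd ℂ) (γ' s) =
        (besselSeries 0 (curveArg μ γ t t' s) * η s -
        besselSeries 1 (curveArg μ γ t t' s) * arg' s * (a s / 2)) +
        a s * besselSeries 1 (curveArg μ γ t t' s) *
        (arg' s / 2 + μ * (γ t - γ s) * (starRingEnd ℂ) (γ' s)) := fun s => by ring
    rw [curveKernel]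
    simp only [this]
    rw [intervalIntegral.integral_add (Continuous.intervalIntegrable (by fun_prop) _ _)
      (Continuous.intervalIntegrable (by fun_prop) _ _), hFTC]
    norm_num
    ring
  rw [key]
  have hb1 : ∀ s, ‖arg' s / 2 + μ * (γ t - γ s) * (starRingEnd ℂ) (γ' s)‖ ≤ 2 * μ * d * D := by
    intro s
    have h1 : ‖γ' s * ((starRingEnd ℂ) (γ t') - (starRingEnd ℂ) (γ s))‖ ≤ D * d := by
      rw [← map_sub, norm_mul, RCLike.norm_conj]
      exact mul_le_mul (hD s) (hd _ _) (norm_nonneg _) hD0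
    have h2 : ‖(γ t - γ s) * (starRingEnd ℂ) (γ' s)‖ ≤ d * D := by
      rw [norm_mul, RCLike.norm_conj]
      exact mul_le_mul (hd _ _) (hD s) (norm_nonneg _) hd0
    have e : arg' s / 2 + μ * (γ t - γ s) * (starRingEnd ℂ) (γ' s) =
      (μ / 2 : ℝ) * ((γ t - γ s) * (starRingEnd ℂ) (γ' s) -
        γ' s * ((starRingEnd ℂ) (γ t') - (starRingEnd ℂ) (γ s))) := by
      simp only [arg']; push_cast; ring
    rw [e, norm_mul, Complex.norm_real, Real.norm_of_nonneg (by positivity)]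
    have h3 := (norm_sub_le ((γ t - γ s) * (starRingEnd ℂ) (γ' s))
        (γ' s * ((starRingEnd ℂ) (γ t') - (starRingEnd ℂ) (γ s)))).trans (add_le_add h2 h1)
    have h4 := mul_le_mul_of_nonneg_left h3 (show 0 ≤ μ / 2 by positivity)
    have h5 : 0 ≤ μ * d * D := by positivity
    linarith
  have hb2 := intervalIntegral.norm_integral_le_of_norm_le_const (a := t') (b := t)
    (C := A * Real.exp (lam * d) * (2 * μ * d * D))
    (f := fun s => a s * besselSeries 1 (curveArg μ γ t t' s) *
        (arg' s / 2 + μ * (γ t - γ s) * (starRingEnd ℂ) (γ' s))) fun s _ => by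
      rw [norm_mul, norm_mul]
      exact mul_le_mul (mul_le_mul (hA s) (norm_besselSeries_curveArg_le hlam hd _ _ _ _)
        (norm_nonneg _) h0) (hb1 s) (norm_nonneg _) (by positivity)
  have hb3 : ‖(a t + a t') / 2‖ ≤ A := by
    rw [norm_div, RCLike.norm_ofNat]
    linarith [norm_add_le (a t) (a t'), hA t, hA t']
  have hL0 : 0 ≤ L := (abs_nonneg _).trans ht
  have hexp : μ * Real.exp (lam * d) ≤ Real.exp (lam * (d + 1)) := by
    rw [mul_add, Real.exp_add, mul_one, mul_comm]
    exact mul_le_mul_of_nonneg_left (sq_div_four_le_exp hlam) (Real.exp_pos _).le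
  calc _ ≤ A + A * Real.exp (lam * d) * (2 * μ * d * D) * L :=
        (norm_add_le _ _).trans (add_le_add hb3 (hb2.trans (by gcongr)))
    _ = (1 + 2 * L * d * D * (μ * Real.exp (lam * d))) * A := by ring
    _ ≤ _ := by gcongr

theorem continuous_intervalIntegral_fst {F : ℝ → ℝ → ℂ} (hF : Continuous fun p : ℝ × ℝ => F p.1 p.2)
    (s₀ : ℝ) : Continuous fun τ => ∫ σ in s₀..τ, F τ σ :=
  (continuous_intervalIntegral_var (f := fun τ _ σ => F τ σ)
    (hF.comp (by fun_prop : Continuous fun p : ℝ × ℝ × ℝ => (p.1, p.2.2)))).comp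
    (by fun_prop : Continuous fun τ : ℝ => (τ, s₀))

theorem continuous_intervalIntegral_snd {F : ℝ → ℝ → ℂ} (hF : Continuous fun p : ℝ × ℝ => F p.1 p.2)
    (t : ℝ) : Continuous fun τ => ∫ σ in τ..t, F σ τ :=
  (continuous_intervalIntegral_var (f := fun _ τ σ => F σ τ)
    (hF.comp (by fun_prop : Continuous fun p : ℝ × ℝ × ℝ => (p.2.2, p.2.1)))).comp
    (by fun_prop : Continuous fun τ : ℝ => (t, τ))

/-- The Neumann (`ε = 1`) or Dirichlet (`ε = -1`) boundary condition for boundary values `a` and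
tangential derivative form `η`, together with a bound `A` of the remaining Cauchy datum. -/
def BoundaryCondition (ε : ℂ) (a η : ℝ → ℂ) (A : ℝ) : Prop :=
  (ε = 1 ∧ (∀ t, (starRingEnd ℂ) (η t) = η t) ∧ ∀ t, ‖a t‖ ≤ A) ∨
    (ε = -1 ∧ (∀ t, (starRingEnd ℂ) (η t) = -η t) ∧ (∀ t, a t = 0) ∧ ∀ t, ‖η t‖ ≤ A)

theorem BoundaryCondition.nonneg {ε : ℂ} {a η : ℝ → ℂ} {A : ℝ} (h : BoundaryCondition ε a η A) :
    0 ≤ A := by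
  rcases h with ⟨-, -, h⟩ | ⟨-, -, -, h⟩ <;> exact (norm_nonneg _).trans (h 0)

theorem BoundaryCondition.conj_eq {ε : ℂ} {a η : ℝ → ℂ} {A : ℝ} (h : BoundaryCondition ε a η A)
    (t : ℝ) : (starRingEnd ℂ) (η t) = ε * η t := by
  rcases h with ⟨rfl, h, -⟩ | ⟨rfl, h, -⟩ <;> simp [h]

theorem BoundaryCondition.norm_eq {ε : ℂ} {a η : ℝ → ℂ} {A : ℝ} (h : BoundaryCondition ε a η A) :
    ‖ε‖ = 1 := by
  rcases h with ⟨rfl, -⟩ | ⟨rfl, -⟩ <;> simp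

theorem norm_curveKernel_le {ε : ℂ} {lam d D L A : ℝ} (hlam : 0 ≤ lam) {γ γ' a η : ℝ → ℂ}
    (hγ : ∀ t, HasDerivAt γ (γ' t) t) (hγ' : Continuous γ') (hη : Continuous η)
    (hd : ∀ t s, ‖γ t - γ s‖ ≤ d) (hD : ∀ t, ‖γ' t‖ ≤ D)
    (ha : ∀ t, HasDerivAt a (η t + (starRingEnd ℂ) (η t)) t) (hb : BoundaryCondition ε a η A)
    {t t' : ℝ} (ht : |t - t'| ≤ L) :
    ‖curveKernel (lam ^ 2 / 4) γ γ' a η t t'‖ ≤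
      (1 + L + 2 * L * d * D) * Real.exp (lam * (d + 1)) * A := by
  have hA := hb.nonneg
  have hd0 : 0 ≤ d := (norm_nonneg _).trans (hd t t)
  have hD0 : 0 ≤ D := (norm_nonneg _).trans (hD t)
  have hL0 : 0 ≤ L := (abs_nonneg _).trans ht
  have h1 : 1 ≤ Real.exp (lam * (d + 1)) := Real.one_le_exp (by positivity)
  have h2 : Real.exp (lam * d) ≤ Real.exp (lam * (d + 1)) := Real.exp_le_exp.2 (by nlinarith)
  rcases hb with ⟨-, hη', hA'⟩ | ⟨-, -, ha0, hA'⟩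
  · refine (norm_curveKernel_le_of_neumann hlam hγ hγ' hη hd hD (fun t => ?_) hA' ht).trans ?_
    · have := ha t
      rwa [hη', ← two_mul] at this
    · refine mul_le_mul_of_nonneg_right ?_ hA
      generalize Real.exp (lam * (d + 1)) = E at h1
      nlinarith [mul_nonneg hL0 (by linarith : 0 ≤ E)]
  · refine (norm_curveKernel_le_of_dirichlet hlam hd ha0 hA' ht).trans ?_
    refine mul_le_mul_of_nonneg_right ?_ hA
    have h3 : 0 ≤ L * d * D := by positivity
    exact mul_le_mul (by nlinarith) h2 (Real.exp_pos _).le (by positivity)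

namespace HelmholtzPair

variable {Ω : Set ℂ} {Γ : ℂ → ℂ} {L δ μ : ℝ} {v : ℂ → ℝ} {g : ℂ → ℂ}

theorem continuous_deriv_collar (hC : Collar Ω Γ L δ) : Continuous fun t : ℝ => deriv Γ t := by
  have h := (hC.diff.deriv (isOpen_strip δ)).continuousOn
  exact h.comp_continuous Complex.continuous_ofReal fun t => upStrip_subset δ (hC.real_mem t)

theorem hasDerivAt_collar (hC : Collar Ω Γ L δ) (t : ℝ) :
    HasDerivAt (fun t : ℝ => Γ t) (deriv Γ t) t :=
  (hC.hasDerivAt (upStrip_subset δ (hC.real_mem t))).comp_ofReal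

theorem hasDerivAt_trace (h : HelmholtzPair Ω μ v g) (hC : Collar Ω Γ L δ) (t : ℝ) :
    HasDerivAt (fun t : ℝ => (v (Γ t) : ℂ))
      (g (Γ t) * deriv Γ t + (starRingEnd ℂ) (g (Γ t) * deriv Γ t)) t := by
  refine ((h.hasFDerivAt_v (Γ t)).comp_hasDerivAt t (hasDerivAt_collar hC t)).congr_deriv ?_
  simp [wirt_apply]

theorem continuous_collar (hC : Collar Ω Γ L δ) : Continuous fun t : ℝ => Γ t :=
  continuous_iff_continuousAt.2 fun t => (hasDerivAt_collar hC t).continuousAt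

theorem continuous_normal (h : HelmholtzPair Ω μ v g) (hC : Collar Ω Γ L δ) :
    Continuous fun t : ℝ => g (Γ t) * deriv Γ t :=
  (h.contDiff_g.continuous.comp (continuous_collar hC)).mul (continuous_deriv_collar hC)

theorem integral_helmForm_eq (t s : ℝ) :
    v (Γ s) + ∫ σ in s..t, helmForm μ v g (Γ t) ((starRingEnd ℂ) (Γ s)) (Γ σ) (deriv Γ σ) =
      curveKernel μ (fun t : ℝ => Γ t) (fun t : ℝ => deriv Γ t) (fun t : ℝ => (v (Γ t) : ℂ))
        (fun t : ℝ => g (Γ t) * deriv Γ t) t s := by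
  simp only [curveKernel, helmForm, wirt_apply, riemannFun, riemannFunBar, curveArg]
  congr 1
  congr 1
  funext σ
  ring

/-- A solution with vanishing Cauchy data vanishes. -/
theorem eq_zero_of_trace (h : HelmholtzPair Ω μ v g) (hC : Collar Ω Γ L δ)
    (h0 : ∀ t : ℝ, v (Γ t) = 0) (h1 : ∀ t : ℝ, g (Γ t) = 0) : ∀ x ∈ closure Ω, v x = 0 := by
  obtain ⟨V, hV, hVb, hVs, hVd⟩ := h.exists_kernel hC
  have hb : ∀ t s : ℝ, V (Γ t) (Γ s) = 0 := fun t s => by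
    rw [hVb, integral_helmForm_eq]
    simp [curveKernel, h0, h1]
  have hmax : ∀ q ∈ closure Ω, (∀ t : ℝ, V (Γ t) q = 0) → ∀ x ∈ closure Ω, V x q = 0 := by
    intro q hq hz x hx
    have := Complex.norm_le_of_forall_mem_frontier_norm_le hC.bdd (f := fun Z => V Z q)
      ⟨(hV q hq).1, (hV q hq).2⟩ (C := 0) (fun z hz' => ?_) hx
    · simpa using this
    · rw [hC.front] at hz'
      obtain ⟨w, hw, rfl⟩ := hz'
      have : w = (w.re : ℂ) := by apply Complex.ext <;> simp_all
      rw [this, hz, norm_zero]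
  intro x hx
  have hc := hmax x hx (fun t => by
    have ht := hC.mem_closure (hC.real_mem t)
    rw [← hVs (Γ t) ht x hx, hmax (Γ t) ht (fun s => hb s t) x hx, map_zero]) x hx
  rw [hVd] at hc
  exact_mod_cast hc

theorem halfBox_subset (s₀ ρ δ : ℝ) : halfBox s₀ ρ δ ⊆ upStrip δ := fun _ h => h.2

theorem openHalfBox_subset_int (s₀ ρ δ : ℝ) : openHalfBox s₀ ρ δ ⊆ upStripInt δ := fun _ h => h.2

theorem conj_mem_strip {z : ℂ} (hz : z ∈ strip δ) : (starRingEnd ℂ) z ∈ strip δ := by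
  simpa [strip] using hz

set_option maxHeartbeats 400000 in
/-- The primitive of the unknown Cauchy datum extends holomorphically to the collar, with a bound
exponential in the frequency. -/
theorem exists_primitive_extension (hC : Collar Ω Γ L δ) {ρ : ℝ} (hρ : 0 < ρ) :
    ∃ K > 0, ∀ lam > 0, ∀ (v : ℂ → ℝ) (g : ℂ → ℂ), HelmholtzPair Ω (lam ^ 2 / 4) v g →
      ∀ (ε : ℂ) (A : ℝ), BoundaryCondition ε (fun t : ℝ => (v (Γ t) : ℂ))
        (fun t : ℝ => g (Γ t) * deriv Γ t) A → ∀ s₀ : ℝ, ∃ Y : ℂ → ℂ,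
        ContinuousOn Y (halfBox s₀ ρ δ) ∧ DifferentiableOn ℂ Y (openHalfBox s₀ ρ δ) ∧
        (∀ ζ ∈ halfBox s₀ ρ δ, ‖Y ζ‖ ≤ K * Real.exp (K * lam) * A) ∧
        ∀ t : ℝ, |t - s₀| < ρ → Y t = ∫ s in s₀..t, g (Γ s) * deriv Γ s := by
  obtain ⟨D₀, hD₀⟩ := hC.deriv_bdd
  obtain ⟨d, hd⟩ := Metric.isBounded_iff.1 hC.isCompact_closure.isBounded
  set D := max D₀ 1 with hDdef
  have hD : ∀ z ∈ strip δ, ‖deriv Γ z‖ ≤ D := fun z hz => (hD₀ z hz).trans (le_max_left _ _)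
  have hD0 : 0 < D := lt_max_of_lt_right one_pos
  have hdγ : ∀ t s : ℝ, ‖Γ t - Γ s‖ ≤ d := fun t s => by
    rw [← dist_eq_norm]
    exact hd (hC.mem_closure (hC.real_mem t)) (hC.mem_closure (hC.real_mem s))
  have hd0 : 0 ≤ d := (norm_nonneg _).trans (hdγ 0 0)
  have hL := hC.L_pos
  have hδ := hC.δ_pos
  set κ₀ := (ρ + δ) * D with hκ₀
  have hκ₀p : 0 < κ₀ := by positivity
  set M := 1 + L + 2 * L * d * D with hM
  have hMp : 0 < M := by positivity
  refine ⟨5 * M * Real.exp (2 * κ₀) + (d + 1 + 2 * κ₀), by positivity, ?_⟩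
  intro lam hlam v g h ε A hb s₀
  have hA := hb.nonneg
  obtain ⟨V, hV, hVb, hVs, hVd⟩ := h.exists_kernel hC
  set μ := lam ^ 2 / 4 with hμ
  set B := M * Real.exp (lam * (d + 1)) * A with hB
  have hγ := hasDerivAt_collar hC
  have hγ' := continuous_deriv_collar hC
  have hη := h.continuous_normal hC
  have ha : Continuous (fun t : ℝ => (v (Γ t) : ℂ)) :=
    continuous_iff_continuousAt.2 fun t => (h.hasDerivAt_trace hC t).continuousAt
  have hmem : ∀ t : ℝ, (t : ℂ) ∈ strip δ := fun t => upStrip_subset δ (hC.real_mem t)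
  have hs₀ := hC.mem_closure (hC.real_mem s₀)
  have hVB : ∀ x ∈ closure Ω, ‖V x (Γ s₀)‖ ≤ B := fun x hx => by
    refine Complex.norm_le_of_forall_mem_frontier_norm_le hC.bdd (f := fun Z => V Z (Γ s₀))
      ⟨(hV _ hs₀).1, (hV _ hs₀).2⟩ (fun z hz => ?_) hx
    rw [hC.front] at hz
    obtain ⟨w, hw, rfl⟩ := hz
    obtain ⟨k, hk, hk'⟩ := hC.exists_re_mem w s₀
    have hws : w ∈ strip δ := by
      simp only [strip, mem_ofPred_eq]
      rw [show w.im = 0 from hw, abs_zero]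
      exact hδ
    rw [← hC.per_int hws k]
    have e : w + k * L = ((w + k * L).re : ℂ) := by
      apply Complex.ext
      · simp
      · rw [hk', Complex.ofReal_im]; exact hw
    rw [e, hVb, integral_helmForm_eq]
    refine norm_curveKernel_le hlam.le hγ hγ' hη hdγ (fun t => hD _ (hmem t))
      (h.hasDerivAt_trace hC) hb ?_
    rw [abs_le]
    constructor <;> linarith [hk.1, hk.2]
  have hVk : ∀ t s : ℝ, V (Γ t) (Γ s) = curveKernel μ (fun t : ℝ => Γ t) (fun t : ℝ => deriv Γ t)
      (fun t : ℝ => (v (Γ t) : ℂ)) (fun t : ℝ => g (Γ t) * deriv Γ t) t s := fun t s => by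
    rw [hVb, integral_helmForm_eq]
  have hWc : Continuous fun p : ℝ × ℝ => V (Γ p.1) (Γ p.2) := by
    simp only [hVk]
    exact continuous_curveKernel (continuous_collar hC) hγ' ha hη
  have hcc : Continuous fun p : ℝ × ℝ => -(μ * deriv Γ p.1 * (starRingEnd ℂ) (deriv Γ p.2)) := by
    exact ((continuous_const.mul (hγ'.comp continuous_fst)).mul
      ((continuous_conj_comp hγ').comp continuous_snd)).neg
  obtain ⟨I1, I2⟩ := kernel_integral_identities (W := fun t s : ℝ => V (Γ t) (Γ s))
    (c := fun t s : ℝ => -(μ * deriv Γ t * (starRingEnd ℂ) (deriv Γ s)))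
    hWc (continuous_curveKernelDeriv (μ := μ) (continuous_collar hC) hγ' ha hη) hcc hη
    (fun t t' => by simp only [hVk]; exact hasDerivAt_curveKernel hγ hγ' ha hη t t')
    (fun t t' => by simp only [hVk]; exact hasDerivAt_curveKernelDeriv hγ hγ' ha hη t t')
    (fun t => curveKernelDeriv_self t)
    (fun t t' => hVs _ (hC.mem_closure (hC.real_mem t')) _ (hC.mem_closure (hC.real_mem t)))
    (fun t t' => by simp; ring) s₀
  have hηε : ∀ t : ℝ, (starRingEnd ℂ) (∫ s in s₀..t, g (Γ s) * deriv Γ s) =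
      ε * ∫ s in s₀..t, g (Γ s) * deriv Γ s := fun t => by
    rw [← intervalIntegral.integral_const_mul]
    refine ((Complex.conjCLE : ℂ →L[ℝ] ℂ).intervalIntegral_comp_comm
      (hη.intervalIntegrable _ _)).symm.trans ?_
    exact intervalIntegral.integral_congr fun s _ => hb.conj_eq s
  have hpd : DifferentiableOn ℂ (deriv Γ) (strip δ) := hC.diff.deriv (isOpen_strip δ)
  have hqd : DifferentiableOn ℂ (fun z => (starRingEnd ℂ) (deriv Γ ((starRingEnd ℂ) z)))
      (strip δ) := fun z hz => by
    refine DifferentiableAt.differentiableWithinAt ?_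
    have := (hpd.differentiableAt ((isOpen_strip δ).mem_nhds (conj_mem_strip hz)))
    exact differentiableAt_conj_conj_iff.2 this
  have hb1 := (halfBox_subset s₀ ρ δ).trans (upStrip_subset δ)
  have hb2 := ((openHalfBox_subset_int s₀ ρ δ).trans (upStripInt_subset δ)).trans (upStrip_subset δ)
  have hk : ∀ τ σ : ℝ, -(μ : ℂ) * deriv Γ τ * (starRingEnd ℂ) (deriv Γ ((starRingEnd ℂ) (σ : ℂ))) =
      -(μ * deriv Γ τ * (starRingEnd ℂ) (deriv Γ σ)) := fun τ σ => by
    rw [Complex.conj_ofReal]; ring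
  have hcW : Continuous fun p : ℝ × ℝ =>
      -(μ * deriv Γ p.1 * (starRingEnd ℂ) (deriv Γ p.2)) * V (Γ p.1) (Γ p.2) := hcc.mul hWc
  have j1 : Continuous fun τ : ℝ => ∫ σ in s₀..τ,
      -(μ * deriv Γ τ * (starRingEnd ℂ) (deriv Γ σ)) * V (Γ τ) (Γ σ) :=
    continuous_intervalIntegral_fst (F := fun τ σ : ℝ =>
      -(μ * deriv Γ τ * (starRingEnd ℂ) (deriv Γ σ)) * V (Γ τ) (Γ σ)) hcW s₀
  have j2 : ∀ t : ℝ, Continuous fun τ : ℝ => ∫ σ in τ..t,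
      -(μ * deriv Γ σ * (starRingEnd ℂ) (deriv Γ τ)) * V (Γ σ) (Γ τ) := fun t =>
    continuous_intervalIntegral_snd (F := fun τ σ : ℝ =>
      -(μ * deriv Γ τ * (starRingEnd ℂ) (deriv Γ σ)) * V (Γ τ) (Γ σ)) hcW t
  obtain ⟨Y, hYc, hYd, hYb, hY⟩ := exists_boundary_primitive (s₀ := s₀) (ρ := ρ) (δ := δ)
    (B := B) (D := D) (κ := κ₀ * (1 + lam)) (ε := ε) (k := -μ) (H := fun ζ => V (Γ ζ) (Γ s₀))
    (p := deriv Γ) (q := fun z => (starRingEnd ℂ) (deriv Γ ((starRingEnd ℂ) z)))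
    (W := fun t s : ℝ => V (Γ t) (Γ s))
    ((hV _ hs₀).2.comp (hC.diff.continuousOn.mono hb1)
      fun z hz => hC.mem_closure (halfBox_subset s₀ ρ δ hz))
    ((hV _ hs₀).1.comp (hC.diff.mono hb2)
      fun z hz => hC.inside z (openHalfBox_subset_int s₀ ρ δ hz))
    (hpd.continuousOn.mono hb1) (hpd.mono hb2) (hqd.continuousOn.mono hb1) (hqd.mono hb2)
    (by positivity) (fun ζ hζ => hVB _ (hC.mem_closure (halfBox_subset s₀ ρ δ hζ)))
    (fun ζ hζ => hD _ (hb1 hζ))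
    (fun ζ hζ => by rw [RCLike.norm_conj]; exact hD _ (conj_mem_strip (hb1 hζ)))
    hb.norm_eq.le (by positivity)
    (by
      rw [norm_neg, Complex.norm_real, Real.norm_of_nonneg (by positivity), hκ₀, hμ]
      have : 0 ≤ ((ρ + δ) * D) ^ 2 := by positivity
      nlinarith [mul_nonneg this hlam.le, mul_nonneg this (sq_nonneg lam)])
    hWc
    (fun t t' => by
      simp only [hk]
      rw [intervalIntegral.integral_add ((j1.const_mul ε).intervalIntegrable _ _)
        ((j2 t).intervalIntegrable _ _), I2 t t', hηε, I1 t', intervalIntegral.integral_const_mul]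
      ring)
  refine ⟨Y, hYc, hYd, fun ζ hζ => (hYb ζ hζ).trans ?_, fun t ht => ?_⟩
  · have e : 5 * B * Real.exp (2 * (κ₀ * (1 + lam))) =
        5 * M * Real.exp (2 * κ₀) * Real.exp ((d + 1 + 2 * κ₀) * lam) * A := by
      have : Real.exp (lam * (d + 1)) * Real.exp (2 * (κ₀ * (1 + lam))) =
          Real.exp (2 * κ₀) * Real.exp ((d + 1 + 2 * κ₀) * lam) := by
        rw [← Real.exp_add, ← Real.exp_add]; ring_nf
      rw [hB]
      linear_combination 5 * M * A * this
    rw [e]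
    have hp : 0 < 5 * M * Real.exp (2 * κ₀) := by positivity
    have hq : 0 < d + 1 + 2 * κ₀ := by positivity
    refine mul_le_mul_of_nonneg_right ?_ hA
    refine mul_le_mul (by linarith) (Real.exp_le_exp.2 ?_) (Real.exp_pos _).le (by positivity)
    exact mul_le_mul_of_nonneg_right (by linarith) hlam.le
  · have ht' : (t : ℂ) ∈ halfBox s₀ ρ δ := by
      simp only [halfBox, mem_ofPred_eq, Complex.ofReal_re, Complex.ofReal_im]
      exact ⟨ht, le_rfl, hδ⟩
    rw [hY t ht', I1 t]
    simp only [hk]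
end HelmholtzPair

/-- A continuous function on an open set, holomorphic off the real axis, is holomorphic. -/
theorem differentiableOn_of_differentiableAt_off_real {G : ℂ → ℂ} {U : Set ℂ} (hU : IsOpen U)
    (hc : ContinuousOn G U) (hd : ∀ z ∈ U, z.im ≠ 0 → DifferentiableAt ℂ G z) :
    DifferentiableOn ℂ G U := by
  intro z hz
  obtain ⟨r, hr, hball⟩ := Metric.isOpen_iff.1 hU z hz
  have hcons : Complex.IsConservativeOn G (Metric.ball z r) := by
    intro z w hzw
    replace hzw := hzw.trans hball
    rw [← add_eq_zero_iff_eq_neg, Complex.wedgeIntegral_add_wedgeIntegral_eq]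
    obtain ⟨m, hm, hm1, hm2⟩ : ∃ m ∈ uIcc z.im w.im,
        (∀ y ∈ Ioo (min z.im m) (max z.im m), y ≠ 0) ∧
        ∀ y ∈ Ioo (min m w.im) (max m w.im), y ≠ 0 := by
      by_cases h0 : (0 : ℝ) ∈ (uIcc z.im w.im)
      · refine ⟨0, h0, ?_, ?_⟩
        · rintro y ⟨h1, h2⟩ rfl
          rcases le_total z.im 0 with h | h <;> simp [h] at h1 h2
        · rintro y ⟨h1, h2⟩ rfl
          rcases le_total w.im 0 with h | h <;> simp [h] at h1 h2
      · refine ⟨z.im, left_mem_uIcc, ?_, ?_⟩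
        · rintro y ⟨h1, h2⟩ rfl
          simp at h1 h2
          linarith
        · rintro y hy rfl
          exact h0 ⟨hy.1.le, hy.2.le⟩
    have hm' : (uIcc z.im m) ⊆ (uIcc z.im w.im) := uIcc_subset_uIcc_left hm
    have hm'' : (uIcc m w.im) ⊆ (uIcc z.im w.im) := uIcc_subset_uIcc_right hm
    have H1 := Complex.integral_boundary_rect_eq_zero_of_continuousOn_of_differentiableOn G
      z ⟨w.re, m⟩ (hc.mono fun x hx => hzw ⟨hx.1, hm' hx.2⟩)
      fun x hx => (hd x (hzw ⟨Ioo_subset_Icc_self hx.1, hm' (Ioo_subset_Icc_self hx.2)⟩)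
        (hm1 _ hx.2)).differentiableWithinAt
    have H2 := Complex.integral_boundary_rect_eq_zero_of_continuousOn_of_differentiableOn G
      ⟨z.re, m⟩ w (hc.mono fun x hx => hzw ⟨hx.1, hm'' hx.2⟩)
      fun x hx => (hd x (hzw ⟨Ioo_subset_Icc_self hx.1, hm'' (Ioo_subset_Icc_self hx.2)⟩)
        (hm2 _ hx.2)).differentiableWithinAt
    have hv : ∀ x ∈ (uIcc z.re w.re), (∫ y : ℝ in z.im..m, G (x + y * Complex.I)) +
        ∫ y : ℝ in m..w.im, G (x + y * Complex.I) = ∫ y : ℝ in z.im..w.im, G (x + y * Complex.I) := by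
      intro x hx
      have : ContinuousOn (fun y : ℝ => G (x + y * Complex.I)) (uIcc z.im w.im) :=
        hc.comp (by fun_prop) fun y hy => hzw ⟨by simpa using hx, by simpa using hy⟩
      exact intervalIntegral.integral_add_adjacent_intervals
        (this.mono hm').intervalIntegrable (this.mono hm'').intervalIntegrable
    have h1 := hv _ left_mem_uIcc
    have h2 := hv _ right_mem_uIcc
    simp only [smul_eq_mul] at H1 H2 ⊢
    rw [← h1, ← h2]
    linear_combination H1 + H2
  exact (((hcons.isExactOn_ball (hc.mono hball)).differentiableOn Metric.isOpen_ball) z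
    (Metric.mem_ball_self hr)).differentiableAt (Metric.ball_mem_nhds z hr)
    |>.differentiableWithinAt

/-- An open box symmetric about the real axis, centred at `s₀`. -/
def box (s₀ ρ δ : ℝ) : Set ℂ := {ζ | |ζ.re - s₀| < ρ ∧ |ζ.im| < δ}

theorem isOpen_box (s₀ ρ δ : ℝ) : IsOpen (box s₀ ρ δ) := by
  have h1 : IsOpen {ζ : ℂ | |ζ.re - s₀| < ρ} := isOpen_lt (by fun_prop) continuous_const
  have h2 : IsOpen {ζ : ℂ | |ζ.im| < δ} := isOpen_lt (by fun_prop) continuous_const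
  exact h1.inter h2

theorem mem_halfBox_of_mem_box {s₀ ρ δ : ℝ} {ζ : ℂ} (h : ζ ∈ box s₀ ρ δ) (h0 : 0 ≤ ζ.im) :
    ζ ∈ halfBox s₀ ρ δ := ⟨h.1, h0, (abs_lt.1 h.2).2⟩

theorem conj_mem_box {s₀ ρ δ : ℝ} {ζ : ℂ} (h : ζ ∈ box s₀ ρ δ) :
    (starRingEnd ℂ) ζ ∈ box s₀ ρ δ := by simpa [box] using h

open Classical in
/-- The Schwarz reflection principle. -/
theorem exists_reflection {s₀ ρ δ : ℝ} {F : ℂ → ℂ} (hc : ContinuousOn F (halfBox s₀ ρ δ))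
    (hd : DifferentiableOn ℂ F (openHalfBox s₀ ρ δ))
    (hr : ∀ t : ℝ, (t : ℂ) ∈ halfBox s₀ ρ δ → (starRingEnd ℂ) (F t) = F t) :
    ∃ G : ℂ → ℂ, DifferentiableOn ℂ G (box s₀ ρ δ) ∧ (∀ z ∈ halfBox s₀ ρ δ, G z = F z) ∧
      ∀ z ∈ box s₀ ρ δ, ∃ w ∈ halfBox s₀ ρ δ, ‖G z‖ = ‖F w‖ := by
  let F' : ℂ → ℂ := fun z => (starRingEnd ℂ) (F ((starRingEnd ℂ) z))
  let G : ℂ → ℂ := fun z => if 0 ≤ z.im then F z else F' z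
  have hGF : ∀ z, 0 ≤ z.im → G z = F z := fun z hz => if_pos hz
  have hGF' : ∀ z, z.im < 0 → G z = F' z := fun z hz => if_neg hz.not_ge
  refine ⟨G, differentiableOn_of_differentiableAt_off_real (isOpen_box _ _ _) ?_ ?_,
    fun z hz => hGF z hz.2.1, fun z hz => ?_⟩
  · refine ContinuousOn.if ?_ ?_ ?_
    · rintro z ⟨hz, hz'⟩
      have h0 : z.im = 0 := by simpa using hz'
      have hzr : z = (z.re : ℂ) := by apply Complex.ext <;> simp [h0]
      have := hr z.re (by rw [← hzr]; exact mem_halfBox_of_mem_box hz h0.ge)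
      simp only [F']
      rw [hzr, Complex.conj_ofReal, this]
    · refine hc.mono ?_
      rintro z ⟨hz, hz'⟩
      rw [(isClosed_le continuous_const Complex.continuous_im).closure_eq] at hz'
      exact mem_halfBox_of_mem_box hz hz'
    · refine Complex.continuous_conj.comp_continuousOn (hc.comp
        Complex.continuous_conj.continuousOn ?_)
      rintro z ⟨hz, hz'⟩
      simp only [not_le] at hz'
      rw [Complex.closure_setOfPred_im_lt] at hz'
      exact mem_halfBox_of_mem_box (conj_mem_box hz) (by simpa using hz')
  · intro z hz h0
    rcases lt_or_gt_of_ne h0 with h | h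
    · have hz' : (starRingEnd ℂ) z ∈ openHalfBox s₀ ρ δ :=
        ⟨by simpa using hz.1, by simpa using h, by
          have := (abs_lt.1 hz.2).1
          simp; linarith⟩
      have h1 : DifferentiableAt ℂ F' z := differentiableAt_conj_conj_iff.2
        (hd.differentiableAt ((isOpen_openHalfBox _ _ _).mem_nhds hz'))
      refine h1.congr_of_eventuallyEq ?_
      filter_upwards [(isOpen_lt Complex.continuous_im continuous_const).mem_nhds h] with y hy
      exact hGF' y hy
    · have hz' : z ∈ openHalfBox s₀ ρ δ := ⟨hz.1, h, (abs_lt.1 hz.2).2⟩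
      refine (hd.differentiableAt ((isOpen_openHalfBox _ _ _).mem_nhds hz')).congr_of_eventuallyEq ?_
      filter_upwards [(isOpen_lt continuous_const Complex.continuous_im).mem_nhds h] with y hy
      exact hGF y (le_of_lt hy)
  · rcases le_or_gt 0 z.im with h | h
    · exact ⟨z, mem_halfBox_of_mem_box hz h, by rw [hGF z h]⟩
    · refine ⟨(starRingEnd ℂ) z, mem_halfBox_of_mem_box (conj_mem_box hz) (by simpa using h.le), ?_⟩
      rw [hGF' z h]
      exact RCLike.norm_conj _

/-- Jensen's bound for the number of zeros, in terms of lower bounds of their orders. -/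
theorem sum_order_le_of_analyticOnNhd {f : ℂ → ℂ} {c : ℂ} {r R M : ℝ} (hr : 0 < r) (hrR : r < R)
    (hf : AnalyticOnNhd ℂ f (Metric.closedBall c R)) (h0 : f c ≠ 0)
    (hM : ∀ z ∈ Metric.closedBall c R, ‖f z‖ ≤ M) (T : Finset ℂ)
    (hT : ∀ u ∈ T, u ∈ Metric.closedBall c r) (k : ℂ → ℕ)
    (hk : ∀ u ∈ T, (k u : ℕ∞) ≤ analyticOrderAt f u) :
    ∑ u ∈ T, (k u : ℝ) ≤ Real.log (M / ‖f c‖) / Real.log (R / r) := by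
  have hR : 0 < R := hr.trans hrR
  have hc : c ∈ Metric.closedBall c R := Metric.mem_closedBall_self hR.le
  have hn : 0 < ‖f c‖ := norm_pos_iff.2 h0
  have hsub : Metric.closedBall c r ⊆ Metric.closedBall c R := Metric.closedBall_subset_closedBall hrR.le
  set F : ℂ → ℂ := fun z => (f c)⁻¹ * f z with hF
  have hFa : AnalyticOnNhd ℂ F (Metric.closedBall c R) := fun z hz => analyticAt_const.mul (hf z hz)
  have hFc : F c = 1 := inv_mul_cancel₀ h0
  have hord : ∀ u, u ∈ Metric.closedBall c R → analyticOrderAt F u = analyticOrderAt f u := by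
    intro u hu
    have h1 : analyticOrderAt (fun _ : ℂ => (f c)⁻¹) u = 0 :=
      analyticAt_const.analyticOrderAt_eq_zero.2 (inv_ne_zero h0)
    have := analyticOrderAt_mul (f := fun _ : ℂ => (f c)⁻¹) (g := f) analyticAt_const (hf u hu)
    rw [h1, zero_add] at this
    exact this
  have hJ := AnalyticOnNhd.sum_divisor_le (f := F) (c := c) (r := r) (R := R) (M := M / ‖f c‖)
    (by rwa [abs_of_pos hr]) (by rwa [abs_of_pos hr, abs_of_pos hR])
    (by rw [one_le_div hn]; exact hM c hc) (by rwa [abs_of_pos hR])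
    (by rw [hFc]; exact one_ne_zero) (fun z hz => by
      rw [abs_of_pos hR] at hz
      rw [hF, norm_mul, norm_inv, inv_mul_eq_div]
      exact div_le_div_of_nonneg_right (hM z (Metric.sphere_subset_closedBall hz)) hn.le)
  rw [hFc, norm_one, div_one, abs_of_pos hr] at hJ
  refine le_trans ?_ hJ
  set D := MeromorphicOn.divisor F (Metric.closedBall c r) with hD
  have hFr : AnalyticOnNhd ℂ F (Metric.closedBall c r) := hFa.mono hsub
  have hfin := D.finiteSupport (isCompact_closedBall c r)
  have hDn : ∀ u, 0 ≤ D u := fun u => MeromorphicOn.AnalyticOnNhd.divisor_nonneg hFr u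
  have htop : ∀ u ∈ Metric.closedBall c R, analyticOrderAt F u ≠ ⊤ := by
    intro u hu
    refine hFa.analyticOrderAt_ne_top_of_isPreconnected (convex_closedBall c R).isPreconnected
      hc hu ?_
    rw [(hFa c hc).analyticOrderAt_eq_zero.2 (by rw [hFc]; exact one_ne_zero)]
    exact ENat.zero_ne_top
  have hDk : ∀ u ∈ T, (k u : ℤ) ≤ D u := by
    intro u hu
    have huR := hsub (hT u hu)
    have h1 := hk u hu
    rw [← hord u huR] at h1
    rw [hD, MeromorphicOn.AnalyticOnNhd.divisor_apply hFr (hT u hu)]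
    lift analyticOrderAt F u to ℕ using htop u huR with n hn
    simpa using h1
  rw [finsum_eq_sum_of_support_subset (s := hfin.toFinset ∪ T) _ (fun x hx => by
    simp only [Finset.coe_union, Finite.coe_toFinset]; exact Or.inl hx)]
  have h2 : ∑ u ∈ T, (k u : ℤ) ≤ ∑ u ∈ hfin.toFinset ∪ T, D u :=
    (Finset.sum_le_sum hDk).trans (Finset.sum_le_sum_of_subset_of_nonneg
      Finset.subset_union_right fun u _ _ => hDn u)
  exact_mod_cast h2

/-- A conformal map from the unit disc onto the strip of half-width `c * π` around the real
axis, sending `0` to `s`. -/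
noncomputable def discToStrip (s c : ℝ) (ζ : ℂ) : ℂ :=
  s + c * (Complex.log (1 + ζ) - Complex.log (1 - ζ))

theorem re_lt_one_of_norm {ζ : ℂ} (h : ‖ζ‖ < 1) : 0 < (1 + ζ).re ∧ 0 < (1 - ζ).re := by
  have := abs_lt.1 ((Complex.abs_re_le_norm ζ).trans_lt h)
  simp only [Complex.add_re, Complex.sub_re, Complex.one_re]
  constructor <;> linarith [this.1, this.2]

theorem hasDerivAt_discToStrip (s c : ℝ) {ζ : ℂ} (h : ‖ζ‖ < 1) :
    HasDerivAt (discToStrip s c) (c * (1 / (1 + ζ) + 1 / (1 - ζ))) ζ := by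
  obtain ⟨h1, h2⟩ := re_lt_one_of_norm h
  have d1 := ((hasDerivAt_id ζ).const_add 1).clog (Or.inl h1)
  have d2 := ((hasDerivAt_id ζ).const_sub 1).clog (Or.inl h2)
  have := ((d1.sub d2).const_mul (c : ℂ)).const_add (s : ℂ)
  refine this.congr_deriv ?_
  simp only [id]
  ring

theorem analyticAt_discToStrip (s c : ℝ) {ζ : ℂ} (h : ‖ζ‖ < 1) :
    AnalyticAt ℂ (discToStrip s c) ζ := by
  obtain ⟨h1, h2⟩ := re_lt_one_of_norm h
  exact analyticAt_const.add (analyticAt_const.mul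
    (((analyticAt_const.add analyticAt_id).clog (Or.inl h1)).sub
      ((analyticAt_const.sub analyticAt_id).clog (Or.inl h2))))

theorem deriv_discToStrip_ne_zero (s : ℝ) {c : ℝ} (hc : 0 < c) {ζ : ℂ} (h : ‖ζ‖ < 1) :
    deriv (discToStrip s c) ζ ≠ 0 := by
  obtain ⟨h1, h2⟩ := re_lt_one_of_norm h
  have n1 : 1 + ζ ≠ 0 := fun h => by simp [h] at h1
  have n2 : 1 - ζ ≠ 0 := fun h => by simp [h] at h2
  rw [(hasDerivAt_discToStrip s c h).deriv]
  have : (1 / (1 + ζ) + 1 / (1 - ζ)) = 2 / ((1 + ζ) * (1 - ζ)) := by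
    field_simp
    ring
  rw [this]
  exact mul_ne_zero (by exact_mod_cast hc.ne') (div_ne_zero two_ne_zero (mul_ne_zero n1 n2))

theorem discToStrip_zero (s c : ℝ) : discToStrip s c 0 = s := by simp [discToStrip]

theorem abs_im_discToStrip_lt (s : ℝ) {c : ℝ} (hc : 0 < c) {ζ : ℂ} (h : ‖ζ‖ < 1) :
    |(discToStrip s c ζ).im| < c * Real.pi := by
  obtain ⟨h1, h2⟩ := re_lt_one_of_norm h
  have a1 := abs_lt.1 (Complex.abs_arg_lt_pi_div_two_iff.2 (Or.inl h1))
  have a2 := abs_lt.1 (Complex.abs_arg_lt_pi_div_two_iff.2 (Or.inl h2))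
  have : (discToStrip s c ζ).im = c * (Complex.arg (1 + ζ) - Complex.arg (1 - ζ)) := by
    simp [discToStrip, Complex.log_im]
  rw [this, abs_mul, abs_of_pos hc]
  refine mul_lt_mul_of_pos_left (abs_lt.2 ⟨?_, ?_⟩) hc <;> linarith [a1.1, a1.2, a2.1, a2.2]

theorem abs_re_discToStrip_sub_le (s : ℝ) {c R : ℝ} (hc : 0 < c) (hR : R < 1) {ζ : ℂ}
    (h : ‖ζ‖ ≤ R) : |(discToStrip s c ζ).re - s| ≤ c * (2 * Real.log (2 / (1 - R))) := by
  have hR0 : 0 ≤ R := (norm_nonneg ζ).trans h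
  have key : ∀ w : ℂ, ‖w‖ ≤ R → |Real.log ‖1 + w‖| ≤ Real.log (2 / (1 - R)) := by
    intro w hw
    have u : ‖1 + w‖ ≤ 2 := (norm_add_le _ _).trans (by rw [norm_one]; linarith)
    have l : 1 - R ≤ ‖1 + w‖ := by
      have := norm_sub_le (1 + w) w
      rw [add_sub_cancel_right, norm_one] at this
      linarith
    have p : 0 < 1 - R := by linarith
    have n : 0 < ‖1 + w‖ := p.trans_le l
    rw [Real.log_div two_ne_zero p.ne', abs_le]
    have e1 := Real.log_le_log p l
    have e2 := Real.log_le_log n u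
    have e3 : Real.log (1 - R) ≤ 0 := Real.log_nonpos p.le (by linarith)
    have e4 : 0 ≤ Real.log 2 := Real.log_nonneg (by norm_num)
    constructor <;> linarith
  have : (discToStrip s c ζ).re - s = c * (Real.log ‖1 + ζ‖ - Real.log ‖1 + -ζ‖) := by
    simp [discToStrip, Complex.log_re, sub_eq_add_neg]
  rw [this, abs_mul, abs_of_pos hc]
  refine mul_le_mul_of_nonneg_left ((abs_sub _ _).trans ?_) hc.le
  linarith [key ζ h, key (-ζ) (by rwa [norm_neg])]

/-- The point of the unit interval mapped to `t` by `discToStrip s c`. -/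
noncomputable def stripToDisc (s c t : ℝ) : ℝ :=
  (Real.exp ((t - s) / c) - 1) / (Real.exp ((t - s) / c) + 1)

theorem one_sub_stripToDisc (s c t : ℝ) :
    1 - stripToDisc s c t = 2 / (Real.exp ((t - s) / c) + 1) := by
  have := Real.exp_pos ((t - s) / c)
  rw [stripToDisc]
  field_simp
  ring

theorem one_add_stripToDisc (s c t : ℝ) :
    1 + stripToDisc s c t = Real.exp ((t - s) / c) * (2 / (Real.exp ((t - s) / c) + 1)) := by
  have := Real.exp_pos ((t - s) / c)
  rw [stripToDisc]
  field_simp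
  ring

theorem discToStrip_stripToDisc (s t : ℝ) {c : ℝ} (hc : 0 < c) :
    discToStrip s c (stripToDisc s c t) = t := by
  have e := Real.exp_pos ((t - s) / c)
  have p : 0 < 2 / (Real.exp ((t - s) / c) + 1) := by positivity
  have h1 : (1 : ℂ) + (stripToDisc s c t : ℂ) = ((1 + stripToDisc s c t : ℝ) : ℂ) := by push_cast; rfl
  have h2 : (1 : ℂ) - (stripToDisc s c t : ℂ) = ((1 - stripToDisc s c t : ℝ) : ℂ) := by push_cast; rfl
  rw [discToStrip, h1, h2, one_sub_stripToDisc, one_add_stripToDisc,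
    ← Complex.ofReal_log p.le, ← Complex.ofReal_log (mul_pos e p).le,
    Real.log_mul e.ne' p.ne', Real.log_exp, ← Complex.ofReal_sub, add_sub_cancel_right,
    ← Complex.ofReal_mul, mul_div_cancel₀ _ hc.ne', ← Complex.ofReal_add]
  congr 1
  ring

theorem stripToDisc_nonneg {s t c : ℝ} (hc : 0 < c) (h : s ≤ t) : 0 ≤ stripToDisc s c t := by
  have : 0 ≤ (t - s) / c := div_nonneg (by linarith) hc.le
  have := Real.one_le_exp this
  exact div_nonneg (by linarith) (by linarith)

theorem stripToDisc_le {s t t' c : ℝ} (hc : 0 < c) (h : t ≤ t') :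
    stripToDisc s c t ≤ stripToDisc s c t' := by
  have h1 := one_sub_stripToDisc s c t
  have h2 := one_sub_stripToDisc s c t'
  have e := Real.exp_pos ((t - s) / c)
  have : Real.exp ((t - s) / c) ≤ Real.exp ((t' - s) / c) :=
    Real.exp_le_exp.2 (div_le_div_of_nonneg_right (by linarith) hc.le)
  have : 2 / (Real.exp ((t' - s) / c) + 1) ≤ 2 / (Real.exp ((t - s) / c) + 1) :=
    div_le_div_of_nonneg_left zero_le_two (by linarith) (by linarith)
  linarith

theorem exists_zero_count_const {L δ : ℝ} (hL : 0 < L) (hδ : 0 < δ) :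
    ∃ ρ > 0, ∃ C > 0, ∀ (s : ℝ) (q : ℂ → ℂ) (M : ℝ), DifferentiableOn ℂ q (box s ρ δ) →
      (∀ z ∈ box s ρ δ, ‖q z‖ ≤ M) → q s ≠ 0 → ∀ T : Finset ℝ,
      (∀ p ∈ T, p ∈ Ico s (s + L)) → ∀ k : ℝ → ℕ,
      (∀ p ∈ T, (k p : ℕ∞) ≤ analyticOrderAt q p) →
      ∑ p ∈ T, (k p : ℝ) ≤ C * Real.log (M / ‖q s‖) := by
  set c := δ / Real.pi with hcd
  have hc : 0 < c := div_pos hδ Real.pi_pos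
  set r := stripToDisc 0 c L with hr
  have hr0 : 0 < r := by
    have : 0 < (L - 0) / c := by rw [sub_zero]; positivity
    have := Real.one_lt_exp_iff.2 this
    exact div_pos (by linarith) (by linarith)
  have hr1 : r < 1 := by
    have h := one_sub_stripToDisc 0 c L
    have : 0 < 2 / (Real.exp ((L - 0) / c) + 1) := by positivity
    linarith
  set R := (1 + r) / 2 with hRd
  have hrR : r < R := by rw [hRd]; linarith
  have hR1 : R < 1 := by rw [hRd]; linarith
  have hlog : 0 ≤ Real.log (2 / (1 - R)) := Real.log_nonneg (by
    rw [one_le_div (by linarith)]; linarith)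
  refine ⟨c * (2 * Real.log (2 / (1 - R))) + 1, by positivity, (Real.log (R / r))⁻¹,
    inv_pos.2 (Real.log_pos (by rwa [one_lt_div hr0])), ?_⟩
  intro s q M hq hM hs T hT k hk
  have hlt : ∀ ζ ∈ Metric.closedBall (0 : ℂ) R, ‖ζ‖ < 1 := fun ζ hζ =>
    (mem_closedBall_zero_iff.1 hζ).trans_lt hR1
  have hmem : ∀ ζ ∈ Metric.closedBall (0 : ℂ) R,
      discToStrip s c ζ ∈ box s (c * (2 * Real.log (2 / (1 - R))) + 1) δ := fun ζ hζ =>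
    ⟨(abs_re_discToStrip_sub_le s hc hR1 (mem_closedBall_zero_iff.1 hζ)).trans_lt (lt_add_one _),
      (abs_im_discToStrip_lt s hc (hlt ζ hζ)).trans_eq (div_mul_cancel₀ _ Real.pi_ne_zero)⟩
  have hx : ∀ p ∈ T, ((stripToDisc s c p : ℝ) : ℂ) ∈ Metric.closedBall (0 : ℂ) r := by
    intro p hp
    rw [mem_closedBall_zero_iff, Complex.norm_real,
      Real.norm_of_nonneg (stripToDisc_nonneg hc (hT p hp).1)]
    refine (stripToDisc_le hc (hT p hp).2.le).trans_eq ?_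
    rw [hr, stripToDisc, stripToDisc, add_sub_cancel_left, sub_zero]
  have hinj : Set.InjOn (fun p : ℝ => ((stripToDisc s c p : ℝ) : ℂ)) T := by
    intro p _ p' _ h
    have := congrArg (discToStrip s c) h
    simp only [discToStrip_stripToDisc s _ hc] at this
    exact_mod_cast this
  have hre : ∀ p : ℝ, (discToStrip s c (stripToDisc s c p)).re = p := fun p => by
    rw [discToStrip_stripToDisc s _ hc, Complex.ofReal_re]
  have hmain := sum_order_le_of_analyticOnNhd (f := q ∘ discToStrip s c) (c := 0) (M := M) hr0 hrR
    (fun ζ hζ => ((hq.analyticAt ((isOpen_box _ _ _).mem_nhds (hmem ζ hζ))).comp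
      (analyticAt_discToStrip s c (hlt ζ hζ))))
    (by simpa [discToStrip_zero] using hs) (fun ζ hζ => hM _ (hmem ζ hζ))
    (T.image fun p : ℝ => ((stripToDisc s c p : ℝ) : ℂ))
    (by
      intro u hu
      obtain ⟨p, hp, rfl⟩ := Finset.mem_image.1 hu
      exact hx p hp)
    (fun u => k (discToStrip s c u).re)
    (by
      intro u hu
      obtain ⟨p, hp, rfl⟩ := Finset.mem_image.1 hu
      have hn := hlt _ (Metric.closedBall_subset_closedBall hrR.le (hx p hp))
      rw [analyticOrderAt_comp_of_deriv_ne_zero (analyticAt_discToStrip s c hn)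
        (deriv_discToStrip_ne_zero s hc hn), hre, discToStrip_stripToDisc s _ hc]
      exact hk p hp)
  rw [Finset.sum_image hinj] at hmain
  simp only [hre, Function.comp, discToStrip_zero] at hmain
  rwa [inv_mul_eq_div]

theorem iteratedDeriv_eq_of_eqOn_real {q : ℂ → ℂ} {n : ℝ → ℂ} {U : Set ℂ} (hU : IsOpen U)
    (hq : DifferentiableOn ℂ q U) (h : ∀ t : ℝ, (t : ℂ) ∈ U → n t = q t) (j : ℕ) :
    ∀ t : ℝ, (t : ℂ) ∈ U → iteratedDeriv j n t = iteratedDeriv j q t := by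
  induction j with
  | zero => simpa using h
  | succ j ih =>
    intro t ht
    rw [iteratedDeriv_succ, iteratedDeriv_succ]
    have ha : AnalyticAt ℂ (iteratedDeriv j q) t := by
      rw [iteratedDeriv_eq_iterate]
      exact (hq.analyticAt (hU.mem_nhds ht)).iterated_deriv j
    have hev : iteratedDeriv j n =ᶠ[𝓝 t] fun x : ℝ => iteratedDeriv j q x := by
      have : ∀ᶠ x : ℝ in 𝓝 t, (x : ℂ) ∈ U :=
        Complex.continuous_ofReal.continuousAt (hU.mem_nhds ht)
      filter_upwards [this] with x hx using ih x hx
    rw [hev.deriv_eq]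
    exact ha.differentiableAt.hasDerivAt.comp_ofReal.deriv

theorem exists_abs_le_of_periodic {f : ℝ → ℝ} {L : ℝ} (hL : 0 < L) (hf : Continuous f)
    (hp : Function.Periodic f L) : ∃ s, ∀ t, f t ≤ f s := by
  obtain ⟨s, _, hs⟩ := isCompact_Icc.exists_isMaxOn (nonempty_Icc.2 hL.le) hf.continuousOn
  refine ⟨s, fun t => ?_⟩
  obtain ⟨y, hy, he⟩ := hp.exists_mem_Ico₀ hL t
  rw [he]
  exact hs ⟨hy.1, hy.2.le⟩

theorem real_mem_box {s ρ δ t : ℝ} (hδ : 0 < δ) (h : |t - s| < ρ) : (t : ℂ) ∈ box s ρ δ :=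
  ⟨by simpa using h, by simpa using hδ⟩

theorem abs_sub_lt_of_real_mem_box {s ρ δ t : ℝ} (h : (t : ℂ) ∈ box s ρ δ) : |t - s| < ρ := by
  simpa using h.1

/-- The zero count for a function on the real line which extends holomorphically to a
complex neighbourhood with exponential bounds. -/
theorem exists_order_count_const {L δ : ℝ} (hL : 0 < L) (hδ : 0 < δ) :
    ∃ ρ > 0, ∀ K > (0 : ℝ), ∃ C > 0, ∀ lam > (0 : ℝ), ∀ (s A : ℝ) (n : ℝ → ℂ) (q : ℂ → ℂ),
      DifferentiableOn ℂ q (box s ρ δ) →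
      (∀ z ∈ box s ρ δ, ‖q z‖ ≤ K * Real.exp (K * lam) * A) → (∀ t, |t - s| < ρ → n t = q t) →
      ‖n s‖ = A → 0 < A → ∀ T : Finset ℝ, (∀ p ∈ T, p ∈ Ico s (s + L)) → ∀ k : ℝ → ℕ,
      (∀ p ∈ T, ∀ j < k p, iteratedDeriv j n p = 0) → ∑ p ∈ T, (k p : ℝ) ≤ C * (1 + lam) := by
  obtain ⟨ρ, hρ, C, hC, h⟩ := exists_zero_count_const hL hδ
  refine ⟨ρ + L, by positivity, fun K hK => ⟨C * (|Real.log K| + K), by positivity, ?_⟩⟩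
  intro lam hlam s A n q hq hb hnq hA hA0 T hT k hk
  have hsub : box s ρ δ ⊆ box s (ρ + L) δ := fun z hz => ⟨hz.1.trans (by linarith), hz.2⟩
  have hs : n s = q s := hnq s (by simpa using by positivity)
  have hsA : ‖q s‖ = A := by rw [← hs, hA]
  refine (h s q _ (hq.mono hsub) (fun z hz => hb z (hsub hz))
    (norm_pos_iff.1 (by rw [hsA]; exact hA0)) T hT k ?_).trans ?_
  · intro p hp
    have hpb : |p - s| < ρ + L := by
      rw [abs_of_nonneg (by linarith [(hT p hp).1])]
      linarith [(hT p hp).2]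
    have hp' := real_mem_box hδ hpb
    rw [natCast_le_analyticOrderAt_iff_iteratedDeriv_eq_zero
      (hq.analyticAt ((isOpen_box _ _ _).mem_nhds hp'))]
    intro j hj
    rw [← iteratedDeriv_eq_of_eqOn_real (isOpen_box _ _ _) hq
      (fun t ht => hnq t (abs_sub_lt_of_real_mem_box ht)) j p hp']
    exact hk p hp j hj
  · rw [hsA, mul_div_cancel_right₀ _ hA0.ne', Real.log_mul hK.ne' (Real.exp_ne_zero _),
      Real.log_exp, mul_assoc]
    refine mul_le_mul_of_nonneg_left ?_ hC.le
    have := le_abs_self (Real.log K)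
    nlinarith [abs_nonneg (Real.log K)]

namespace HelmholtzPair

variable {Ω : Set ℂ} {Γ : ℂ → ℂ} {L δ : ℝ}

theorem _root_.Collar.per_deriv (hC : Collar Ω Γ L δ) (t : ℝ) :
    deriv Γ ((t + L : ℝ) : ℂ) = deriv Γ t := by
  have hev : (fun z => Γ (z + L)) =ᶠ[𝓝 (t : ℂ)] Γ := by
    have := (isOpen_strip δ).mem_nhds (upStrip_subset _ (hC.real_mem t))
    filter_upwards [this] with z hz using hC.per z hz
  rw [Complex.ofReal_add, ← hev.deriv_eq, deriv_comp_add_const]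

theorem _root_.Collar.per_real (hC : Collar Ω Γ L δ) (t : ℝ) :
    Γ ((t + L : ℝ) : ℂ) = Γ t := by
  rw [Complex.ofReal_add, hC.per _ (upStrip_subset _ (hC.real_mem t))]

theorem exists_neumann_bound (hC : Collar Ω Γ L δ) :
    ∃ C > 0, ∀ lam > (0 : ℝ), ∀ v g, HelmholtzPair Ω (lam ^ 2 / 4) v g →
      (∃ x ∈ closure Ω, v x ≠ 0) →
      (∀ t : ℝ, (starRingEnd ℂ) (g (Γ t) * deriv Γ t) = g (Γ t) * deriv Γ t) →
      ∃ s : ℝ, ∀ T : Finset ℝ, (∀ p ∈ T, p ∈ Ico s (s + L)) → ∀ k : ℝ → ℕ,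
        (∀ p ∈ T, ∀ j < k p, iteratedDeriv j (fun t : ℝ => (v (Γ t) : ℂ)) p = 0) →
        ∑ p ∈ T, (k p : ℝ) ≤ C * (1 + lam) := by
  obtain ⟨ρ, hρ, hcount⟩ := exists_order_count_const hC.L_pos hC.δ_pos
  obtain ⟨K, hK, hext⟩ := exists_primitive_extension hC hρ
  obtain ⟨C, hC0, hcount⟩ := hcount (2 * K + 1) (by positivity)
  refine ⟨C, hC0, fun lam hlam v g h hne hη => ?_⟩
  have hac : Continuous fun t : ℝ => (v (Γ t) : ℂ) :=
    continuous_iff_continuousAt.2 fun t => (h.hasDerivAt_trace hC t).continuousAt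
  obtain ⟨s, hs⟩ := exists_abs_le_of_periodic hC.L_pos hac.norm
    (fun t => by rw [hC.per_real])
  set A := ‖(v (Γ s) : ℂ)‖ with hA
  have hA0 : 0 < A := by
    rcases (norm_nonneg (v (Γ s) : ℂ)).lt_or_eq with h0 | h0
    · exact h0
    exfalso
    have ha : ∀ t : ℝ, v (Γ t) = 0 := fun t => by
      have := (hs t).trans_eq (hA.trans h0.symm)
      exact_mod_cast norm_le_zero_iff.1 this
    obtain ⟨x, hx, hx0⟩ := hne
    refine hx0 (h.eq_zero_of_trace hC ha (fun t => ?_) x hx)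
    have hd := h.hasDerivAt_trace hC t
    rw [hη t] at hd
    have hz : (fun t : ℝ => (v (Γ t) : ℂ)) = fun _ => 0 := by
      funext t
      rw [ha t, Complex.ofReal_zero]
    rw [hz] at hd
    have := hd.unique (hasDerivAt_const t (0 : ℂ))
    have h2 : g (Γ t) * deriv Γ t = 0 := by linear_combination this / 2
    exact (mul_eq_zero.1 h2).resolve_right (hC.deriv_ne _ (upStrip_subset _ (hC.real_mem t)))
  obtain ⟨Y, hYc, hYd, hYb, hYt⟩ := hext lam hlam v g h 1 A (Or.inl ⟨rfl, hη, hs⟩) s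
  have hconj : ∀ t : ℝ, (t : ℂ) ∈ halfBox s ρ δ → (starRingEnd ℂ) (Y t) = Y t := by
    intro t ht
    rw [hYt t (by simpa using ht.1), ← Complex.conjCLE_apply, ← ContinuousLinearEquiv.coe_coe,
      ← ContinuousLinearMap.intervalIntegral_comp_comm _
        ((h.continuous_normal hC).intervalIntegrable _ _)]
    simp only [ContinuousLinearEquiv.coe_coe, Complex.conjCLE_apply, hη]
  obtain ⟨G, hGd, hGe, hGb⟩ := exists_reflection hYc hYd hconj
  refine ⟨s, hcount lam hlam s A _ (fun z => v (Γ s) + 2 * G z) ?_ ?_ ?_ hA.symm hA0⟩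
  · exact (hGd.const_mul 2).const_add _
  · intro z hz
    obtain ⟨w, hw, hzw⟩ := hGb z hz
    have h1 := hYb w hw
    have h2 : 1 ≤ Real.exp (K * lam) := Real.one_le_exp (by positivity)
    have h3 : Real.exp (K * lam) ≤ Real.exp ((2 * K + 1) * lam) :=
      Real.exp_le_exp.2 (by nlinarith)
    refine (norm_add_le _ _).trans ?_
    rw [norm_mul, hzw, ← hA, Complex.norm_two]
    calc A + 2 * ‖Y w‖ ≤ A * Real.exp (K * lam) + 2 * (K * Real.exp (K * lam) * A) := by
          nlinarith
      _ = (2 * K + 1) * A * Real.exp (K * lam) := by ring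
      _ ≤ (2 * K + 1) * A * Real.exp ((2 * K + 1) * lam) := by gcongr
      _ = _ := by ring
  · intro t ht
    have hmem : (t : ℂ) ∈ halfBox s ρ δ := ⟨by simpa using ht, by simp, by simpa using hC.δ_pos⟩
    have hint := intervalIntegral.integral_eq_sub_of_hasDerivAt (a := s) (b := t)
      (f := fun t : ℝ => (v (Γ t) : ℂ)) (f' := fun t : ℝ => 2 * (g (Γ t) * deriv Γ t))
      (fun x _ => by
        have := h.hasDerivAt_trace hC x
        rw [hη x] at this
        exact this.congr_deriv (two_mul _).symm)
      (((h.continuous_normal hC).const_mul 2).intervalIntegrable _ _)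
    rw [intervalIntegral.integral_const_mul] at hint
    rw [hGe _ hmem, hYt t ht, hint]
    ring

theorem exists_dirichlet_bound (hC : Collar Ω Γ L δ) :
    ∃ C > 0, ∀ lam > (0 : ℝ), ∀ v g, HelmholtzPair Ω (lam ^ 2 / 4) v g →
      (∃ x ∈ closure Ω, v x ≠ 0) → (∀ t : ℝ, v (Γ t) = 0) →
      ∃ s : ℝ, ∀ T : Finset ℝ, (∀ p ∈ T, p ∈ Ico s (s + L)) → ∀ k : ℝ → ℕ,
        (∀ p ∈ T, ∀ j < k p, iteratedDeriv j (fun t : ℝ => g (Γ t) * deriv Γ t) p = 0) →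
        ∑ p ∈ T, (k p : ℝ) ≤ C * (1 + lam) := by
  have hδ := hC.δ_pos
  obtain ⟨ρ, hρ, hcount⟩ := exists_order_count_const hC.L_pos (half_pos hδ)
  obtain ⟨K, hK, hext⟩ := exists_primitive_extension hC (ρ := ρ + δ / 2) (by positivity)
  obtain ⟨C, hC0, hcount⟩ := hcount (K + K / (δ / 4)) (by positivity)
  refine ⟨C, hC0, fun lam hlam v g h hne ha => ?_⟩
  have hη : ∀ t : ℝ, (starRingEnd ℂ) (g (Γ t) * deriv Γ t) = -(g (Γ t) * deriv Γ t) := by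
    intro t
    have hd := h.hasDerivAt_trace hC t
    have hz : (fun t : ℝ => (v (Γ t) : ℂ)) = fun _ => 0 := by
      funext t
      rw [ha t, Complex.ofReal_zero]
    rw [hz] at hd
    linear_combination hd.unique (hasDerivAt_const t (0 : ℂ))
  obtain ⟨s, hs⟩ := exists_abs_le_of_periodic hC.L_pos (h.continuous_normal hC).norm
    (fun t => by rw [hC.per_real, hC.per_deriv])
  set A := ‖g (Γ s) * deriv Γ s‖ with hA
  have hA0 : 0 < A := by
    rcases (norm_nonneg (g (Γ s) * deriv Γ s)).lt_or_eq with h0 | h0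
    · exact h0
    exfalso
    obtain ⟨x, hx, hx0⟩ := hne
    refine hx0 (h.eq_zero_of_trace hC ha (fun t => ?_) x hx)
    have := norm_le_zero_iff.1 ((hs t).trans_eq (hA.trans h0.symm))
    exact (mul_eq_zero.1 this).resolve_right (hC.deriv_ne _ (upStrip_subset _ (hC.real_mem t)))
  obtain ⟨Y, hYc, hYd, hYb, hYt⟩ := hext lam hlam v g h (-1) A
    (Or.inr ⟨rfl, hη, fun t => by simp [ha t], hs⟩) s
  have hconj : ∀ t : ℝ, (t : ℂ) ∈ halfBox s (ρ + δ / 2) δ →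
      (starRingEnd ℂ) (Complex.I * Y t) = Complex.I * Y t := by
    intro t ht
    rw [map_mul, Complex.conj_I, hYt t (by simpa using ht.1), ← Complex.conjCLE_apply,
      ← ContinuousLinearEquiv.coe_coe, ← ContinuousLinearMap.intervalIntegral_comp_comm _
        ((h.continuous_normal hC).intervalIntegrable _ _)]
    simp only [ContinuousLinearEquiv.coe_coe, Complex.conjCLE_apply, hη]
    rw [intervalIntegral.integral_neg]
    ring
  obtain ⟨G, hGd, hGe, hGb⟩ := exists_reflection (hYc.const_mul Complex.I)
    (hYd.const_mul Complex.I) hconj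
  have hsub : box s ρ (δ / 2) ⊆ box s (ρ + δ / 2) δ := fun z hz =>
    ⟨hz.1.trans (by linarith), hz.2.trans (by linarith)⟩
  have hGt : ∀ t : ℝ, |t - s| < ρ + δ / 2 →
      G t = Complex.I * ∫ x in s..t, g (Γ x) * deriv Γ x := by
    intro t ht
    rw [hGe _ ⟨by simpa using ht, by simp, by simpa using hδ⟩, hYt t ht]
  refine ⟨s, hcount lam hlam s A _ (fun z => -Complex.I * deriv G z) ?_ ?_ ?_ hA.symm hA0⟩
  · exact ((hGd.deriv (isOpen_box _ _ _)).mono hsub).const_mul _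
  · intro z hz
    have hball : Metric.closedBall z (δ / 4) ⊆ box s (ρ + δ / 2) δ := by
      intro w hw
      rw [Metric.mem_closedBall, dist_eq_norm] at hw
      have h1 := (Complex.abs_re_le_norm (w - z)).trans hw
      have h2 := (Complex.abs_im_le_norm (w - z)).trans hw
      rw [Complex.sub_re] at h1
      rw [Complex.sub_im] at h2
      have h3 := hz.1
      have h4 := hz.2
      constructor
      · have := abs_add_le (w.re - z.re) (z.re - s)
        rw [sub_add_sub_cancel] at this
        linarith
      · have := abs_add_le (w.im - z.im) z.im
        rw [sub_add_cancel] at this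
        linarith
    have hd := Complex.norm_deriv_le_of_forall_mem_sphere_norm_le (c := z) (f := G)
      (R := δ / 4) (C := K * Real.exp (K * lam) * A) (by positivity)
      ((hGd.mono (Metric.closure_ball_subset_closedBall.trans hball)).diffContOnCl) (fun w hw => by
        obtain ⟨w', hw', he⟩ := hGb w (hball (Metric.sphere_subset_closedBall hw))
        rw [he, norm_mul, Complex.norm_I, one_mul]
        exact hYb w' hw')
    have hKK : K ≤ K + K / (δ / 4) := by
      have : 0 < K / (δ / 4) := by positivity
      linarith
    rw [norm_mul, norm_neg, Complex.norm_I, one_mul]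
    refine hd.trans ?_
    have h3 : Real.exp (K * lam) ≤ Real.exp ((K + K / (δ / 4)) * lam) :=
      Real.exp_le_exp.2 (mul_le_mul_of_nonneg_right hKK hlam.le)
    calc K * Real.exp (K * lam) * A / (δ / 4) = K / (δ / 4) * Real.exp (K * lam) * A := by ring
      _ ≤ _ := by
        gcongr
        linarith
  · intro t ht
    have hmem : (t : ℂ) ∈ box s (ρ + δ / 2) δ := hsub (real_mem_box (half_pos hδ) ht)
    have h1 := (hGd.differentiableAt ((isOpen_box _ _ _).mem_nhds hmem)).hasDerivAt.comp_ofReal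
    have h2 : HasDerivAt (fun t : ℝ => Complex.I * ∫ x in s..t, g (Γ x) * deriv Γ x)
        (Complex.I * (g (Γ t) * deriv Γ t)) t :=
      ((h.continuous_normal hC).integral_hasStrictDerivAt s t).hasDerivAt.const_mul _
    have hev : (fun t : ℝ => G t) =ᶠ[𝓝 t]
        fun t : ℝ => Complex.I * ∫ x in s..t, g (Γ x) * deriv Γ x := by
      have : ∀ᶠ x : ℝ in 𝓝 t, |x - s| < ρ + δ / 2 :=
        (isOpen_lt (f := fun x : ℝ => |x - s|) (by fun_prop) continuous_const).mem_nhds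
          (show |t - s| < ρ + δ / 2 by linarith)
      filter_upwards [this] with x hx using hGt x hx
    rw [(h1.congr_of_eventuallyEq hev.symm).unique h2, neg_mul, ← mul_assoc, Complex.I_mul_I]
    ring

end HelmholtzPair

/-- Iterated Rolle theorem: `k + 1` zeros force a zero of the `k`-th derivative. -/
theorem not_strictMono_zeros {J : Set ℝ} (hJ : J.OrdConnected) (k : ℕ) :
    ∀ f : ℕ → ℝ → ℝ, (∀ j < k, ∀ x ∈ J, HasDerivAt (f j) (f (j + 1) x) x) →
      (∀ x ∈ J, f k x ≠ 0) → ∀ x : Fin (k + 1) → ℝ, StrictMono x → (∀ i, x i ∈ J) →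
      ¬ ∀ i, f 0 (x i) = 0 := by
  induction k with
  | zero => exact fun f _ h x _ hx h0 => h _ (hx 0) (h0 0)
  | succ k ih =>
    intro f hd h x hmono hx h0
    have key : ∀ i : Fin (k + 1), ∃ y ∈ Ioo (x i.castSucc) (x i.succ), f 1 y = 0 := by
      intro i
      have hlt : x i.castSucc < x i.succ := hmono Fin.castSucc_lt_succ
      have hsub : Icc (x i.castSucc) (x i.succ) ⊆ J := hJ.out (hx _) (hx _)
      exact exists_hasDerivAt_eq_zero hlt
        (fun y hy => (hd 0 k.succ_pos y (hsub hy)).continuousAt.continuousWithinAt)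
        (by rw [h0, h0]) (fun y hy => hd 0 k.succ_pos y (hsub (Ioo_subset_Icc_self hy)))
    choose y hy hy0 using key
    refine ih (fun j => f (j + 1)) (fun j hj => hd (j + 1) (by omega)) h y ?_ ?_ hy0
    · rw [Fin.strictMono_iff_lt_succ]
      intro i
      have h1 := (hy i.castSucc).2
      have h2 := (hy i.succ).1
      rw [Fin.succ_castSucc] at h1
      exact h1.trans h2
    · exact fun i => hJ.out (hx _) (hx _) (Ioo_subset_Icc_self (hy i))

theorem card_zeros_le {J : Set ℝ} (hJ : J.OrdConnected) {k : ℕ} {f : ℕ → ℝ → ℝ}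
    (hd : ∀ j < k, ∀ x ∈ J, HasDerivAt (f j) (f (j + 1) x) x) (h : ∀ x ∈ J, f k x ≠ 0)
    (T : Finset ℝ) (hT : ∀ x ∈ T, x ∈ J ∧ f 0 x = 0) : T.card ≤ k := by
  by_contra! hlt
  obtain ⟨T', hT', hc⟩ := Finset.exists_subset_card_eq (Nat.succ_le_of_lt hlt)
  have hm : ∀ i, T'.orderEmbOfFin hc i ∈ T := fun i => hT' (T'.orderEmbOfFin_mem hc i)
  exact not_strictMono_zeros hJ k f hd h (T'.orderEmbOfFin hc) (T'.orderEmbOfFin hc).strictMono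
    (fun i => (hT _ (hm i)).1) fun i => (hT _ (hm i)).2

/-- A function vanishing to order `k` at `p` has no other zero on an interval where the `k`-th
derivative does not vanish. -/
theorem ne_zero_of_iterated_deriv {J : Set ℝ} (hJ : J.OrdConnected) (k : ℕ) {p : ℝ}
    (hp : p ∈ J) : ∀ f : ℕ → ℝ → ℝ, (∀ j < k, ∀ x ∈ J, HasDerivAt (f j) (f (j + 1) x) x) →
      (∀ x ∈ J, f k x ≠ 0) → (∀ j < k, f j p = 0) → ∀ x ∈ J, x ≠ p → f 0 x ≠ 0 := by
  induction k with
  | zero => exact fun f _ h _ x hx _ => h x hx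
  | succ k ih =>
    intro f hd h hz x hx hxp h0
    have hp0 := hz 0 k.succ_pos
    have hc : ∀ a ∈ J, ∀ b ∈ J, a < b → f 0 a = 0 → f 0 b = 0 →
        ∃ y ∈ Ioo a b, y ∈ J ∧ f 1 y = 0 := by
      intro a ha b hb hab h1 h2
      have hsub : Icc a b ⊆ J := hJ.out ha hb
      obtain ⟨y, hy, hy0⟩ := exists_hasDerivAt_eq_zero hab
        (fun y hy => (hd 0 k.succ_pos y (hsub hy)).continuousAt.continuousWithinAt)
        (by rw [h1, h2]) (fun y hy => hd 0 k.succ_pos y (hsub (Ioo_subset_Icc_self hy)))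
      exact ⟨y, hy, hsub (Ioo_subset_Icc_self hy), hy0⟩
    have hih := ih (fun j => f (j + 1)) (fun j hj => hd (j + 1) (by omega)) h
      (fun j hj => hz (j + 1) (by omega))
    rcases lt_or_gt_of_ne hxp with hlt | hlt
    · obtain ⟨y, hy, hyJ, hy0⟩ := hc x hx p hp hlt h0 hp0
      exact hih y hyJ hy.2.ne hy0
    · obtain ⟨y, hy, hyJ, hy0⟩ := hc p hp x hx hlt hp0 h0
      exact hih y hyJ (ne_of_gt hy.1) hy0

/-- The derivative of `G` in the direction `e`. -/
noncomputable def dirDeriv (e : ℂ) (G : ℂ → ℝ) (z : ℂ) : ℝ := fderiv ℝ G z e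

theorem ContDiffOn.dirDeriv {W : Set ℂ} (hW : IsOpen W) {G : ℂ → ℝ}
    (hG : ContDiffOn ℝ (⊤ : ℕ∞) G W) (e : ℂ) : ContDiffOn ℝ (⊤ : ℕ∞) (dirDeriv e G) W := by
  have := hG.fderiv_of_isOpen hW (m := (⊤ : ℕ∞)) (by norm_cast)
  exact this.clm_apply contDiffOn_const

theorem ContDiffOn.dirDeriv_iterate {W : Set ℂ} (hW : IsOpen W) {G : ℂ → ℝ}
    (hG : ContDiffOn ℝ (⊤ : ℕ∞) G W) (e : ℂ) (k : ℕ) :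
    ContDiffOn ℝ (⊤ : ℕ∞) ((_root_.dirDeriv e)^[k] G) W := by
  induction k with
  | zero => exact hG
  | succ k ih =>
    rw [Function.iterate_succ_apply']
    exact ih.dirDeriv hW e

theorem ContDiffOn.hasFDerivAt_of_isOpen {W : Set ℂ} (hW : IsOpen W) {G : ℂ → ℝ}
    (hG : ContDiffOn ℝ (⊤ : ℕ∞) G W) {z : ℂ} (hz : z ∈ W) : HasFDerivAt G (fderiv ℝ G z) z :=
  ((hG.contDiffAt (hW.mem_nhds hz)).differentiableAt (by simp)).hasFDerivAt

theorem hasDerivAt_horizontal {W : Set ℂ} (hW : IsOpen W) {G : ℂ → ℝ}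
    (hG : ContDiffOn ℝ (⊤ : ℕ∞) G W) (w : ℂ) {s : ℝ} (hz : (s : ℂ) + w ∈ W) :
    HasDerivAt (fun s : ℝ => G (s + w)) (dirDeriv 1 G (s + w)) s := by
  have h1 : HasDerivAt (fun s : ℝ => (s : ℂ) + w) 1 s :=
    (hasDerivAt_id (s : ℂ)).comp_ofReal.add_const w
  exact (hG.hasFDerivAt_of_isOpen hW hz).comp_hasDerivAt s h1

theorem hasDerivAt_vertical {W : Set ℂ} (hW : IsOpen W) {G : ℂ → ℝ}
    (hG : ContDiffOn ℝ (⊤ : ℕ∞) G W) (w : ℂ) {τ : ℝ} (hz : w + τ * Complex.I ∈ W) :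
    HasDerivAt (fun τ : ℝ => G (w + τ * Complex.I)) (dirDeriv Complex.I G (w + τ * Complex.I)) τ := by
  have h1 : HasDerivAt (fun τ : ℝ => w + (τ : ℂ) * Complex.I) (1 * Complex.I) τ :=
    ((hasDerivAt_id (τ : ℂ)).comp_ofReal.mul_const _).const_add w
  rw [one_mul] at h1
  exact (hG.hasFDerivAt_of_isOpen hW hz).comp_hasDerivAt τ h1

theorem dirDeriv_comm {W : Set ℂ} (hW : IsOpen W) {G : ℂ → ℝ}
    (hG : ContDiffOn ℝ (⊤ : ℕ∞) G W) (e e' : ℂ) {z : ℂ} (hz : z ∈ W) :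
    dirDeriv e (dirDeriv e' G) z = dirDeriv e' (dirDeriv e G) z := by
  have hd : DifferentiableAt ℝ (fderiv ℝ G) z :=
    ((hG.fderiv_of_isOpen hW (m := (⊤ : ℕ∞)) (by norm_cast)).contDiffAt
      (hW.mem_nhds hz)).differentiableAt (by simp)
  have hsymm := (hG.contDiffAt (hW.mem_nhds hz)).isSymmSndFDerivAt
    (by simpa using WithTop.coe_le_coe.2 (le_top (a := (2 : ℕ∞))))
  have key : ∀ a b : ℂ, dirDeriv a (dirDeriv b G) z = fderiv ℝ (fderiv ℝ G) z a b := by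
    intro a b
    have := hd.hasFDerivAt.clm_apply (hasFDerivAt_const b z)
    change fderiv ℝ (fun w => fderiv ℝ G w b) z a = _
    rw [this.fderiv]
    simp
  rw [key, key]
  exact hsymm e e'

theorem dirDeriv_congr {W : Set ℂ} (hW : IsOpen W) {G H : ℂ → ℝ} (h : EqOn G H W) (e : ℂ) :
    EqOn (dirDeriv e G) (dirDeriv e H) W := by
  intro z hz
  have : G =ᶠ[𝓝 z] H := h.eventuallyEq_of_mem (hW.mem_nhds hz)
  change fderiv ℝ G z e = fderiv ℝ H z e
  rw [this.fderiv_eq]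

theorem dirDeriv_iterate_comm {W : Set ℂ} (hW : IsOpen W) {G : ℂ → ℝ}
    (hG : ContDiffOn ℝ (⊤ : ℕ∞) G W) (e e' : ℂ) (k : ℕ) :
    EqOn (dirDeriv e' ((dirDeriv e)^[k] G)) ((dirDeriv e)^[k] (dirDeriv e' G)) W := by
  induction k with
  | zero => exact fun z _ => rfl
  | succ k ih =>
    intro z hz
    rw [Function.iterate_succ_apply', Function.iterate_succ_apply',
      dirDeriv_comm hW (hG.dirDeriv_iterate hW e k) e' e hz]
    exact dirDeriv_congr hW ih e hz

theorem hasDerivAt_iterate {W : Set ℂ} (hW : IsOpen W) {G : ℂ → ℝ}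
    (hG : ContDiffOn ℝ (⊤ : ℕ∞) G W) (w : ℂ) {s : ℝ} (hz : (s : ℂ) + w ∈ W) (j : ℕ) :
    HasDerivAt (fun s : ℝ => (dirDeriv 1)^[j] G (s + w)) ((dirDeriv 1)^[j + 1] G (s + w)) s := by
  rw [Function.iterate_succ_apply']
  exact hasDerivAt_horizontal hW (hG.dirDeriv_iterate hW 1 j) w hz

theorem dirDeriv_iterate_eq_zero {W : Set ℂ} (hW : IsOpen W) {G : ℂ → ℝ}
    (hG : ContDiffOn ℝ (⊤ : ℕ∞) G W) (hr : ∀ t : ℝ, (t : ℂ) ∈ W) (h0 : ∀ t : ℝ, G t = 0)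
    (k : ℕ) : ∀ t : ℝ, (dirDeriv 1)^[k] G t = 0 := by
  induction k with
  | zero => exact h0
  | succ k ih =>
    intro t
    have := hasDerivAt_iterate hW hG 0 (s := t) (by simpa using hr t) k
    simp only [add_zero, ih] at this
    exact this.unique (hasDerivAt_const t (0 : ℝ))

/-- If the vertical derivative does not vanish on a vertical segment starting at a zero of `G`,
then `G` has no other zero on the segment. -/
theorem ne_zero_of_vertical {W : Set ℂ} (hW : IsOpen W) {G : ℂ → ℝ}
    (hG : ContDiffOn ℝ (⊤ : ℕ∞) G W) {s τ : ℝ} (hτ : 0 < τ) (h0 : G s = 0)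
    (hmem : ∀ σ ∈ Icc 0 τ, (s : ℂ) + σ * Complex.I ∈ W)
    (hne : ∀ σ ∈ Icc 0 τ, dirDeriv Complex.I G (s + σ * Complex.I) ≠ 0) :
    G (s + τ * Complex.I) ≠ 0 := by
  intro h
  obtain ⟨σ, hσ, hz⟩ := exists_hasDerivAt_eq_zero hτ
    (f := fun σ : ℝ => G (s + σ * Complex.I))
    (fun σ hσ => (hasDerivAt_vertical hW hG s (hmem σ hσ)).continuousAt.continuousWithinAt)
    (by simp [h0, h])
    (fun σ hσ => hasDerivAt_vertical hW hG s (hmem σ (Ioo_subset_Icc_self hσ)))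
  exact hne σ (Ioo_subset_Icc_self hσ) hz

theorem exists_ball_ne_zero {W : Set ℂ} (hW : IsOpen W) {G : ℂ → ℝ} (hG : ContinuousOn G W)
    {z : ℂ} (hz : z ∈ W) (h : G z ≠ 0) : ∃ ρ > 0, ∀ w, ‖w - z‖ < ρ → w ∈ W ∧ G w ≠ 0 := by
  have h1 : ∀ᶠ w in 𝓝 z, w ∈ W ∧ G w ≠ 0 :=
    (hW.eventually_mem hz).and ((hG.continuousAt (hW.mem_nhds hz)).eventually_ne h)
  obtain ⟨ρ, hρ, hb⟩ := Metric.eventually_nhds_iff.1 h1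
  exact ⟨ρ, hρ, fun w hw => hb (by rwa [dist_eq_norm])⟩

/-- The structure near the real axis of the zero set of a function vanishing on the real axis
whose normal derivative vanishes to order `k` at `p`. -/
theorem exists_zero_box {W : Set ℂ} (hW : IsOpen W) {F : ℂ → ℝ}
    (hF : ContDiffOn ℝ (⊤ : ℕ∞) F W) (hr : ∀ t : ℝ, (t : ℂ) ∈ W) (h0 : ∀ t : ℝ, F t = 0)
    {p : ℝ} {k : ℕ} (hz : ∀ j < k, (dirDeriv 1)^[j] (dirDeriv Complex.I F) p = 0)
    (hk : (dirDeriv 1)^[k] (dirDeriv Complex.I F) p ≠ 0) :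
    ∃ r > (0 : ℝ), ∃ ε₀ > (0 : ℝ), ∀ ε : ℝ, 0 < ε → ε < ε₀ →
      (∀ τ : ℝ, 0 < τ → τ ≤ ε → F ((p - r : ℝ) + τ * Complex.I) ≠ 0 ∧
        F ((p + r : ℝ) + τ * Complex.I) ≠ 0) ∧
      ∀ T : Finset ℝ, (∀ s ∈ T, s ∈ Icc (p - r) (p + r) ∧ F (s + ε * Complex.I) = 0) →
        T.card ≤ k := by
  set E := dirDeriv Complex.I F with hE
  have hEs : ContDiffOn ℝ (⊤ : ℕ∞) E W := hF.dirDeriv hW _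
  obtain ⟨ρ, hρ, hb⟩ := exists_ball_ne_zero hW (hEs.dirDeriv_iterate hW 1 k).continuousOn (hr p) hk
  have hnorm : ∀ s σ : ℝ, ∀ q : ℝ, ‖(s : ℂ) + σ * Complex.I - q‖ ≤ |s - q| + |σ| := by
    intro s σ q
    have : (s : ℂ) + σ * Complex.I - q = ((s - q : ℝ) : ℂ) + σ * Complex.I := by push_cast; ring
    rw [this]
    refine (norm_add_le _ _).trans ?_
    rw [norm_mul, Complex.norm_I, mul_one, Complex.norm_real, Complex.norm_real,
      Real.norm_eq_abs, Real.norm_eq_abs]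
  have hside : ∀ x : ℝ, |x - p| = ρ / 2 → ∃ ε₁ > (0 : ℝ), ∀ τ : ℝ, 0 < τ → τ < ε₁ →
      F (x + τ * Complex.I) ≠ 0 := by
    intro x hx
    have hJ : (Icc (p - ρ / 2) (p + ρ / 2)).OrdConnected := ordConnected_Icc
    have hxJ : x ∈ Icc (p - ρ / 2) (p + ρ / 2) := by
      have := abs_le.1 hx.le
      constructor <;> linarith [this.1, this.2]
    have hx0 : E x ≠ 0 := by
      refine ne_zero_of_iterated_deriv hJ k (p := p) ⟨by linarith, by linarith⟩
        (fun j s => (dirDeriv 1)^[j] E s) ?_ ?_ hz x hxJ ?_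
      · intro j _ s _
        have := hasDerivAt_iterate hW hEs 0 (s := s) (by simpa using hr s) j
        simpa using this
      · intro s hs
        refine (hb s ?_).2
        have h1 := hnorm s 0 p
        have h2 : |s - p| ≤ ρ / 2 := abs_le.2 ⟨by linarith [hs.1], by linarith [hs.2]⟩
        simp only [Complex.ofReal_zero, zero_mul, add_zero, abs_zero] at h1
        linarith
      · rintro rfl
        rw [sub_self, abs_zero] at hx
        linarith
    obtain ⟨ε₁, hε₁, hb₁⟩ := exists_ball_ne_zero hW hEs.continuousOn (hr x) hx0
    refine ⟨ε₁, hε₁, fun τ hτ hτ1 => ?_⟩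
    have : ∀ σ ∈ Icc 0 τ, ‖(x : ℂ) + (σ : ℝ) * Complex.I - x‖ < ε₁ := by
      intro σ hσ
      have := hnorm x σ x
      rw [sub_self, abs_zero, zero_add, abs_of_nonneg hσ.1] at this
      linarith [hσ.2]
    exact ne_zero_of_vertical hW hF hτ (h0 x) (fun σ hσ => (hb₁ _ (this σ hσ)).1)
      fun σ hσ => (hb₁ _ (this σ hσ)).2
  obtain ⟨ε₁, hε₁, h₁⟩ := hside (p - ρ / 2) (by
    rw [sub_sub_cancel_left, abs_neg, abs_of_pos (by positivity)])
  obtain ⟨ε₂, hε₂, h₂⟩ := hside (p + ρ / 2) (by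
    rw [add_sub_cancel_left, abs_of_pos (by positivity)])
  refine ⟨ρ / 2, by positivity, min (ρ / 2) (min ε₁ ε₂), by positivity, fun ε hε hεε => ?_⟩
  obtain ⟨e0, e1⟩ := lt_min_iff.1 hεε
  obtain ⟨e1, e2⟩ := lt_min_iff.1 e1
  refine ⟨fun τ hτ hτε => ⟨h₁ τ hτ (by linarith), h₂ τ hτ (by linarith)⟩, fun T hT => ?_⟩
  have hin : ∀ s ∈ Icc (p - ρ / 2) (p + ρ / 2), ∀ σ ∈ Icc 0 ε,
      ‖(s : ℂ) + (σ : ℝ) * Complex.I - p‖ < ρ := by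
    intro s hs σ hσ
    have h1 := hnorm s σ p
    have h2 : |s - p| ≤ ρ / 2 := abs_le.2 ⟨by linarith [hs.1], by linarith [hs.2]⟩
    rw [abs_of_nonneg hσ.1] at h1
    linarith [hσ.2]
  refine card_zeros_le (ordConnected_Icc (a := p - ρ / 2) (b := p + ρ / 2))
    (f := fun j s => (dirDeriv 1)^[j] F (s + ε * Complex.I)) ?_ ?_ T hT
  · intro j _ s hs
    exact hasDerivAt_iterate hW hF _ (hb _ (hin s hs ε ⟨hε.le, le_rfl⟩)).1 j
  · intro s hs
    refine ne_zero_of_vertical hW (hF.dirDeriv_iterate hW 1 k) hε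
      (dirDeriv_iterate_eq_zero hW hF hr h0 k s) (fun σ hσ => (hb _ (hin s hs σ hσ)).1) ?_
    intro σ hσ
    have hm := hb _ (hin s hs σ hσ)
    rw [dirDeriv_iterate_comm hW hF 1 Complex.I k hm.1]
    exact hm.2

section BoxCrossing

variable {Ω : Set ℂ} {Γ : ℂ → ℂ} {L δ : ℝ}

/-- A connected subset of the interior nodal set which accumulates at a boundary point and is not
contained in a box at this point crosses the top edge of the box. -/
theorem Collar.exists_mem_top (hC : Collar Ω Γ L δ) {v : ℂ → ℝ} {S : Set ℂ}
    (hS : IsPreconnected S) (hSΩ : ∀ x ∈ S, x ∈ Ω ∧ v x = 0) {p r ε : ℝ} (hr : 0 < r)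
    (hε : 0 < ε) (hεδ : ε < δ) (hp : Γ p ∈ closure S)
    (hside : ∀ τ : ℝ, 0 < τ → τ ≤ ε → v (Γ ((p - r : ℝ) + τ * Complex.I)) ≠ 0 ∧
        v (Γ ((p + r : ℝ) + τ * Complex.I)) ≠ 0)
    {x : ℂ} (hx : x ∈ S) (hxb : ∀ z ∈ upStripInt δ, Γ z = x → ε < z.im) :
    ∃ s ∈ Icc (p - r) (p + r), Γ (s + ε * Complex.I) ∈ S := by
  by_contra! hcon
  set N : Set ℂ := Ioo (p - r) (p + r) ×ℂ Ioo (-ε) ε with hN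
  set B : Set ℂ := Icc (p - r) (p + r) ×ℂ Icc (-ε) ε with hB
  have hstrip : B ⊆ strip δ := fun z hz => by
    have := hz.2
    exact (abs_le.2 this).trans_lt hεδ
  have hNB : N ⊆ B := fun z hz => ⟨Ioo_subset_Icc_self hz.1, Ioo_subset_Icc_self hz.2⟩
  have hNo : IsOpen (Γ '' N) :=
    hC.isOpen_image (isOpen_Ioo.reProdIm isOpen_Ioo) (hNB.trans hstrip)
  have hBc : IsCompact (Γ '' B) :=
    (isCompact_Icc.reProdIm isCompact_Icc).image_of_continuousOn (hC.diff.continuousOn.mono hstrip)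
  have hup : ∀ z ∈ B, Γ z ∈ Ω → z ∈ upStripInt δ := by
    intro z hz hzΩ
    have hzs : -δ < z.im ∧ z.im < δ := abs_lt.1 (hstrip hz)
    refine ⟨?_, hzs.2⟩
    by_contra! hneg
    rcases hneg.lt_or_eq with h | h
    · exact hC.outside z hzs.1 h (subset_closure hzΩ)
    · have hf : Γ z ∈ frontier Ω := by
        rw [hC.front]
        exact ⟨z, h, rfl⟩
      exact (hC.isOpen.frontier_eq ▸ hf).2 hzΩ
  have hcover : S ⊆ Γ '' N ∪ (Γ '' B)ᶜ := by
    intro y hy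
    by_cases hyB : y ∈ Γ '' B
    · left
      obtain ⟨z, hz, rfl⟩ := hyB
      have hzu := hup z hz (hSΩ _ hy).1
      have hzeq : ((z.re : ℝ) : ℂ) + z.im * Complex.I = z := Complex.re_add_im z
      have h1 : z.re ≠ p - r := fun h => (hside z.im hzu.1 hz.2.2).1 (by
        rw [← h, hzeq]; exact (hSΩ _ hy).2)
      have h2 : z.re ≠ p + r := fun h => (hside z.im hzu.1 hz.2.2).2 (by
        rw [← h, hzeq]; exact (hSΩ _ hy).2)
      have h3 : z.im ≠ ε := fun h => hcon z.re hz.1 (by rw [← h, hzeq]; exact hy)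
      exact ⟨z, ⟨⟨lt_of_le_of_ne hz.1.1 h1.symm, lt_of_le_of_ne hz.1.2 h2⟩,
        ⟨by have := hzu.1; linarith, lt_of_le_of_ne hz.2.2 h3⟩⟩, rfl⟩
    · exact Or.inr hyB
  have hne1 : (S ∩ Γ '' N).Nonempty := by
    rw [inter_comm]
    refine mem_closure_iff.1 hp _ hNo ⟨p, ⟨?_, ?_⟩, rfl⟩
    · simp [hr]
    · simp [hε]
  have hne2 : (S ∩ (Γ '' B)ᶜ).Nonempty := by
    refine ⟨x, hx, ?_⟩
    rintro ⟨z, hz, hzx⟩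
    have := hxb z (hup z hz (by rw [hzx]; exact (hSΩ x hx).1)) hzx
    exact absurd this (not_lt.2 hz.2.2)
  obtain ⟨y, -, hyN, hyB⟩ := hS _ _ hNo hBc.isClosed.isOpen_compl hcover hne1 hne2
  exact hyB (image_mono hNB hyN)

theorem Collar.exists_height (hC : Collar Ω Γ L δ) (x : ℂ) :
    ∃ ε > 0, ∀ z ∈ upStripInt δ, Γ z = x → ε ≤ z.im := by
  by_cases h : ∃ z ∈ upStripInt δ, Γ z = x
  · obtain ⟨z, hz, hzx⟩ := h
    refine ⟨z.im, hz.1, fun w hw hwx => ?_⟩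
    obtain ⟨k, rfl⟩ := hC.inj z (upStrip_subset _ (upStripInt_subset _ hz)) w
      (upStrip_subset _ (upStripInt_subset _ hw)) (hzx.trans hwx.symm)
    simp
  · push Not at h
    exact ⟨1, one_pos, fun z hz hzx => absurd hzx (h z hz)⟩

/-- At a boundary point where the normal derivative vanishes to order `k`, at most `k` pairwise
disjoint connected subsets of the interior nodal set accumulate. -/
theorem Collar.card_le_order (hC : Collar Ω Γ L δ) {v : ℂ → ℝ}
    (hv : ContDiff ℝ (⊤ : ℕ∞) v) (h0 : ∀ t : ℝ, v (Γ t) = 0) {p : ℝ} {k : ℕ}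
    (hz : ∀ j < k, (dirDeriv 1)^[j] (dirDeriv Complex.I (v ∘ Γ)) p = 0)
    (hk : (dirDeriv 1)^[k] (dirDeriv Complex.I (v ∘ Γ)) p ≠ 0) (A : Finset (Set ℂ))
    (hd : (A : Set (Set ℂ)).PairwiseDisjoint id)
    (hA : ∀ S ∈ A, IsPreconnected S ∧ (∀ x ∈ S, x ∈ Ω ∧ v x = 0) ∧ Γ p ∈ closure S) :
    A.card ≤ k := by
  have hFs : ContDiffOn ℝ (⊤ : ℕ∞) (v ∘ Γ) (strip δ) :=
    hv.comp_contDiffOn ((hC.diff.contDiffOn (isOpen_strip δ)).restrict_scalars ℝ)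
  obtain ⟨r, hr, ε₀, hε₀, hbox⟩ := exists_zero_box (isOpen_strip δ) hFs
    (fun t => upStrip_subset _ (hC.real_mem t)) h0 hz hk
  have hne : ∀ S ∈ A, ∃ x, x ∈ S := fun S hS => closure_nonempty_iff.1 ⟨_, (hA S hS).2.2⟩
  choose! x hx using hne
  choose h hh0 hh using fun S : Set ℂ => hC.exists_height (x S)
  obtain ⟨ε₁, hε₁, hle⟩ : ∃ ε₁ > 0, ∀ S ∈ A, ε₁ ≤ h S := by
    rcases A.eq_empty_or_nonempty with rfl | hAn
    · exact ⟨1, one_pos, by simp⟩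
    · obtain ⟨S, hS, he⟩ := A.exists_min_image h hAn
      exact ⟨h S, hh0 S, he⟩
  obtain ⟨ε, hε, hεm⟩ := exists_between (lt_min hε₁ (lt_min hε₀ hC.δ_pos))
  obtain ⟨e1, e2⟩ := lt_min_iff.1 hεm
  obtain ⟨e2, e3⟩ := lt_min_iff.1 e2
  obtain ⟨hside, hcard⟩ := hbox ε hε e2
  have htop : ∀ S ∈ A, ∃ s ∈ Icc (p - r) (p + r), Γ (s + ε * Complex.I) ∈ S := by
    intro S hS
    obtain ⟨h1, h2, h3⟩ := hA S hS
    exact hC.exists_mem_top h1 h2 hr hε e3 h3 hside (hx S hS) fun z hz hzx =>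
      e1.trans_le ((hle S hS).trans (hh S z hz hzx))
  choose! s hs hsS using htop
  have hinj : Set.InjOn s A := by
    intro S hS S' hS' he
    by_contra hne
    exact Set.disjoint_left.1 (hd hS hS' hne) (hsS S hS) (by rw [he]; exact hsS S' hS')
  rw [← Finset.card_image_of_injOn hinj]
  refine hcard _ fun t ht => ?_
  obtain ⟨S, hS, rfl⟩ := Finset.mem_image.1 ht
  exact ⟨hs S hS, ((hA S hS).2.1 _ (hsS S hS)).2⟩

end BoxCrossing

namespace HelmholtzPair

variable {Ω : Set ℂ} {Γ : ℂ → ℂ} {L δ : ℝ}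

theorem _root_.Collar.exists_real_mem_Ico (hC : Collar Ω Γ L δ) (s t : ℝ) :
    ∃ t' : ℝ, t' ∈ Ico s (s + L) ∧ Γ t' = Γ t := by
  obtain ⟨k, hk, -⟩ := existsUnique_add_zsmul_mem_Ico hC.L_pos t s
  refine ⟨t + k • L, hk, ?_⟩
  have := hC.per_int (upStrip_subset _ (hC.real_mem t)) k
  rw [← this]
  congr 1
  simp

theorem exists_neumann_card_le (hC : Collar Ω Γ L δ) :
    ∃ C > 0, ∀ lam > (0 : ℝ), ∀ v g, HelmholtzPair Ω (lam ^ 2 / 4) v g →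
      (∃ x ∈ closure Ω, v x ≠ 0) →
      (∀ t : ℝ, (starRingEnd ℂ) (g (Γ t) * deriv Γ t) = g (Γ t) * deriv Γ t) →
      ∀ A : Finset (Set ℂ), (A : Set (Set ℂ)).PairwiseDisjoint id →
        (∀ S ∈ A, ∃ t : ℝ, Γ t ∈ S ∧ v (Γ t) = 0) → (A.card : ℝ) ≤ C * (1 + lam) := by
  obtain ⟨C, hC0, hb⟩ := exists_neumann_bound hC
  refine ⟨C, hC0, fun lam hlam v g h hne hη A hd hA => ?_⟩
  obtain ⟨s, hb⟩ := hb lam hlam v g h hne hη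
  have hA' : ∀ S ∈ A, ∃ t : ℝ, t ∈ Ico s (s + L) ∧ Γ t ∈ S ∧ v (Γ t) = 0 := by
    intro S hS
    obtain ⟨t, ht, h0⟩ := hA S hS
    obtain ⟨t', ht', he⟩ := hC.exists_real_mem_Ico s t
    exact ⟨t', ht', by rwa [he], by rwa [he]⟩
  choose! t ht htS ht0 using hA'
  have hinj : Set.InjOn t A := by
    intro S hS S' hS' he
    by_contra hne
    exact Set.disjoint_left.1 (hd hS hS' hne) (htS S hS) (by rw [he]; exact htS S' hS')
  have := hb (A.image t) (by
    intro p hp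
    obtain ⟨S, hS, rfl⟩ := Finset.mem_image.1 hp
    exact ht S hS) (fun _ => 1) (by
    intro p hp j hj
    obtain ⟨S, hS, rfl⟩ := Finset.mem_image.1 hp
    rw [Nat.lt_one_iff.1 hj, iteratedDeriv_zero, ht0 S hS, Complex.ofReal_zero])
  simpa [Finset.card_image_of_injOn hinj] using this

theorem iteratedDeriv_normal {v : ℂ → ℝ} {g : ℂ → ℂ} {μ : ℝ} (h : HelmholtzPair Ω μ v g)
    (hC : Collar Ω Γ L δ) (hv : ContDiff ℝ (⊤ : ℕ∞) v)
    (hη : ∀ t : ℝ, (starRingEnd ℂ) (g (Γ t) * deriv Γ t) = -(g (Γ t) * deriv Γ t)) (j : ℕ) :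
    ∀ t : ℝ, iteratedDeriv j (fun t : ℝ => g (Γ t) * deriv Γ t) t =
      -(Complex.I / 2) * ((dirDeriv 1)^[j] (dirDeriv Complex.I (v ∘ Γ)) t : ℝ) := by
  have hFs : ContDiffOn ℝ (⊤ : ℕ∞) (v ∘ Γ) (strip δ) :=
    hv.comp_contDiffOn ((hC.diff.contDiffOn (isOpen_strip δ)).restrict_scalars ℝ)
  induction j with
  | zero =>
    intro t
    have hzs := upStrip_subset _ (hC.real_mem t)
    have h1 : HasDerivAt (fun τ : ℝ => (t : ℂ) + (τ : ℂ) * Complex.I) (1 * Complex.I) 0 :=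
      ((hasDerivAt_id ((0 : ℝ) : ℂ)).comp_ofReal.mul_const _).const_add _
    have h2 : HasDerivAt (fun τ : ℝ => Γ ((t : ℂ) + (τ : ℂ) * Complex.I))
        (deriv Γ t * (1 * Complex.I)) 0 := by
      refine HasDerivAt.comp (h₂ := Γ) (0 : ℝ) ?_ h1
      simpa using hC.hasDerivAt hzs
    have h3 := (h.hasFDerivAt_v (Γ ((t : ℂ) + ((0 : ℝ) : ℂ) * Complex.I))).comp_hasDerivAt
      (0 : ℝ) h2
    have h4 := (hasDerivAt_vertical (isOpen_strip δ) hFs (t : ℂ) (τ := 0)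
      (by simpa using hzs)).ofReal_comp
    have h5 := h3.unique h4
    have h6 := hη t
    simp only [Complex.ofReal_zero, zero_mul, add_zero, wirt_apply, map_mul, one_mul,
      Complex.conj_I] at h5 h6
    rw [iteratedDeriv_zero, Function.iterate_zero, id, ← h5]
    linear_combination (g (Γ t) * deriv Γ t) * Complex.I_mul_I - (Complex.I ^ 2 / 2) * h6
  | succ j ih =>
    intro t
    rw [iteratedDeriv_succ, funext ih]
    have := hasDerivAt_iterate (isOpen_strip δ) (hFs.dirDeriv (isOpen_strip δ) Complex.I) 0
      (s := t) (by simpa using upStrip_subset _ (hC.real_mem t)) j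
    simp only [add_zero] at this
    exact (this.ofReal_comp.const_mul _).deriv

theorem exists_dirichlet_card_le (hC : Collar Ω Γ L δ) :
    ∃ C > 0, ∀ lam > (0 : ℝ), ∀ v g, HelmholtzPair Ω (lam ^ 2 / 4) v g →
      ContDiff ℝ (⊤ : ℕ∞) v → (∃ x ∈ closure Ω, v x ≠ 0) → (∀ t : ℝ, v (Γ t) = 0) →
      ∀ A : Finset (Set ℂ), (A : Set (Set ℂ)).PairwiseDisjoint id →
        (∀ S ∈ A, IsPreconnected S ∧ (∀ x ∈ S, x ∈ Ω ∧ v x = 0) ∧ ∃ t : ℝ, Γ t ∈ closure S) →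
        (A.card : ℝ) ≤ C * (1 + lam) := by
  obtain ⟨C, hC0, hb⟩ := exists_dirichlet_bound hC
  refine ⟨C, hC0, fun lam hlam v g h hv hne ha A hd hA => ?_⟩
  obtain ⟨s, hb⟩ := hb lam hlam v g h hne ha
  have hη : ∀ t : ℝ, (starRingEnd ℂ) (g (Γ t) * deriv Γ t) = -(g (Γ t) * deriv Γ t) := by
    intro t
    have hd := h.hasDerivAt_trace hC t
    have hz : (fun t : ℝ => (v (Γ t) : ℂ)) = fun _ => 0 := by
      funext t
      rw [ha t, Complex.ofReal_zero]
    rw [hz] at hd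
    linear_combination hd.unique (hasDerivAt_const t (0 : ℂ))
  have hfin : ∀ p ∈ Ico s (s + L), ∃ k, iteratedDeriv k (fun t : ℝ => g (Γ t) * deriv Γ t) p ≠ 0 := by
    intro p hp
    by_contra! hcon
    obtain ⟨N, hN⟩ := exists_nat_gt (C * (1 + lam))
    have := hb {p} (by simpa using hp) (fun _ => N) (fun q hq j _ => by
      rw [Finset.mem_singleton.1 hq]
      exact hcon j)
    simp only [Finset.sum_singleton] at this
    linarith
  have hfin' : ∀ p ∈ Ico s (s + L), ∃ k,
      iteratedDeriv k (fun t : ℝ => g (Γ t) * deriv Γ t) p ≠ 0 ∧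
      ∀ j < k, iteratedDeriv j (fun t : ℝ => g (Γ t) * deriv Γ t) p = 0 := by
    classical
    intro p hp
    exact ⟨Nat.find (hfin p hp), Nat.find_spec (hfin p hp),
      fun j hj => not_not.1 (Nat.find_min (hfin p hp) hj)⟩
  choose! k hk hkz using hfin'
  have hA' : ∀ S ∈ A, ∃ t : ℝ, t ∈ Ico s (s + L) ∧ Γ t ∈ closure S := by
    intro S hS
    obtain ⟨t, ht⟩ := (hA S hS).2.2
    obtain ⟨t', ht', he⟩ := hC.exists_real_mem_Ico s t
    exact ⟨t', ht', by rwa [he]⟩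
  choose! t ht htS using hA'
  have hmem : ∀ p ∈ A.image t, p ∈ Ico s (s + L) := by
    intro p hp
    obtain ⟨S, hS, rfl⟩ := Finset.mem_image.1 hp
    exact ht S hS
  have hnorm := h.iteratedDeriv_normal hC hv hη
  have hfiber : ∀ p ∈ A.image t, (A.filter fun S => t S = p).card ≤ k p := by
    intro p hp
    refine hC.card_le_order hv ha (p := p) ?_ ?_ _ (hd.subset (Finset.filter_subset _ _)) ?_
    · intro j hj
      have := hkz p (hmem p hp) j hj
      rw [hnorm] at this
      simpa [Complex.I_ne_zero] using this
    · intro h0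
      refine hk p (hmem p hp) ?_
      rw [hnorm, h0, Complex.ofReal_zero, mul_zero]
    · intro S hS
      obtain ⟨hSA, rfl⟩ := Finset.mem_filter.1 hS
      exact ⟨(hA S hSA).1, (hA S hSA).2.1, htS S hSA⟩
  calc (A.card : ℝ) = ∑ p ∈ A.image t, ((A.filter fun S => t S = p).card : ℝ) := by
        exact_mod_cast Finset.card_eq_sum_card_image t A
    _ ≤ ∑ p ∈ A.image t, (k p : ℝ) := Finset.sum_le_sum fun p hp => by
        exact_mod_cast hfiber p hp
    _ ≤ C * (1 + lam) := hb _ hmem k fun p hp => hkz p (hmem p hp)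

end HelmholtzPair

theorem AnalyticAt.exists_local_extension {γ : ℝ → ℂ} {x : ℝ} (h : AnalyticAt ℝ γ x) :
    ∃ r > 0, ∃ G : ℂ → ℂ, DifferentiableOn ℂ G (Metric.ball x r) ∧
      ∀ t : ℝ, (t : ℂ) ∈ Metric.ball (x : ℂ) r → γ t = G t := by
  obtain ⟨p, R, hp⟩ := h
  obtain ⟨r, hr0, hrR⟩ := ENNReal.lt_iff_exists_nnreal_btwn.1 hp.r_pos
  have hr0' : (0 : ℝ) < r := by exact_mod_cast hr0
  refine ⟨r, hr0', fun z => ∑' n, (z - x) ^ n * p.coeff n, ?_, ?_⟩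
  · refine Complex.differentiableOn_tsum_of_summable_norm
      (p.summable_norm_mul_pow (hrR.trans_le hp.r_le)) (fun n => by fun_prop) Metric.isOpen_ball ?_
    intro n w hw
    rw [norm_mul, norm_pow, mul_comm, p.norm_apply_eq_norm_coef]
    rw [Metric.mem_ball, dist_eq_norm] at hw
    gcongr
  · intro t ht
    rw [Metric.mem_ball, dist_eq_norm, ← Complex.ofReal_sub, Complex.norm_real] at ht
    have := hp.hasSum (y := t - x) (by
      rw [Metric.mem_eball, edist_zero_right]
      refine lt_of_lt_of_le ?_ hrR.le
      rw [enorm_eq_nnnorm]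
      exact_mod_cast ht)
    rw [add_sub_cancel] at this
    rw [← this.tsum_eq]
    refine tsum_congr fun n => ?_
    rw [p.apply_eq_pow_smul_coeff, Complex.real_smul]
    push_cast
    rfl

/-- The holomorphic extension of a real-analytic function, given by its Taylor series. -/
noncomputable def taylorExtension (γ : ℝ → ℂ) (z : ℂ) : ℂ :=
  ∑' n : ℕ, (n.factorial : ℂ)⁻¹ • (z - z.re) ^ n • iteratedDeriv n γ z.re

theorem taylorExtension_eventuallyEq {γ : ℝ → ℂ} {x : ℝ} (h : AnalyticAt ℝ γ x) :
    AnalyticAt ℂ (taylorExtension γ) x ∧ taylorExtension γ x = γ x := by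
  obtain ⟨r, hr, G, hG, hGγ⟩ := h.exists_local_extension
  have hev : taylorExtension γ =ᶠ[𝓝 (x : ℂ)] G := by
    filter_upwards [Metric.ball_mem_nhds (x : ℂ) (half_pos hr)] with z hz
    rw [Metric.mem_ball, dist_eq_norm] at hz
    have h1 := (Complex.abs_re_le_norm (z - x)).trans_lt hz
    have h2 := (Complex.abs_im_le_norm (z - x)).trans_lt hz
    rw [Complex.sub_re, Complex.ofReal_re] at h1
    rw [Complex.sub_im, Complex.ofReal_im, sub_zero] at h2
    have hre : ((z.re : ℝ) : ℂ) ∈ Metric.ball (x : ℂ) r := by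
      rw [Metric.mem_ball, dist_eq_norm, ← Complex.ofReal_sub, Complex.norm_real, Real.norm_eq_abs]
      linarith
    have hsub : Metric.ball ((z.re : ℝ) : ℂ) (r / 2) ⊆ Metric.ball (x : ℂ) r := by
      refine Metric.ball_subset_ball' ?_
      rw [dist_eq_norm, ← Complex.ofReal_sub, Complex.norm_real, Real.norm_eq_abs]
      linarith
    have hz' : z ∈ Metric.ball ((z.re : ℝ) : ℂ) (r / 2) := by
      rw [Metric.mem_ball, dist_eq_norm]
      have : z - (z.re : ℝ) = z.im * Complex.I := by
        linear_combination -(Complex.re_add_im z)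
      rwa [this, norm_mul, Complex.norm_I, mul_one, Complex.norm_real]
    rw [← Complex.taylorSeries_eq_on_ball (hG.mono hsub) hz', taylorExtension]
    refine tsum_congr fun n => ?_
    rw [iteratedDeriv_eq_of_eqOn_real Metric.isOpen_ball hG hGγ n _ hre]
  refine ⟨(hG.analyticAt (Metric.ball_mem_nhds _ hr)).congr hev.symm, ?_⟩
  rw [hev.eq_of_nhds, hGγ x (Metric.mem_ball_self hr)]

theorem taylorExtension_add_period {γ : ℝ → ℂ} {L : ℝ} (h : ∀ t, γ (t + L) = γ t) (z : ℂ) :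
    taylorExtension γ (z + L) = taylorExtension γ z := by
  have hp : ∀ n, iteratedDeriv n γ (z.re + L) = iteratedDeriv n γ z.re := fun n => by
    have := iteratedDeriv_comp_add_const n γ L
    have h' : (fun t => γ (t + L)) = γ := funext h
    rw [h'] at this
    exact (congrFun this z.re).symm
  rw [taylorExtension, taylorExtension]
  refine tsum_congr fun n => ?_
  simp only [Complex.add_re, Complex.ofReal_re, hp]
  push_cast
  rw [add_sub_add_right_eq_sub]

theorem norm_sub_re (z : ℂ) : ‖z - (z.re : ℂ)‖ = |z.im| := by
  have : z - (z.re : ℂ) = z.im * Complex.I := by linear_combination -(Complex.re_add_im z)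
  rw [this, norm_mul, Complex.norm_I, mul_one, Complex.norm_real, Real.norm_eq_abs]

theorem exists_int_mul_re_mem {L : ℝ} (hL : 0 < L) (z : ℂ) :
    ∃ k : ℤ, (z + k * L).re ∈ Icc 0 L ∧ (z + k * L).im = z.im := by
  obtain ⟨k, hk, -⟩ := existsUnique_add_zsmul_mem_Ico hL z.re 0
  refine ⟨k, ?_, by simp⟩
  have := Ico_subset_Icc_self hk
  simpa using this

theorem exists_strip_of_analyticAt {Γ : ℂ → ℂ} {L : ℝ} (hL : 0 < L)
    (hper : Function.Periodic Γ (L : ℂ)) (ha : ∀ t : ℝ, AnalyticAt ℂ Γ t)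
    (hd : ∀ t : ℝ, deriv Γ t ≠ 0) :
    ∃ δ > 0, ∀ z ∈ strip δ, AnalyticAt ℂ Γ z ∧ deriv Γ z ≠ 0 := by
  set U : Set ℂ := {z | ∀ᶠ w in 𝓝 z, AnalyticAt ℂ Γ w ∧ deriv Γ w ≠ 0} with hU
  have hUo : IsOpen U := isOpen_setOfPred_eventually_nhds
  have hK : IsCompact ((fun t : ℝ => (t : ℂ)) '' Icc 0 L) :=
    isCompact_Icc.image Complex.continuous_ofReal
  obtain ⟨δ, hδ, hδU⟩ := hK.exists_thickening_subset_open hUo (by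
    rintro _ ⟨t, -, rfl⟩
    exact (ha t).eventually_analyticAt.and ((ha t).deriv.continuousAt.eventually_ne (hd t)))
  refine ⟨δ, hδ, fun z hz => ?_⟩
  obtain ⟨k, hk, him⟩ := exists_int_mul_re_mem hL z
  have hmem : z + k * L ∈ U := hδU (Metric.mem_thickening_iff.2 ⟨_, ⟨_, hk, rfl⟩, by
    rw [dist_eq_norm, norm_sub_re, him]; exact hz⟩)
  have hsh : (fun w => Γ (w + k * L)) = Γ := funext (hper.int_mul k)
  obtain ⟨h1, h2⟩ := hmem.self_of_nhds
  constructor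
  · rw [← hsh]
    exact AnalyticAt.fun_comp (f := fun w : ℂ => w + k * L) h1 (by fun_prop)
  · rwa [← hsh, deriv_comp_add_const]

theorem exists_strip_inj {Γ : ℂ → ℂ} {L : ℝ} (hL : 0 < L)
    (hper : Function.Periodic Γ (L : ℂ)) (ha : ∀ t : ℝ, AnalyticAt ℂ Γ t)
    (hd : ∀ t : ℝ, deriv Γ t ≠ 0)
    (hinj : ∀ s t : ℝ, Γ s = Γ t → ∃ k : ℤ, t = s + k * L) :
    ∃ δ > 0, ∀ z ∈ strip δ, ∀ w ∈ strip δ, Γ z = Γ w → ∃ k : ℤ, w = z + k * L := by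
  set V : Set (ℂ × ℂ) :=
    {p | ∀ᶠ q : ℂ × ℂ in 𝓝 p, Γ q.1 = Γ q.2 → ∃ k : ℤ, q.2 = q.1 + k * L} with hV
  have hVo : IsOpen V := isOpen_setOfPred_eventually_nhds
  have hK : IsCompact ((fun p : ℝ × ℝ => ((p.1 : ℂ), (p.2 : ℂ))) '' (Icc 0 L ×ˢ Icc 0 L)) :=
    (isCompact_Icc.prod isCompact_Icc).image (by fun_prop)
  have hreal : ∀ s t : ℝ, ((s : ℂ), (t : ℂ)) ∈ V := by
    intro s t
    by_cases h : Γ s = Γ t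
    · obtain ⟨k, hk⟩ := hinj s t h
      have hs := (ha s).hasStrictDerivAt.hasStrictFDerivAt_equiv (hd s)
      set e := hs.toOpenPartialHomeomorph Γ with he
      have hse : (s : ℂ) ∈ e.source := hs.mem_toOpenPartialHomeomorph_source
      have hc1 : ∀ᶠ q : ℂ × ℂ in 𝓝 ((s : ℂ), (t : ℂ)), q.1 ∈ e.source :=
        continuous_fst.continuousAt (e.open_source.mem_nhds hse)
      have hc2 : ∀ᶠ q : ℂ × ℂ in 𝓝 ((s : ℂ), (t : ℂ)), q.2 - k * L ∈ e.source := by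
        have : Continuous fun q : ℂ × ℂ => q.2 - k * L := by fun_prop
        refine this.continuousAt (e.open_source.mem_nhds ?_)
        have : (t : ℂ) - k * L = s := by rw [hk]; push_cast; ring
        rwa [this]
      filter_upwards [hc1, hc2] with q h1 h2 hq
      have h3 : Γ (q.2 - k * L) = Γ q.2 := hper.sub_int_mul_eq k
      refine ⟨k, ?_⟩
      have := e.injOn h1 h2 (by
        rw [he, hs.toOpenPartialHomeomorph_coe, h3, hq])
      rw [this, sub_add_cancel]
    · have h1 : Tendsto (fun q : ℂ × ℂ => Γ q.1) (𝓝 ((s : ℂ), (t : ℂ))) (𝓝 (Γ s)) :=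
        (ha s).continuousAt.tendsto.comp continuous_fst.continuousAt
      have h2 : Tendsto (fun q : ℂ × ℂ => Γ q.2) (𝓝 ((s : ℂ), (t : ℂ))) (𝓝 (Γ t)) :=
        (ha t).continuousAt.tendsto.comp continuous_snd.continuousAt
      filter_upwards [(h1.sub h2).eventually_ne (sub_ne_zero.2 h)] with q hq hq'
      exact absurd (sub_eq_zero.2 hq') hq
  obtain ⟨δ, hδ, hδV⟩ := hK.exists_thickening_subset_open hVo (by
    rintro _ ⟨p, -, rfl⟩
    exact hreal _ _)
  refine ⟨δ, hδ, fun z hz w hw h => ?_⟩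
  obtain ⟨k, hk, hki⟩ := exists_int_mul_re_mem hL z
  obtain ⟨m, hm, hmi⟩ := exists_int_mul_re_mem hL w
  have hmem : ((z + k * L, w + m * L) : ℂ × ℂ) ∈ V :=
    hδV (Metric.mem_thickening_iff.2
      ⟨_, ⟨((z + k * L).re, (w + m * L).re), ⟨hk, hm⟩, rfl⟩, by
      rw [Prod.dist_eq, dist_eq_norm, dist_eq_norm]
      refine max_lt ?_ ?_
      · exact (norm_sub_re _).trans_lt (hki ▸ hz)
      · exact (norm_sub_re _).trans_lt (hmi ▸ hw)⟩)
  obtain ⟨j, hj⟩ := hmem.self_of_nhds (by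
    simp only
    rw [hper.int_mul k z, hper.int_mul m w, h])
  refine ⟨k + j - m, ?_⟩
  simp only at hj
  push_cast
  linear_combination hj

/-- The complexification of a closed real-analytic Jordan curve. -/
theorem exists_complexification {γ : ℝ → ℂ} {L : ℝ} (hL : 0 < L) (ha : ∀ t, AnalyticAt ℝ γ t)
    (hper : ∀ t, γ (t + L) = γ t) (hd : ∀ t, deriv γ t ≠ 0)
    (hinj : ∀ s t, γ s = γ t → ∃ k : ℤ, t = s + k * L) :
    ∃ Γ : ℂ → ℂ, ∃ δ > 0, DifferentiableOn ℂ Γ (strip δ) ∧ Function.Periodic Γ (L : ℂ) ∧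
      (∀ z ∈ strip δ, ∀ w ∈ strip δ, Γ z = Γ w → ∃ k : ℤ, w = z + k * L) ∧
      (∀ z ∈ strip δ, deriv Γ z ≠ 0) ∧ (∃ K, ∀ z ∈ strip δ, ‖deriv Γ z‖ ≤ K) ∧
      (∀ t : ℝ, Γ t = γ t) ∧ ∀ t : ℝ, deriv Γ t = deriv γ t := by
  set Γ := taylorExtension γ with hΓ
  have hΓa : ∀ t : ℝ, AnalyticAt ℂ Γ t := fun t => (taylorExtension_eventuallyEq (ha t)).1
  have hΓγ : ∀ t : ℝ, Γ t = γ t := fun t => (taylorExtension_eventuallyEq (ha t)).2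
  have hΓp : Function.Periodic Γ (L : ℂ) := taylorExtension_add_period hper
  have hΓd : ∀ t : ℝ, deriv Γ t = deriv γ t := by
    intro t
    have := (hΓa t).differentiableAt.hasDerivAt.comp_ofReal
    simp only [hΓγ] at this
    exact this.deriv.symm
  obtain ⟨δ₁, hδ₁, h₁⟩ := exists_strip_of_analyticAt hL hΓp hΓa (fun t => by rw [hΓd]; exact hd t)
  obtain ⟨δ₂, hδ₂, h₂⟩ := exists_strip_inj hL hΓp hΓa (fun t => by rw [hΓd]; exact hd t)
    (fun s t h => hinj s t (by rwa [hΓγ, hΓγ] at h))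
  obtain ⟨δ, hδ, hlt⟩ := exists_between (lt_min hδ₁ hδ₂)
  obtain ⟨e1, e2⟩ := lt_min_iff.1 hlt
  have s1 : strip δ ⊆ strip δ₁ := fun z hz => lt_trans hz e1
  have s2 : strip δ ⊆ strip δ₂ := fun z hz => lt_trans hz e2
  refine ⟨Γ, δ, hδ, fun z hz => (h₁ z (s1 hz)).1.differentiableAt.differentiableWithinAt, hΓp,
    fun z hz w hw => h₂ z (s2 hz) w (s2 hw), fun z hz => (h₁ z (s1 hz)).2, ?_, hΓγ, hΓd⟩
  have hK : IsCompact (Icc 0 L ×ℂ Icc (-δ) δ) := isCompact_Icc.reProdIm isCompact_Icc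
  have hKs : Icc 0 L ×ℂ Icc (-δ) δ ⊆ strip δ₁ := fun z hz => (abs_le.2 hz.2).trans_lt e1
  obtain ⟨K, hKb⟩ := hK.exists_bound_of_continuousOn (f := deriv Γ)
    fun z hz => (h₁ z (hKs hz)).1.deriv.continuousAt.continuousWithinAt
  refine ⟨K, fun z hz => ?_⟩
  obtain ⟨k, hk, hki⟩ := exists_int_mul_re_mem hL z
  have hsh : (fun w => Γ (w + k * L)) = Γ := funext (hΓp.int_mul k)
  rw [← hsh, deriv_comp_add_const]
  exact hKb _ ⟨hk, by rw [mem_preimage, hki]; exact abs_le.1 (le_of_lt hz)⟩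

theorem IsPreconnected.subset_or_subset_compl_closure {X : Type*} [TopologicalSpace X]
    {Ω A : Set X} (hA : IsPreconnected A) (hΩ : IsOpen Ω) (hd : Disjoint A (frontier Ω)) :
    A ⊆ Ω ∨ A ⊆ (closure Ω)ᶜ := by
  refine hA.subset_or_subset hΩ isClosed_closure.isOpen_compl
    (disjoint_compl_right.mono_left subset_closure) fun x hx => ?_
  by_contra h
  rw [mem_union, not_or, mem_compl_iff, not_not] at h
  exact hd.notMem_of_mem_left hx ⟨h.2, by rw [hΩ.interior_eq]; exact h.1⟩

theorem isOpen_image_of_deriv_ne {Γ : ℂ → ℂ} {U : Set ℂ} (hU : IsOpen U)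
    (hd : DifferentiableOn ℂ Γ U) (h0 : ∀ z ∈ U, deriv Γ z ≠ 0) : IsOpen (Γ '' U) := by
  rw [isOpen_iff_mem_nhds]
  rintro _ ⟨z, hz, rfl⟩
  have hs : HasStrictDerivAt Γ (deriv Γ z) z :=
    ((hd.analyticAt (hU.mem_nhds hz)).contDiffAt (n := 1)).hasStrictDerivAt (by norm_num)
  rw [← hs.map_nhds_eq (h0 z hz)]
  exact image_mem_map (hU.mem_nhds hz)

/-- A bounded open set whose boundary is a closed analytic Jordan curve lies on exactly one side
of that curve. -/
theorem mapsTo_sides {Ω : Set ℂ} (hΩo : IsOpen Ω) (hΩb : Bornology.IsBounded Ω) {Γ : ℂ → ℂ}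
    {L δ : ℝ} (hδ : 0 < δ) (hd : DifferentiableOn ℂ Γ (strip δ))
    (hinj : ∀ z ∈ strip δ, ∀ w ∈ strip δ, Γ z = Γ w → ∃ k : ℤ, w = z + k * L)
    (h0 : ∀ z ∈ strip δ, deriv Γ z ≠ 0) (hfr : frontier Ω = Γ '' {z | z.im = 0}) :
    ((∀ z ∈ upStripInt δ, Γ z ∈ Ω) ∧ ∀ z : ℂ, -δ < z.im → z.im < 0 → Γ z ∉ closure Ω) ∨
    ((∀ z : ℂ, -δ < z.im → z.im < 0 → Γ z ∈ Ω) ∧ ∀ z ∈ upStripInt δ, Γ z ∉ closure Ω) := by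
  set D : Set ℂ := {z | -δ < z.im} ∩ {z | z.im < 0} with hD
  have hus : upStripInt δ ⊆ strip δ := (upStripInt_subset δ).trans (upStrip_subset δ)
  have hds : D ⊆ strip δ := fun z hz => abs_lt.2 ⟨hz.1, lt_trans hz.2 hδ⟩
  have hdc : Convex ℝ D := (convex_halfSpace_im_gt _).inter (convex_halfSpace_im_lt _)
  have hdisj : ∀ A ⊆ strip δ, (∀ z ∈ A, z.im ≠ 0) → Disjoint (Γ '' A) (frontier Ω) := by
    intro A hA hA0
    rw [hfr, disjoint_left]
    rintro _ ⟨z, hz, rfl⟩ ⟨w, hw, hwz⟩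
    have hw' : w.im = 0 := hw
    obtain ⟨k, hk⟩ := hinj w (by simp [strip, hw', hδ]) z (hA hz) hwz
    exact hA0 z hz (by simp [hk, hw'])
  have hside : ∀ A ⊆ strip δ, Convex ℝ A → (∀ z ∈ A, z.im ≠ 0) →
      Γ '' A ⊆ Ω ∨ Γ '' A ⊆ (closure Ω)ᶜ := fun A hA hAc hA0 =>
    (hAc.isPreconnected.image Γ (hd.continuousOn.mono hA)).subset_or_subset_compl_closure hΩo
      (hdisj A hA hA0)
  have hopen := isOpen_image_of_deriv_ne (isOpen_strip δ) hd h0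
  have h0s : (0 : ℂ) ∈ strip δ := by simp [strip, hδ]
  have h0f : Γ 0 ∈ frontier Ω := by rw [hfr]; exact ⟨0, by simp, rfl⟩
  have htri : ∀ z ∈ strip δ, z ∈ upStripInt δ ∨ z.im = 0 ∨ z ∈ D := by
    intro z hz
    obtain ⟨h1, h2⟩ := abs_lt.1 (show |z.im| < δ from hz)
    rcases lt_trichotomy z.im 0 with h | h | h
    · exact Or.inr (Or.inr ⟨h1, h⟩)
    · exact Or.inr (Or.inl h)
    · exact Or.inl ⟨h, h2⟩
  rcases hside _ hus (convex_upStripInt δ) (fun z hz => hz.1.ne') with hu | hu <;>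
    rcases hside D hds hdc (fun z hz => (show z.im < 0 from hz.2).ne) with hl | hl
  · exfalso
    have hsub : Γ '' strip δ ⊆ closure Ω := by
      rintro _ ⟨z, hz, rfl⟩
      rcases htri z hz with h | h | h
      · exact subset_closure (hu ⟨z, h, rfl⟩)
      · exact frontier_subset_closure (by rw [hfr]; exact ⟨z, h, rfl⟩)
      · exact subset_closure (hl ⟨z, h, rfl⟩)
    have heq : closure Ω = Ω ∪ Γ '' strip δ := by
      apply Subset.antisymm
      · rw [closure_eq_self_union_frontier, hfr]
        refine union_subset_union_right _ (image_mono fun z hz => ?_)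
        simp [strip, (show z.im = 0 from hz), hδ]
      · exact union_subset subset_closure hsub
    have hclopen : IsClopen (closure Ω) := ⟨isClosed_closure, by
      rw [heq]; exact hΩo.union hopen⟩
    have huniv := hclopen.eq_univ ⟨_, frontier_subset_closure h0f⟩
    exact NormedSpace.unbounded_univ ℝ ℂ (huniv ▸ hΩb.closure)
  · exact Or.inl ⟨fun z hz => hu ⟨z, hz, rfl⟩, fun z h1 h2 => hl ⟨z, ⟨h1, h2⟩, rfl⟩⟩
  · exact Or.inr ⟨fun z h1 h2 => hl ⟨z, ⟨h1, h2⟩, rfl⟩, fun z hz => hu ⟨z, hz, rfl⟩⟩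
  · exfalso
    obtain ⟨_, ⟨z, hz, rfl⟩, hzΩ⟩ := mem_closure_iff.1 (frontier_subset_closure h0f) _ hopen
      ⟨0, h0s, rfl⟩
    rcases htri z hz with h | h | h
    · exact hu ⟨z, h, rfl⟩ (subset_closure hzΩ)
    · have : Γ z ∈ frontier Ω := by rw [hfr]; exact ⟨z, h, rfl⟩
      rw [hΩo.frontier_eq] at this
      exact this.2 hzΩ
    · exact hl ⟨z, h, rfl⟩ (subset_closure hzΩ)

theorem exists_int_of_injOn_Ico {X : Type*} {γ : ℝ → X} {L : ℝ} (hL : 0 < L)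
    (hper : ∀ t, γ (t + L) = γ t) (hinj : InjOn γ (Ico 0 L)) {s t : ℝ} (h : γ s = γ t) :
    ∃ k : ℤ, t = s + k * L := by
  have hp : Function.Periodic γ L := hper
  obtain ⟨k, hk, -⟩ := existsUnique_add_zsmul_mem_Ico hL s 0
  obtain ⟨m, hm, -⟩ := existsUnique_add_zsmul_mem_Ico hL t 0
  rw [zero_add, zsmul_eq_mul] at hk hm
  have := hinj hk hm (by rw [hp.int_mul k s, hp.int_mul m t, h])
  exact ⟨k - m, by push_cast; linear_combination -this⟩

/-- A bounded open set whose boundary is a closed analytic Jordan curve has a holomorphic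
collar. -/
theorem exists_collar {Ω : Set ℂ} (hΩo : IsOpen Ω) (hΩb : Bornology.IsBounded Ω) {γ : ℝ → ℂ}
    {L : ℝ} (hL : 0 < L) (ha : ∀ t, AnalyticAt ℝ γ t) (hper : ∀ t, γ (t + L) = γ t)
    (hd : ∀ t, deriv γ t ≠ 0) (hinj : InjOn γ (Ico 0 L)) (himg : γ '' Ico 0 L = frontier Ω) :
    ∃ Γ δ, Collar Ω Γ L δ ∧
      ∀ t : ℝ, ∃ t', Γ t = γ t' ∧ ∃ c : ℝ, deriv Γ t = c * deriv γ t' := by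
  obtain ⟨Γ, δ, hδ, hΓd, hΓp, hΓi, hΓ0, ⟨K, hK⟩, hΓγ, hΓγ'⟩ := exists_complexification hL ha hper hd
    (fun s t h => exists_int_of_injOn_Ico hL hper hinj h)
  have hp : Function.Periodic γ L := hper
  have hfr : frontier Ω = Γ '' {z | z.im = 0} := by
    rw [← himg]
    apply Subset.antisymm
    · rintro _ ⟨t, -, rfl⟩
      exact ⟨t, by simp, hΓγ t⟩
    · rintro _ ⟨z, hz, rfl⟩
      obtain ⟨k, hk, -⟩ := existsUnique_add_zsmul_mem_Ico hL z.re 0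
      rw [zero_add, zsmul_eq_mul] at hk
      refine ⟨_, hk, ?_⟩
      rw [hp.int_mul k, ← hΓγ]
      congr 1
      exact Complex.ext (by simp) (by simpa using (show z.im = 0 from hz).symm)
  rcases mapsTo_sides hΩo hΩb hδ hΓd hΓi hΓ0 hfr with ⟨h1, h2⟩ | ⟨h1, h2⟩
  · refine ⟨Γ, δ, ⟨hΩo, hΩb, hL, hδ, hΓd, fun z _ => hΓp z, hΓi, hΓ0, ⟨K, hK⟩, hfr, h1, h2⟩,
      fun t => ⟨t, hΓγ t, 1, by rw [hΓγ' t]; simp⟩⟩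
  · have hneg : ∀ z ∈ strip δ, -z ∈ strip δ := fun z hz => by simpa [strip] using hz
    have hder : ∀ z, deriv (fun w => Γ (-w)) z = -deriv Γ (-z) := fun z => deriv_comp_neg Γ z
    refine ⟨fun z => Γ (-z), δ, ⟨hΩo, hΩb, hL, hδ, hΓd.comp (by fun_prop) hneg, ?_, ?_, ?_, ?_,
      ?_, ?_, ?_⟩, fun t => ⟨-t, ?_, -1, ?_⟩⟩
    · intro z _
      rw [← hΓp (-(z + L))]
      congr 1; ring
    · intro z hz w hw h
      obtain ⟨k, hk⟩ := hΓi _ (hneg z hz) _ (hneg w hw) h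
      exact ⟨-k, by push_cast; linear_combination -hk⟩
    · intro z hz
      rw [hder]
      exact neg_ne_zero.2 (hΓ0 _ (hneg z hz))
    · refine ⟨K, fun z hz => ?_⟩
      rw [hder, norm_neg]
      exact hK _ (hneg z hz)
    · rw [hfr]
      ext x
      constructor
      · rintro ⟨z, hz, rfl⟩
        exact ⟨-z, by simpa using hz, by simp⟩
      · rintro ⟨z, hz, rfl⟩
        exact ⟨-z, by simpa using hz, rfl⟩
    · intro z hz
      exact h1 _ (by simpa using hz.2) (by simpa using hz.1)
    · intro z hz1 hz2
      exact h2 _ ⟨by simpa using hz2, by simp only [Complex.neg_im]; linarith⟩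
    · rw [← hΓγ]; push_cast; rfl
    · rw [hder, ← hΓγ' (-t)]; push_cast; ring

theorem exists_contDiff_eventuallyEq {E : Type*} [NormedAddCommGroup E] [NormedSpace ℝ E]
    [FiniteDimensional ℝ E] {K U : Set E} (hK : IsClosed K) (hU : IsOpen U) (hKU : K ⊆ U)
    {φ : E → ℝ} (hφ : ContDiffOn ℝ (⊤ : ℕ∞) φ U) :
    ∃ f : E → ℝ, ContDiff ℝ (⊤ : ℕ∞) f ∧ ∀ x ∈ K, f =ᶠ[𝓝 x] φ := by
  obtain ⟨V, hVo, hKV, hVU⟩ := normal_exists_closure_subset hK hU hKU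
  obtain ⟨χ, h0, h1, -⟩ := exists_contMDiffMap_zero_one_nhds_of_isClosed (n := (⊤ : ℕ∞))
    (modelWithCornersSelf ℝ E) hVo.isClosed_compl hK
    (disjoint_compl_left_iff_subset.2 hKV)
  have hχ : ContDiff ℝ (⊤ : ℕ∞) χ := χ.contMDiff.contDiff
  refine ⟨fun x => χ x * φ x, contDiff_iff_contDiffAt.2 fun x => ?_, fun x hx => ?_⟩
  · by_cases hx : x ∈ U
    · exact hχ.contDiffAt.mul (hφ.contDiffAt (hU.mem_nhds hx))
    · refine (contDiffAt_const (c := (0 : ℝ))).congr_of_eventuallyEq ?_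
      have : (closure V)ᶜ ∈ 𝓝 x := isClosed_closure.isOpen_compl.mem_nhds fun h => hx (hVU h)
      filter_upwards [this] with y hy
      rw [(eventually_nhdsSet_iff_forall.1 h0 y fun h => hy (subset_closure h)).self_of_nhds,
        zero_mul]
  · filter_upwards [eventually_nhdsSet_iff_forall.1 h1 x hx] with y hy
    rw [hy, one_mul]

/-- The Wirtinger derivative of a real function on the plane. -/
noncomputable def wirtDeriv (v : ℂ → ℝ) (z : ℂ) : ℂ :=
  (fderiv ℝ v z 1 - fderiv ℝ v z Complex.I * Complex.I) / 2

theorem fderiv_apply_eq_re_add_im (B : ℂ →L[ℝ] ℝ) (h : ℂ) :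
    B h = h.re * B 1 + h.im * B Complex.I := by
  have : h = h.re • (1 : ℂ) + h.im • Complex.I := by simp
  conv_lhs => rw [this]
  simp only [map_add, map_smul, smul_eq_mul]

theorem wirtDeriv_mul (v : ℂ → ℝ) (z h : ℂ) :
    wirtDeriv v z * h = (fderiv ℝ v z h - fderiv ℝ v z (Complex.I * h) * Complex.I) / 2 := by
  rw [wirtDeriv, fderiv_apply_eq_re_add_im _ h, fderiv_apply_eq_re_add_im _ (Complex.I * h)]
  apply Complex.ext <;> simp <;> ring

theorem helmholtzPair_wirtDeriv {Ω : Set ℂ} {v : ℂ → ℝ} {lam : ℝ} (hv : ContDiff ℝ (⊤ : ℕ∞) v)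
    (hlap : ∀ x ∈ Ω, fderiv ℝ (fun y => fderiv ℝ v y 1) x 1 +
      fderiv ℝ (fun y => fderiv ℝ v y Complex.I) x Complex.I = -lam ^ 2 * v x) :
    HelmholtzPair Ω (lam ^ 2 / 4) v (wirtDeriv v) := by
  have hd : ContDiff ℝ 1 (fderiv ℝ v) := 
    hv.fderiv_right (WithTop.coe_le_coe.2 (le_top (a := (2 : ℕ∞))))
  have hd' : ∀ w, ContDiff ℝ 1 fun y => fderiv ℝ v y w := fun w => hd.clm_apply contDiff_const
  have hv1 : ContDiff ℝ 1 v := hv.of_le (by exact_mod_cast le_top)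
  refine ⟨hv1, ?_, fun x => ?_, fun x hx => ?_⟩
  · unfold wirtDeriv
    have := fun w => Complex.ofRealCLM.contDiff.comp (hd' w)
    exact ((this 1).sub ((this Complex.I).mul contDiff_const)).div_const 2
  · have h1 := Complex.ofRealCLM.hasFDerivAt.comp x (hv1.differentiable one_ne_zero x).hasFDerivAt
    refine h1.congr_fderiv (wirt_ext fun h => ?_)
    simp only [ContinuousLinearMap.comp_apply, Complex.ofRealCLM_apply]
    rw [← map_mul, Complex.add_conj, wirtDeriv_mul]
    simp [mul_div_cancel₀]
  · set D : ℂ → ℂ →L[ℝ] ℝ := fun w => fderiv ℝ (fun y => fderiv ℝ v y w) x with hD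
    have hDw : ∀ w, HasFDerivAt (fun y => ((fderiv ℝ v y w : ℝ) : ℂ))
        (Complex.ofRealCLM ∘L D w) x := fun w =>
      Complex.ofRealCLM.hasFDerivAt.comp x ((hd' w).differentiable one_ne_zero x).hasFDerivAt
    have hsym : D 1 Complex.I = D Complex.I 1 := by
      have hs := (hv.contDiffAt (x := x)).isSymmSndFDerivAt
        (by simpa using WithTop.coe_le_coe.2 (le_top (a := (2 : ℕ∞))))
      have hDe : ∀ w h, D w h = fderiv ℝ (fderiv ℝ v) x h w := fun w h => by
        have := ((hd.differentiable one_ne_zero x).hasFDerivAt.clm_apply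
          (hasFDerivAt_const w x)).fderiv
        simp only [hD]
        rw [this]; simp
      rw [hDe, hDe]
      exact hs _ _
    have hl := hlap x hx
    set a : ℂ := (((D 1 1 - D Complex.I Complex.I : ℝ) : ℂ) -
      (2 * D 1 Complex.I : ℝ) * Complex.I) / 4 with ha
    have h1 := ((hDw 1).sub ((hDw Complex.I).mul_const Complex.I)).mul_const (1 / 2)
    have h2 : HasFDerivAt (wirtDeriv v) _ x :=
      h1.congr_of_eventuallyEq (Eventually.of_forall fun y => by
        simp only [wirtDeriv, Pi.sub_apply]; ring)
    refine ⟨a, h2.congr_fderiv (wirt_ext fun h => ?_)⟩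
    have hl' : D 1 1 + D Complex.I Complex.I = -lam ^ 2 * v x := hl
    have hc : (-((lam ^ 2 / 4 : ℝ) : ℂ) * (v x : ℂ)) =
        ((D 1 1 + D Complex.I Complex.I : ℝ) : ℂ) / 4 := by
      rw [hl']; push_cast; ring
    rw [hc, ha]
    simp only [sub_apply, smul_apply, ContinuousLinearMap.comp_apply,
      Complex.ofRealCLM_apply]
    rw [fderiv_apply_eq_re_add_im (D 1) h, fderiv_apply_eq_re_add_im (D Complex.I) h, hsym]
    apply Complex.ext <;> simp <;> ring

theorem pairwiseDisjoint_componentsOf {α : Type*} [TopologicalSpace α] (Z : Set α) :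
    (componentsOf Z).PairwiseDisjoint id := by
  rintro _ ⟨x, -, rfl⟩ _ ⟨y, -, rfl⟩ hne
  rw [Function.onFun, id, id, disjoint_left]
  intro z hz hz'
  exact hne ((connectedComponentIn_eq hz).trans (connectedComponentIn_eq hz').symm)

theorem subset_of_mem_componentsOf {α : Type*} [TopologicalSpace α] {Z S : Set α}
    (h : S ∈ componentsOf Z) : S ⊆ Z := by
  obtain ⟨x, -, rfl⟩ := h
  exact connectedComponentIn_subset Z x

theorem isPreconnected_of_mem_componentsOf {α : Type*} [TopologicalSpace α] {Z S : Set α}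
    (h : S ∈ componentsOf Z) : IsPreconnected S := by
  obtain ⟨x, -, rfl⟩ := h
  exact isPreconnected_connectedComponentIn

theorem Set.finite_and_ncard_le_of_forall_finset {α : Type*} {S : Set α} {K : ℝ}
    (h : ∀ A : Finset α, (A : Set α) ⊆ S → (A.card : ℝ) ≤ K) :
    S.Finite ∧ (S.ncard : ℝ) ≤ K := by
  have hf : S.Finite := by
    by_contra hS
    obtain ⟨A, hA, hc⟩ := Set.Infinite.exists_subset_card_eq hS (⌊K⌋₊ + 1)
    have h1 := h A hA
    rw [hc] at h1
    push_cast at h1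
    exact absurd (Nat.lt_floor_add_one K) (not_lt.2 h1)
  refine ⟨hf, ?_⟩
  have := h hf.toFinset (by simp)
  rwa [← Set.ncard_eq_toFinset_card S hf] at this

/-- The identification of the complex plane with the Euclidean plane. -/
noncomputable def planeEquiv : ℂ ≃ₗᵢ[ℝ] EuclideanSpace ℝ (Fin 2) :=
  Complex.orthonormalBasisOneI.repr

theorem planeEquiv_one : planeEquiv 1 = EuclideanSpace.single 0 1 := by
  ext i; fin_cases i <;> simp [planeEquiv]

theorem planeEquiv_I : planeEquiv Complex.I = EuclideanSpace.single 1 1 := by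
  ext i; fin_cases i <;> simp [planeEquiv]

theorem closure_preimage_planeEquiv (S : Set (EuclideanSpace ℝ (Fin 2))) :
    closure (planeEquiv ⁻¹' S) = planeEquiv ⁻¹' closure S :=
  (planeEquiv.toHomeomorph.preimage_closure S).symm

theorem frontier_preimage_planeEquiv (S : Set (EuclideanSpace ℝ (Fin 2))) :
    frontier (planeEquiv ⁻¹' S) = planeEquiv ⁻¹' frontier S :=
  (planeEquiv.toHomeomorph.preimage_frontier S).symm

theorem fderiv_comp_planeEquiv {f : EuclideanSpace ℝ (Fin 2) → ℝ} (hf : Differentiable ℝ f)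
    (z h : ℂ) :
    fderiv ℝ (fun w => f (planeEquiv w)) z h = fderiv ℝ f (planeEquiv z) (planeEquiv h) := by
  have := (hf (planeEquiv z)).hasFDerivAt.comp z
    (planeEquiv.toContinuousLinearEquiv.toContinuousLinearMap.hasFDerivAt (x := z))
  exact congrArg (· h) this.fderiv

theorem fderiv_fderiv_comp_planeEquiv {f : EuclideanSpace ℝ (Fin 2) → ℝ}
    (hf : ContDiff ℝ (⊤ : ℕ∞) f) (z h : ℂ) :
    fderiv ℝ (fun y => fderiv ℝ (fun w => f (planeEquiv w)) y h) z h =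
      fderiv ℝ (fun y => fderiv ℝ f y (planeEquiv h)) (planeEquiv z) (planeEquiv h) := by
  have hd : ContDiff ℝ 1 (fderiv ℝ f) :=
    hf.fderiv_right (WithTop.coe_le_coe.2 (le_top (a := (2 : ℕ∞))))
  have hd' : ContDiff ℝ 1 fun y => fderiv ℝ f y (planeEquiv h) := hd.clm_apply contDiff_const
  have hdf : Differentiable ℝ f := hf.differentiable (by simp)
  simp only [fderiv_comp_planeEquiv hdf]
  exact fderiv_comp_planeEquiv (hd'.differentiable one_ne_zero) z h

theorem lap2_congr {f g : EuclideanSpace ℝ (Fin 2) → ℝ} {x : EuclideanSpace ℝ (Fin 2)}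
    (h : f =ᶠ[𝓝 x] g) : lap2 f x = lap2 g x := by
  unfold lap2
  refine Finset.sum_congr rfl fun i _ => ?_
  have : (fun y => fderiv ℝ f y (EuclideanSpace.single i 1)) =ᶠ[𝓝 x]
      fun y => fderiv ℝ g y (EuclideanSpace.single i 1) := by
    filter_upwards [h.fderiv (𝕜 := ℝ)] with y hy
    rw [hy]
  rw [this.fderiv_eq]

theorem helmholtzPair_comp_planeEquiv {Ω : Set (EuclideanSpace ℝ (Fin 2))} {lam : ℝ}
    {φ f : EuclideanSpace ℝ (Fin 2) → ℝ} (hf : ContDiff ℝ (⊤ : ℕ∞) f)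
    (hfφ : ∀ x ∈ closure Ω, f =ᶠ[𝓝 x] φ) (hφ : ∀ x ∈ Ω, lap2 φ x = -lam ^ 2 * φ x) :
    HelmholtzPair (planeEquiv ⁻¹' Ω) (lam ^ 2 / 4) (fun w => f (planeEquiv w))
      (wirtDeriv fun w => f (planeEquiv w)) := by
  refine helmholtzPair_wirtDeriv
    (hf.comp planeEquiv.toContinuousLinearEquiv.contDiff) fun x hx => ?_
  have h := hfφ _ (subset_closure hx)
  rw [fderiv_fderiv_comp_planeEquiv hf, fderiv_fderiv_comp_planeEquiv hf, planeEquiv_one,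
    planeEquiv_I, h.eq_of_nhds, ← hφ _ hx, ← lap2_congr h, lap2, Fin.sum_univ_two]

theorem conj_wirtDeriv_mul_of_gradient {f : EuclideanSpace ℝ (Fin 2) → ℝ}
    (hf : Differentiable ℝ f) {z u : ℂ} {c d : ℝ}
    (h : gradient f (planeEquiv z) = c • planeEquiv u) :
    (starRingEnd ℂ) (wirtDeriv (fun w => f (planeEquiv w)) z * (d * u)) =
      wirtDeriv (fun w => f (planeEquiv w)) z * (d * u) := by
  have key : fderiv ℝ (fun w => f (planeEquiv w)) z (Complex.I * (d * u)) = 0 := by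
    rw [fderiv_comp_planeEquiv hf, (hf (planeEquiv z)).hasGradientAt.hasFDerivAt.fderiv, h]
    rw [InnerProductSpace.toDual_apply_apply, real_inner_smul_left,
      LinearIsometryEquiv.inner_map_map, Complex.inner]
    simp; ring_nf; simp
  rw [wirtDeriv_mul, key]
  simp [← Complex.ofReal_ofNat, Complex.conj_ofReal]

theorem exists_collar_planeEquiv {Ω : Set (EuclideanSpace ℝ (Fin 2))} (hΩo : IsOpen Ω)
    (hΩb : Bornology.IsBounded Ω) {L : ℝ} (hL : 0 < L) {γ : ℝ → EuclideanSpace ℝ (Fin 2)}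
    (hγa : AnalyticOnNhd ℝ γ univ) (hper : ∀ t, γ (t + L) = γ t) (hunit : ∀ t, ‖deriv γ t‖ = 1)
    (hinj : InjOn γ (Ico 0 L)) (himg : γ '' Ico 0 L = frontier Ω) :
    ∃ Γ δ, Collar (planeEquiv ⁻¹' Ω) Γ L δ ∧ ∀ t : ℝ, ∃ t', planeEquiv (Γ t) = γ t' ∧
      ∃ c : ℝ, deriv Γ t = c * planeEquiv.symm (deriv γ t') := by
  have hder : ∀ t, HasDerivAt (fun t => planeEquiv.symm (γ t)) (planeEquiv.symm (deriv γ t)) t :=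
    fun t => (planeEquiv.symm.toContinuousLinearEquiv.toContinuousLinearMap.hasFDerivAt
      (x := γ t)).comp_hasDerivAt t (hγa t (mem_univ t)).differentiableAt.hasDerivAt
  have hbdd : Bornology.IsBounded (planeEquiv ⁻¹' Ω) := by
    have := planeEquiv.symm.lipschitz.isBounded_image hΩb
    rwa [LinearIsometryEquiv.image_eq_preimage_symm, LinearIsometryEquiv.symm_symm] at this
  obtain ⟨Γ, δ, hC, hΓ⟩ := exists_collar (Ω := planeEquiv ⁻¹' Ω)
    (γ := fun t => planeEquiv.symm (γ t)) (hΩo.preimage planeEquiv.continuous) hbdd hL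
    (fun t => (planeEquiv.symm.toContinuousLinearEquiv.toContinuousLinearMap.analyticAt
      _).fun_comp (hγa t (mem_univ t)))
    (fun t => by rw [hper]) (fun t => by
      rw [(hder t).deriv, ← norm_ne_zero_iff, LinearIsometryEquiv.norm_map, hunit]
      exact one_ne_zero)
    (planeEquiv.symm.injective.comp_injOn hinj)
    (by
      rw [frontier_preimage_planeEquiv, ← himg, ← LinearIsometryEquiv.symm_symm planeEquiv,
        ← LinearIsometryEquiv.image_eq_preimage_symm, image_image]
      rfl)
  refine ⟨Γ, δ, hC, fun t => ?_⟩
  obtain ⟨t', h1, c, h2⟩ := hΓ t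
  rw [(hder t').deriv] at h2
  exact ⟨t', by rw [h1, LinearIsometryEquiv.apply_symm_apply], c, h2⟩

theorem Collar.exists_of_mem_frontier {Ω : Set (EuclideanSpace ℝ (Fin 2))} {Γ : ℂ → ℂ} {L δ : ℝ}
    (hC : Collar (planeEquiv ⁻¹' Ω) Γ L δ) {x : EuclideanSpace ℝ (Fin 2)} (hx : x ∈ frontier Ω) :
    ∃ t : ℝ, planeEquiv (Γ t) = x := by
  have h : planeEquiv.symm x ∈ frontier (planeEquiv ⁻¹' Ω) := by
    rw [frontier_preimage_planeEquiv]
    simpa using hx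
  rw [hC.front] at h
  obtain ⟨z, hz, hzx⟩ := h
  refine ⟨z.re, ?_⟩
  have : (z.re : ℂ) = z := Complex.ext (by simp) (by simpa using (show z.im = 0 from hz).symm)
  rw [this, hzx, LinearIsometryEquiv.apply_symm_apply]

theorem exists_ne_zero_of_not_eqOn {Ω : Set (EuclideanSpace ℝ (Fin 2))}
    {φ f : EuclideanSpace ℝ (Fin 2) → ℝ} (hfφ : ∀ x ∈ closure Ω, f =ᶠ[𝓝 x] φ)
    (h : ¬ EqOn φ 0 (closure Ω)) : ∃ z ∈ closure (planeEquiv ⁻¹' Ω), f (planeEquiv z) ≠ 0 := by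
  simp only [EqOn, not_forall] at h
  obtain ⟨x, hx, hne⟩ := h
  refine ⟨planeEquiv.symm x, ?_, ?_⟩
  · rw [closure_preimage_planeEquiv]
    simpa using hx
  · rw [LinearIsometryEquiv.apply_symm_apply, (hfφ x hx).eq_of_nhds]
    exact hne

theorem card_le_of_planeEquiv_preimage {F : Set (Set (EuclideanSpace ℝ (Fin 2)))} {K : ℝ}
    (hF : F.PairwiseDisjoint id) {P : Set ℂ → Prop} (hP : ∀ S ∈ F, P (planeEquiv ⁻¹' S))
    (h : ∀ A : Finset (Set ℂ), (A : Set (Set ℂ)).PairwiseDisjoint id → (∀ S ∈ A, P S) →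
      (A.card : ℝ) ≤ K) : F.Finite ∧ (F.ncard : ℝ) ≤ K := by
  classical
  refine finite_and_ncard_le_of_forall_finset fun A hA => ?_
  rw [← Finset.card_image_of_injective A planeEquiv.surjective.preimage_injective]
  refine h _ ?_ ?_
  · rw [Finset.coe_image]
    rintro _ ⟨S, hS, rfl⟩ _ ⟨T, hT, rfl⟩ hne
    exact (hF (hA hS) (hA hT) fun he => hne (by rw [he])).preimage _
  · intro S hS
    obtain ⟨T, hT, rfl⟩ := Finset.mem_image.1 hS
    exact hP T (hA hT)

/-- **Counting nodal components touching the boundary** (Toth–Zelditch).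
For a bounded plane domain Ω with connected real-analytic boundary there is a
constant C = C(Ω) > 0 such that for every λ > 0: (i) every Neumann
eigenfunction with eigenvalue λ² has at most C(1+λ) nodal components (of the
nodal set in the closed domain) meeting ∂Ω, and (ii) every Dirichlet
eigenfunction with eigenvalue λ² has at most C(1+λ) nodal components (of the
interior nodal set) whose closure meets ∂Ω. -/
theorem boundary_nodal_components_bound
    (Ω : Set (EuclideanSpace ℝ (Fin 2))) (hΩo : IsOpen Ω)
    (hΩb : Bornology.IsBounded Ω)
    (L : ℝ) (hL : 0 < L) (γ : ℝ → EuclideanSpace ℝ (Fin 2))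
    (hγa : AnalyticOnNhd ℝ γ Set.univ)
    (hper : ∀ t, γ (t + L) = γ t)
    (hunit : ∀ t, ‖deriv γ t‖ = 1)
    (hinj : Set.InjOn γ (Set.Ico 0 L))
    (himg : γ '' Set.Ico 0 L = frontier Ω) :
    ∃ C > (0 : ℝ), ∀ lam : ℝ, 0 < lam →
      (∀ φ : EuclideanSpace ℝ (Fin 2) → ℝ,
        IsNeumannEigenfunction Ω γ lam φ →
        {S ∈ componentsOf {x ∈ closure Ω | φ x = 0} | (S ∩ frontier Ω).Nonempty}.Finite ∧
          ({S ∈ componentsOf {x ∈ closure Ω | φ x = 0} |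
              (S ∩ frontier Ω).Nonempty}.ncard : ℝ) ≤ C * (1 + lam)) ∧
      (∀ φ : EuclideanSpace ℝ (Fin 2) → ℝ,
        IsDirichletEigenfunction Ω γ lam φ →
        {S ∈ componentsOf {x ∈ Ω | φ x = 0} | (closure S ∩ frontier Ω).Nonempty}.Finite ∧
          ({S ∈ componentsOf {x ∈ Ω | φ x = 0} |
              (closure S ∩ frontier Ω).Nonempty}.ncard : ℝ) ≤ C * (1 + lam)) := by
  obtain ⟨Γ, δ, hC, hΓ⟩ := exists_collar_planeEquiv hΩo hΩb hL hγa hper hunit hinj himg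
  obtain ⟨C₁, hC₁, h₁⟩ := HelmholtzPair.exists_neumann_card_le hC
  obtain ⟨C₂, -, h₂⟩ := HelmholtzPair.exists_dirichlet_card_le hC
  have hfcl : ∀ t : ℝ, γ t ∈ closure Ω := fun t => by
    have hp : Function.Periodic γ L := hper
    obtain ⟨k, hk, -⟩ := existsUnique_add_zsmul_mem_Ico hL t 0
    rw [zero_add, zsmul_eq_mul] at hk
    rw [← hp.int_mul k t]
    exact frontier_subset_closure (himg ▸ mem_image_of_mem γ hk)
  refine ⟨max C₁ C₂, lt_max_of_lt_left hC₁, fun lam hlam => ⟨?_, ?_⟩⟩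
  · rintro φ ⟨⟨U, hU, hΩU, hφU⟩, hne, hlap, hbd⟩
    obtain ⟨f, hf, hfφ⟩ := exists_contDiff_eventuallyEq isClosed_closure hU hΩU hφU
    have hdf : Differentiable ℝ f := hf.differentiable (by simp)
    refine card_le_of_planeEquiv_preimage
      ((pairwiseDisjoint_componentsOf _).subset fun S hS => hS.1)
      (P := fun S => ∃ t : ℝ, Γ t ∈ S ∧ f (planeEquiv (Γ t)) = 0) ?_ fun A hA hAP =>
      (h₁ lam hlam _ _ (helmholtzPair_comp_planeEquiv hf hfφ hlap)
        (exists_ne_zero_of_not_eqOn hfφ hne) (fun t => ?_) A hA hAP).trans ?_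
    · rintro S ⟨hS, x, hxS, hxf⟩
      obtain ⟨t, rfl⟩ := hC.exists_of_mem_frontier hxf
      obtain ⟨hcl, h0⟩ := subset_of_mem_componentsOf hS hxS
      exact ⟨t, hxS, by rw [(hfφ _ hcl).eq_of_nhds, h0]⟩
    · obtain ⟨t', ht', d, hd⟩ := hΓ t
      obtain ⟨c, hc⟩ := hbd t'
      rw [hd]
      refine conj_wirtDeriv_mul_of_gradient hdf (c := c) ?_
      rw [ht', LinearIsometryEquiv.apply_symm_apply, ← hc, gradient, gradient,
        (hfφ _ (hfcl t')).fderiv_eq]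
    · exact mul_le_mul_of_nonneg_right (le_max_left _ _) (by linarith)
  · rintro φ ⟨⟨U, hU, hΩU, hφU⟩, hne, hlap, hbd⟩
    obtain ⟨f, hf, hfφ⟩ := exists_contDiff_eventuallyEq isClosed_closure hU hΩU hφU
    refine card_le_of_planeEquiv_preimage
      ((pairwiseDisjoint_componentsOf _).subset fun S hS => hS.1)
      (P := fun S => IsPreconnected S ∧
        (∀ z ∈ S, z ∈ planeEquiv ⁻¹' Ω ∧ f (planeEquiv z) = 0) ∧ ∃ t : ℝ, Γ t ∈ closure S)
      ?_ fun A hA hAP =>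
      (h₂ lam hlam _ _ (helmholtzPair_comp_planeEquiv hf hfφ hlap)
        (hf.comp planeEquiv.toContinuousLinearEquiv.contDiff)
        (exists_ne_zero_of_not_eqOn hfφ hne) (fun t => ?_) A hA hAP).trans ?_
    · rintro S ⟨hS, x, hxS, hxf⟩
      refine ⟨planeEquiv.toHomeomorph.isPreconnected_preimage.2
        (isPreconnected_of_mem_componentsOf hS), fun z hz => ?_, ?_⟩
      · obtain ⟨hzΩ, h0⟩ := subset_of_mem_componentsOf hS hz
        exact ⟨hzΩ, by rw [(hfφ _ (subset_closure hzΩ)).eq_of_nhds, h0]⟩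
      · obtain ⟨t, rfl⟩ := hC.exists_of_mem_frontier hxf
        refine ⟨t, ?_⟩
        rw [closure_preimage_planeEquiv]
        exact hxS
    · obtain ⟨t', ht', -⟩ := hΓ t
      rw [ht', (hfφ _ (hfcl t')).eq_of_nhds, hbd]
    · exact mul_le_mul_of_nonneg_right (le_max_right _ _) (by linarith)
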